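/- Lyapunov exponent of the Szegő cocycle, singular case: Let t ∈ (−1,1) with t ≠ 0, λ₁ ∈ (0,1), λ₂ ∈ [(1−t²)/(1+t²), 1), Φ irrational, θ ∈ ℝ, and let z belong to the spectrum Σ of W = W_{λ₁,λ₂,Φ,θ}. Then the Lyapunov exponent L(Φ, S_z⁺) exists and: (i) if λ₁ ∈ [(1−t²)/(1+t²), 1), then L(Φ, S_z⁺) = 0; (ii) if λ₁ ∈ (0, (1−t²)/(1+t²)), then L(Φ, S_z⁺) = ln[ ((1−t²)λ₁′ + √((1+t²)²λ₁′² − 4t²)) / (2|t|λ₁) ]. -/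

import Mathlib

open MeasureTheory

noncomputable section

/-- `λ' = √(1 - λ²)`. -/
def sq1 (l : ℝ) : ℝ := Real.sqrt (1 - l ^ 2)

/-- The sampling function `f(x) = (1/k)(2 t λ₂ cos(2πx) + (t²−1) λ₂′)` with `k = −(1+t²)`. -/
def fS (t l x : ℝ) : ℝ :=
  (1 / (-(1 + t ^ 2))) * (2 * t * l * Real.cos (2 * Real.pi * x) + (t ^ 2 - 1) * sq1 l)

/-- The sampling function `g(x) = (1/k)(−t² λ₂ e^{2πix} + λ₂ e^{−2πix} + 2 t λ₂′)`. -/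
def gS (t l x : ℝ) : ℂ :=
  ((1 / (-(1 + t ^ 2)) : ℝ) : ℂ) *
    (-(((t ^ 2 * l : ℝ)) : ℂ) * Complex.exp (2 * Real.pi * x * Complex.I)
      + ((l : ℝ) : ℂ) * Complex.exp (-(2 * Real.pi * x) * Complex.I)
      + ((2 * t * sq1 l : ℝ) : ℂ))

/-- The Hilbert space `ℓ²(ℤ; ℂ²)`. -/
abbrev H2 := lp (fun _ : ℤ => EuclideanSpace ℂ (Fin 2)) 2

/-- The `+` component of `W ψ = S_{λ₁} Q ψ` at site `n`. -/
def wPlus (t l1 l2 Φ θ : ℝ) (ψ : ℤ → EuclideanSpace ℂ (Fin 2)) (n : ℤ) : ℂ :=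
  (l1 : ℂ) * ((fS t l2 (θ + ((n : ℝ) - 1) * Φ) : ℂ) * ψ (n - 1) 0
      - gS t l2 (θ + ((n : ℝ) - 1) * Φ) * ψ (n - 1) 1)
    - (sq1 l1 : ℂ) * ((starRingEnd ℂ) (gS t l2 (θ + (n : ℝ) * Φ)) * ψ n 0
      + (fS t l2 (θ + (n : ℝ) * Φ) : ℂ) * ψ n 1)

/-- The `−` component of `W ψ = S_{λ₁} Q ψ` at site `n`. -/
def wMinus (t l1 l2 Φ θ : ℝ) (ψ : ℤ → EuclideanSpace ℂ (Fin 2)) (n : ℤ) : ℂ :=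
  (l1 : ℂ) * ((starRingEnd ℂ) (gS t l2 (θ + ((n : ℝ) + 1) * Φ)) * ψ (n + 1) 0
      + (fS t l2 (θ + ((n : ℝ) + 1) * Φ) : ℂ) * ψ (n + 1) 1)
    + (sq1 l1 : ℂ) * ((fS t l2 (θ + (n : ℝ) * Φ) : ℂ) * ψ n 0
      - gS t l2 (θ + (n : ℝ) * Φ) * ψ n 1)

/-- `ψ` is a (generalized) eigenvector of `W_{λ₁,λ₂,Φ,θ}` with eigenvalue `z`. -/
def IsEigen (t l1 l2 Φ θ : ℝ) (z : ℂ) (ψ : ℤ → EuclideanSpace ℂ (Fin 2)) : Prop :=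
  ∀ n : ℤ, wPlus t l1 l2 Φ θ ψ n = z * ψ n 0 ∧ wMinus t l1 l2 Φ θ ψ n = z * ψ n 1


/-- `p(w) = (1/k)(t²λ₂e^{2πiw} − λ₂e^{−2πiw} − 2tλ₂′)`. -/
def pS (t l2 : ℝ) (w : ℂ) : ℂ :=
  (1 / (-(1 + (t : ℂ) ^ 2))) *
    ((t : ℂ) ^ 2 * (l2 : ℂ) * Complex.exp (2 * Real.pi * Complex.I * w)
      - (l2 : ℂ) * Complex.exp (-(2 * Real.pi * Complex.I * w))
      - 2 * (t : ℂ) * (sq1 l2 : ℂ))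

/-- `q(w) = (1/k)(t²λ₂e^{−2πiw} − λ₂e^{2πiw} − 2tλ₂′)`. -/
def qS (t l2 : ℝ) (w : ℂ) : ℂ :=
  (1 / (-(1 + (t : ℂ) ^ 2))) *
    ((t : ℂ) ^ 2 * (l2 : ℂ) * Complex.exp (-(2 * Real.pi * Complex.I * w))
      - (l2 : ℂ) * Complex.exp (2 * Real.pi * Complex.I * w)
      - 2 * (t : ℂ) * (sq1 l2 : ℂ))

/-- The matrix `D_z(w)`. -/
def Dz (t l1 l2 : ℝ) (z w : ℂ) : Matrix (Fin 2) (Fin 2) ℂ :=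
  !![z ^ 2 - (sq1 l1 : ℂ) * z * pS t l2 w, qS t l2 w * z - (sq1 l1 : ℂ);
     -(sq1 l1 : ℂ) * z ^ 2 + pS t l2 w * z, -(sq1 l1 : ℂ) * z * qS t l2 w + 1]

/-- The two-step Szegő cocycle map `S_z⁺(x) = (z⁻¹/(λ₁|f(x)|)) D_z(x)`. -/
def SzP (t l1 l2 : ℝ) (z : ℂ) (x : ℝ) : Matrix (Fin 2) (Fin 2) ℂ :=
  (z⁻¹ / ((l1 : ℂ) * ((|fS t l2 x| : ℝ) : ℂ))) • Dz t l1 l2 z (x : ℂ)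

/-- `n`-step cocycle product `Mⁿ(x) = M(x+(n−1)Φ) ⋯ M(x+Φ) M(x)`. -/
def coc (Φ : ℝ) (M : ℝ → Matrix (Fin 2) (Fin 2) ℂ) : ℕ → ℝ → Matrix (Fin 2) (Fin 2) ℂ
  | 0, _ => 1
  | n + 1, x => M (x + (n : ℝ) * Φ) * coc Φ M n x

attribute [local instance] Matrix.frobeniusNormedAddCommGroup

/-- The Lyapunov exponent of the cocycle `(Φ, M)` exists and equals `c`. -/
def HasLyap (Φ : ℝ) (M : ℝ → Matrix (Fin 2) (Fin 2) ℂ) (c : ℝ) : Prop :=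
  Filter.Tendsto
    (fun n : ℕ => (1 / (n : ℝ)) * ∫ x in (0:ℝ)..1, Real.log ‖coc Φ M n x‖)
    Filter.atTop (nhds c)

/-- The standard character `x ↦ e^{2πix}` of the unit circle. -/
def ec (x : UnitAddCircle) : ℂ := (AddCircle.toCircle x : ℂ)

lemma norm_ec (x : UnitAddCircle) : ‖ec x‖ = 1 := Circle.norm_coe _

lemma ec_add (x y : UnitAddCircle) : ec (x + y) = ec x * ec y := by
  simp [ec, AddCircle.toCircle_add]

lemma ec_coe (x : ℝ) : ec (x : UnitAddCircle) = Complex.exp (2 * Real.pi * x * Complex.I) := by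
  simp [ec, AddCircle.toCircle_apply_mk, Circle.coe_exp]

lemma ec_zero : ec 0 = 1 := by simp [ec]

lemma continuous_ec : Continuous ec :=
  continuous_subtype_val.comp AddCircle.continuous_toCircle

lemma ec_ne_zero (x : UnitAddCircle) : ec x ≠ 0 := by
  rw [← norm_pos_iff, norm_ec]; exact one_pos

lemma ec_sub (x y : UnitAddCircle) : ‖ec x - ec y‖ = ‖ec (x - y) - 1‖ := by
  have h : ec x = ec (x - y) * ec y := by rw [← ec_add]; simp
  have h2 : ec x - ec y = (ec (x - y) - 1) * ec y := by rw [h]; ring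
  rw [h2, norm_mul, norm_ec, mul_one]

lemma exists_rep (x : UnitAddCircle) : ∃ r : ℝ, (r : UnitAddCircle) = x ∧ |r| = ‖x‖ := by
  obtain ⟨r, rfl⟩ := QuotientAddGroup.mk_surjective x
  refine ⟨r - round r, ?_, ?_⟩
  · show ((r - round r : ℝ) : UnitAddCircle) = (r : UnitAddCircle)
    rw [AddCircle.coe_sub, sub_eq_self, AddCircle.coe_eq_zero_iff]
    exact ⟨round r, by simp⟩
  · exact (UnitAddCircle.norm_eq).symm

lemma norm_ec_sub_one_coe (r : ℝ) :
    ‖ec (r : UnitAddCircle) - 1‖ = 2 * |Real.sin (Real.pi * r)| := by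
  rw [ec_coe]
  have := Complex.norm_exp_I_mul_ofReal_sub_one (2 * Real.pi * r)
  rw [show Complex.I * ((2 * Real.pi * r : ℝ) : ℂ) = 2 * Real.pi * r * Complex.I by
    push_cast; ring] at this
  rw [this, norm_mul, show 2 * Real.pi * r / 2 = Real.pi * r by ring]
  simp

lemma norm_ec_sub_one_ge (x : UnitAddCircle) : 4 * ‖x‖ ≤ ‖ec x - 1‖ := by
  have hx : ‖x‖ ≤ 1 / 2 := by
    simpa using AddCircle.norm_le_half_period (1 : ℝ) (x := x) one_ne_zero
  obtain ⟨r, rfl, hr⟩ := exists_rep x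
  rw [norm_ec_sub_one_coe, ← hr]
  rw [← hr] at hx
  have h1 := Real.mul_le_sin (x := Real.pi * |r|) (by positivity)
    (by nlinarith [Real.pi_pos])
  have h2 : Real.sin (Real.pi * |r|) ≤ |Real.sin (Real.pi * r)| := by
    rcases abs_choice r with h | h <;> rw [h]
    · exact le_abs_self _
    · rw [mul_neg, Real.sin_neg]; exact neg_le_abs _
  have h3 : 2 / Real.pi * (Real.pi * |r|) = 2 * |r| := by
    field_simp
  linarith

lemma norm_ec_sub_one_le (x : UnitAddCircle) : ‖ec x - 1‖ ≤ 2 * Real.pi * ‖x‖ := by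
  obtain ⟨r, rfl, hr⟩ := exists_rep x
  rw [norm_ec_sub_one_coe, ← hr]
  have := Real.abs_sin_le_abs (x := Real.pi * r)
  rw [abs_mul, abs_of_pos Real.pi_pos] at this
  linarith

lemma norm_ec_sub_le (x y : UnitAddCircle) : ‖ec x - ec y‖ ≤ 2 * Real.pi * ‖x - y‖ := by
  rw [ec_sub]; exact norm_ec_sub_one_le _

instance : IsProbabilityMeasure (volume : Measure UnitAddCircle) :=
  ⟨UnitAddCircle.measure_univ⟩

lemma integral_ec (h : ℂ → ℝ) :
    ∫ x : UnitAddCircle, h (ec x) = Real.circleAverage h 0 1 := by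
  rw [← UnitAddCircle.intervalIntegral_preimage 0, Real.circleAverage_def]
  have := intervalIntegral.integral_comp_mul_left (a := 0) (b := 1)
    (fun θ => h (circleMap 0 1 θ)) (c := 2 * Real.pi) (by positivity)
  simp only [mul_zero, mul_one] at this
  rw [← this, zero_add]
  refine intervalIntegral.integral_congr fun x _ => ?_
  simp only [ec_coe, circleMap]
  congr 1
  push_cast
  simp

lemma integral_log_ec_sub (ζ : ℂ) :
    ∫ x : UnitAddCircle, Real.log ‖ec x - ζ‖ = Real.posLog ‖ζ‖ := by
  rw [integral_ec (fun w => Real.log ‖w - ζ‖), circleAverage_log_norm_sub_const_eq_posLog]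

lemma integrable_ec {h : ℂ → ℝ} (hm : Measurable h) (hh : CircleIntegrable h 0 1) :
    Integrable (fun x : UnitAddCircle => h (ec x)) := by
  have h1 : IntervalIntegrable (fun x : ℝ => h (ec (x : UnitAddCircle))) volume 0 1 := by
    have := (IntervalIntegrable.comp_mul_left (c := 2 * Real.pi) hh)
    simp only [zero_div] at this
    rw [div_self (by positivity)] at this
    refine this.congr_ae (Filter.Eventually.of_forall fun x => ?_)
    simp only [ec_coe, circleMap]
    congr 1
    push_cast
    simp
  rw [intervalIntegrable_iff_integrableOn_Ioc_of_le zero_le_one] at h1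
  have hmp := UnitAddCircle.measurePreserving_mk 0
  rw [zero_add] at hmp
  exact (hmp.integrable_comp (hm.comp continuous_ec.measurable).aestronglyMeasurable).1 h1

lemma integrable_log_ec_sub (ζ : ℂ) :
    Integrable (fun x : UnitAddCircle => Real.log ‖ec x - ζ‖) :=
  integrable_ec (h := fun w => Real.log ‖w - ζ‖) (by fun_prop)
    (circleIntegrable_log_norm_sub_const 1)

lemma ae_ec_ne (ζ : ℂ) : ∀ᵐ x : UnitAddCircle, ec x ≠ ζ := by
  have hs : Set.Subsingleton {x : UnitAddCircle | ¬ ec x ≠ ζ} := by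
    intro x hx y hy
    simp only [ne_eq, not_not, Set.mem_ofPred_eq] at hx hy
    have : AddCircle.toCircle x = AddCircle.toCircle y := Subtype.ext (hx.trans hy.symm)
    exact AddCircle.injective_toCircle one_ne_zero this
  rw [ae_iff]
  rcases hs.eq_empty_or_singleton with h | ⟨x, h⟩
  · rw [h]; exact measure_empty
  · rw [h, ← Metric.closedBall_zero, AddCircle.volume_closedBall]
    simp

lemma exists_joukowski (r ν : ℝ) (hr : 0 ≤ r) (hν : 0 < ν) :
    ∃ A : ℝ, 0 < A ∧ r ≤ A ^ 2 ∧ A ^ 2 + r ^ 2 / A ^ 2 = 1 + r ^ 2 + ν ^ 2 ∧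
      A ≤ max 1 r + ν := by
  set S := 1 + r ^ 2 + ν ^ 2
  have hS : 2 * r ≤ S := by nlinarith [sq_nonneg (r - 1)]
  have hS1 : 1 ≤ S := by nlinarith
  have hd : 0 ≤ S ^ 2 - 4 * r ^ 2 := by nlinarith
  set y := (S + Real.sqrt (S ^ 2 - 4 * r ^ 2)) / 2 with hy
  have hsq := Real.sq_sqrt hd
  have hs0 := Real.sqrt_nonneg (S ^ 2 - 4 * r ^ 2)
  have hypos : 0 < y := by rw [hy]; linarith
  have hyr : r ≤ y := by rw [hy]; linarith
  have hyeq : y ^ 2 + r ^ 2 = S * y := by rw [hy]; nlinarith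
  have hA := Real.sq_sqrt hypos.le
  refine ⟨Real.sqrt y, Real.sqrt_pos.2 hypos, by rw [hA]; exact hyr, ?_, ?_⟩
  · rw [hA]; field_simp; linarith
  · by_contra hcon
    push Not at hcon
    set A := Real.sqrt y
    have hA0 : 0 ≤ A := Real.sqrt_nonneg _
    have h1 : (y - 1) * (y - r ^ 2) = ν ^ 2 * y := by
      have : S = 1 + r ^ 2 + ν ^ 2 := rfl
      rw [this] at hyeq; linear_combination hyeq
    set m := max 1 r
    have hm1 : 1 ≤ m := le_max_left _ _
    have hmr : r ≤ m := le_max_right _ _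
    have h2 : ν * A < y - m ^ 2 := by
      have : m * m < A * (A - ν) := mul_lt_mul'' (by linarith) (by linarith) (by linarith)
        (by linarith)
      linarith
    have hd0 : 0 ≤ y - m ^ 2 := le_trans (by positivity) h2.le
    have h3 : (ν * A) ^ 2 < (y - m ^ 2) ^ 2 :=
      pow_lt_pow_left₀ h2 (by positivity) two_ne_zero
    have hp : 0 ≤ m ^ 2 - 1 := sub_nonneg.2 (one_le_pow₀ hm1)
    have hq : 0 ≤ m ^ 2 - r ^ 2 := sub_nonneg.2 (pow_le_pow_left₀ hr hmr 2)
    have h4 : (y - 1) * (y - r ^ 2) = (y - m ^ 2) ^ 2 + (y - m ^ 2) * (m ^ 2 - 1) +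
      (y - m ^ 2) * (m ^ 2 - r ^ 2) + (m ^ 2 - 1) * (m ^ 2 - r ^ 2) := by ring
    have h5 : (ν * A) ^ 2 = ν ^ 2 * y := by rw [mul_pow, hA]
    have h6 := mul_nonneg hd0 hp
    have h7 := mul_nonneg hd0 hq
    have h8 := mul_nonneg hp hq
    rw [← h5, h4] at h1
    clear_value m
    generalize (y - m ^ 2) * (m ^ 2 - 1) = X1 at *
    generalize (y - m ^ 2) * (m ^ 2 - r ^ 2) = X2 at *
    generalize (m ^ 2 - 1) * (m ^ 2 - r ^ 2) = X3 at *
    generalize (y - m ^ 2) ^ 2 = X4 at *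
    generalize (ν * A) ^ 2 = X5 at *
    linarith only [h1, h3, h6, h7, h8]

lemma log_max_le_log_sqrt (ν g : ℝ) (hν : 0 < ν) :
    Real.log (max g ν) ≤ Real.log (Real.sqrt (g ^ 2 + ν ^ 2)) := by
  refine Real.log_le_log (lt_max_of_lt_right hν) (max_le ?_ ?_)
  · exact Real.le_sqrt_of_sq_le (by nlinarith)
  · exact Real.le_sqrt_of_sq_le (by nlinarith)

lemma abs_log_max_le (ν g : ℝ) :
    |Real.log (max g ν)| ≤ |Real.log g| + |Real.log ν| := by
  rcases max_choice g ν with h | h <;> rw [h]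
  · linarith [abs_nonneg (Real.log ν)]
  · linarith [abs_nonneg (Real.log g)]

lemma integrable_log_max {f : UnitAddCircle → ℝ} (hm : Measurable f)
    (hf : Integrable fun x => Real.log (f x)) (ν : ℝ) :
    Integrable fun x => Real.log (max (f x) ν) := by
  refine Integrable.mono' (hf.abs.add (integrable_const |Real.log ν|)) ?_ ?_
  · exact (Real.measurable_log.comp (hm.max measurable_const)).aestronglyMeasurable
  · exact Filter.Eventually.of_forall fun x => abs_log_max_le _ _

lemma integral_log_max_ec_le (ζ : ℂ) (ν : ℝ) (hν : 0 < ν) :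
    ∫ x : UnitAddCircle, Real.log (max ‖ec x - ζ‖ ν) ≤ Real.posLog ‖ζ‖ + ν := by
  obtain ⟨A, hA, hrA, hAeq, hAle⟩ := exists_joukowski ‖ζ‖ ν (norm_nonneg _) hν
  set ζ' : ℂ := ζ / ((A ^ 2 : ℝ) : ℂ) with hζ'
  have hn : ‖ζ'‖ ≤ 1 := by
    rw [hζ', norm_div, Complex.norm_real, Real.norm_of_nonneg (by positivity)]
    exact (div_le_one (by positivity)).2 hrA
  have key : ∀ x, ‖ec x - ζ‖ ^ 2 + ν ^ 2 = (A * ‖ec x - ζ'‖) ^ 2 := by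
    intro x
    have h1 : Complex.normSq (ec x - ζ) + ν ^ 2 = A ^ 2 * Complex.normSq (ec x - ζ') := by
      have he : Complex.normSq (ec x) = 1 := by
        rw [Complex.normSq_eq_norm_sq, norm_ec]; norm_num
      have hzz : ‖ζ‖ ^ 2 = Complex.normSq ζ := (Complex.normSq_eq_norm_sq ζ).symm
      have hAA : A ^ 2 ≠ 0 := by positivity
      rw [hzz] at hAeq
      simp only [Complex.normSq_apply, Complex.sub_re, Complex.sub_im] at *
      have hr : ζ'.re = ζ.re / A ^ 2 := by rw [hζ', Complex.div_ofReal_re]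
      have hi : ζ'.im = ζ.im / A ^ 2 := by rw [hζ', Complex.div_ofReal_im]
      rw [hr, hi]
      field_simp
      field_simp at hAeq
      linear_combination (A ^ 2 - A ^ 4) * he - hAeq
    rw [mul_pow, ← Complex.normSq_eq_norm_sq, ← Complex.normSq_eq_norm_sq, h1]
  have hle : ∀ᵐ x : UnitAddCircle,
      Real.log (max ‖ec x - ζ‖ ν) ≤ Real.log A + Real.log ‖ec x - ζ'‖ := by
    refine Filter.Eventually.of_forall fun x => ?_
    refine (log_max_le_log_sqrt ν _ hν).trans ?_
    rw [key, Real.sqrt_sq (by positivity)]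
    have : ‖ec x - ζ'‖ ≠ 0 := by
      intro h0
      have := key x
      rw [h0] at this
      nlinarith [sq_nonneg ‖ec x - ζ‖, pow_pos hν 2]
    rw [Real.log_mul hA.ne' this]
  have hmeas : Measurable fun x : UnitAddCircle => ‖ec x - ζ‖ := by
    have := continuous_ec.measurable
    fun_prop
  have h := integral_mono_ae (integrable_log_max hmeas (integrable_log_ec_sub ζ) ν)
    ((integrable_const (Real.log A)).add (integrable_log_ec_sub ζ')) hle
  refine h.trans ?_
  have h2 : ∫ x : UnitAddCircle, (Real.log A + Real.log ‖ec x - ζ'‖)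
      = Real.log A + Real.posLog ‖ζ'‖ := by
    rw [integral_add (integrable_const _) (integrable_log_ec_sub ζ'), integral_log_ec_sub]
    simp
  have h3 : Real.posLog ‖ζ'‖ = 0 := by
    rw [Real.posLog_eq_zero_iff, abs_of_nonneg (norm_nonneg _)]; exact hn
  have h4 : Real.log A ≤ Real.posLog ‖ζ‖ + ν := by
    rw [Real.posLog_eq_log_max_one (norm_nonneg _)]
    set m := max 1 ‖ζ‖
    have hm1 : 1 ≤ m := le_max_left _ _
    have : A ≤ m * Real.exp ν := by
      nlinarith [Real.add_one_le_exp ν]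
    calc Real.log A ≤ Real.log (m * Real.exp ν) := Real.log_le_log hA this
      _ = Real.log m + ν := by
        rw [Real.log_mul (by positivity) (Real.exp_pos _).ne', Real.log_exp]
  calc _ = _ := h2
    _ ≤ _ := by rw [h3]; linarith

/-- The logarithmic excess `(-log u - s)⁺`. -/
def logExcess (s u : ℝ) : ℝ := max 0 (-Real.log u - s)

lemma logExcess_nonneg (s u : ℝ) : 0 ≤ logExcess s u := le_max_left _ _

lemma integrable_logExcess (s : ℝ) (ζ : ℂ) :
    Integrable fun x : UnitAddCircle => logExcess s ‖ec x - ζ‖ := by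
  have h := ((integrable_log_ec_sub ζ).neg.sub (integrable_const s)).pos_part
  refine h.congr (Filter.Eventually.of_forall fun x => ?_)
  simp [logExcess, max_comm]

lemma integral_logExcess_le (s : ℝ) (ζ : ℂ) :
    ∫ x : UnitAddCircle, logExcess s ‖ec x - ζ‖ ≤ Real.exp (-s) := by
  have hmeas : Measurable fun x : UnitAddCircle => ‖ec x - ζ‖ := by
    have := continuous_ec.measurable
    fun_prop
  have hI := integrable_log_max hmeas (integrable_log_ec_sub ζ) (Real.exp (-s))
  have hle : ∀ᵐ x : UnitAddCircle, logExcess s ‖ec x - ζ‖ ≤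
      Real.log (max ‖ec x - ζ‖ (Real.exp (-s))) - Real.log ‖ec x - ζ‖ := by
    filter_upwards [ae_ec_ne ζ] with x hx
    have hp : 0 < ‖ec x - ζ‖ := norm_pos_iff.2 (sub_ne_zero.2 hx)
    refine max_le ?_ ?_
    · exact sub_nonneg.2 (Real.log_le_log hp (le_max_left _ _))
    · have := Real.log_le_log (Real.exp_pos (-s)) (le_max_right ‖ec x - ζ‖ (Real.exp (-s)))
      rw [Real.log_exp] at this
      linarith
  have h := integral_mono_ae (integrable_logExcess s ζ) (hI.sub (integrable_log_ec_sub ζ)) hle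
  refine h.trans ?_
  have h2 : ∫ x : UnitAddCircle, (Real.log (max ‖ec x - ζ‖ (Real.exp (-s))) -
      Real.log ‖ec x - ζ‖) = _ := integral_sub hI (integrable_log_ec_sub ζ)
  have h3 := integral_log_max_ec_le ζ _ (Real.exp_pos (-s))
  rw [integral_log_ec_sub] at h2
  calc _ = _ := h2
    _ ≤ _ := by linarith

/-- `P / Q` with `P` coprime to `Q` is, for some `P`, a good approximation of `α`. -/
def GoodDenom (α : ℝ) (Q : ℕ) : Prop :=
  0 < Q ∧ ∃ P : ℤ, IsCoprime P (Q : ℤ) ∧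
    |α - (P : ℝ) / Q| ≤ 1 / (Q : ℝ) ^ 2 + 1 / (2 * (Q : ℝ) ^ 3)

lemma norm_coe_le_abs (r : ℝ) : ‖(r : UnitAddCircle)‖ ≤ |r| := by
  rw [UnitAddCircle.norm_eq]
  simpa using round_le r 0

lemma nsmul_coe_eq (a : ℕ) (α : ℝ) : a • (α : UnitAddCircle) = ((a * α : ℝ) : UnitAddCircle) := by
  rw [← nsmul_eq_mul]; rfl

lemma sum_range_eq_sum_zmod {Q : ℕ} [NeZero Q] (h : ZMod Q → ℝ) :
    ∑ a ∈ Finset.range Q, h (a : ZMod Q) = ∑ j : ZMod Q, h j := by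
  refine Finset.sum_bij (fun a _ => (a : ZMod Q)) (fun _ _ => Finset.mem_univ _) ?_ ?_ ?_
  · intro a ha b hb hab
    rw [ZMod.natCast_eq_natCast_iff'] at hab
    rwa [Nat.mod_eq_of_lt (Finset.mem_range.1 ha), Nat.mod_eq_of_lt (Finset.mem_range.1 hb)] at hab
  · intro j _
    exact ⟨j.val, Finset.mem_range.2 (ZMod.val_lt j), by simp⟩
  · intros; rfl

lemma GoodDenom.bound {α : ℝ} {Q : ℕ} {P : ℤ} (hQ : 0 < Q)
    (h : |α - (P : ℝ) / Q| ≤ 1 / (Q : ℝ) ^ 2 + 1 / (2 * (Q : ℝ) ^ 3)) {a : ℕ} (ha : a < Q) :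
    |a * α - (a * P : ℝ) / Q| ≤ 1 / Q - 1 / (2 * (Q : ℝ) ^ 2) := by
  have hQ' : (1 : ℝ) ≤ Q := by exact_mod_cast hQ
  have ha' : (a : ℝ) ≤ Q - 1 := by
    have : a + 1 ≤ Q := ha
    have : ((a + 1 : ℕ) : ℝ) ≤ Q := by exact_mod_cast this
    push_cast at this; linarith
  rw [show a * α - (a * P : ℝ) / Q = a * (α - P / Q) by ring, abs_mul, Nat.abs_cast]
  calc (a : ℝ) * |α - P / Q| ≤ (Q - 1) * (1 / (Q : ℝ) ^ 2 + 1 / (2 * (Q : ℝ) ^ 3)) := by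
        gcongr
    _ ≤ 1 / Q - 1 / (2 * (Q : ℝ) ^ 2) := by
        have : 0 < (Q : ℝ) := by linarith
        rw [← sub_nonneg]
        have : 1 / (Q : ℝ) - 1 / (2 * (Q : ℝ) ^ 2)
            - (Q - 1) * (1 / (Q : ℝ) ^ 2 + 1 / (2 * (Q : ℝ) ^ 3))
          = 1 / (2 * (Q : ℝ) ^ 3) := by
          field_simp; ring
        rw [this]; positivity

lemma riemann_sum {ψ : UnitAddCircle → ℝ} {K : ℝ} (hK : 0 ≤ K)
    (hψ : ∀ x y, |ψ x - ψ y| ≤ K * ‖x - y‖) (hi : Integrable ψ) {α : ℝ} {Q : ℕ}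
    (hα : GoodDenom α Q) (x : UnitAddCircle) :
    |∑ a ∈ Finset.range Q, ψ (x + a • (α : UnitAddCircle)) - Q * ∫ y, ψ y| ≤ 2 * K := by
  obtain ⟨hQ, P, hP, hb⟩ := hα
  have : NeZero Q := ⟨hQ.ne'⟩
  have hQ' : (0 : ℝ) < Q := by exact_mod_cast hQ
  set S : UnitAddCircle → ℝ := fun y => ∑ j : ZMod Q, ψ (y + ZMod.toAddCircle j) with hS
  have h1 : |∑ a ∈ Finset.range Q, ψ (x + a • (α : UnitAddCircle)) - S x| ≤ K := by
    have hu : IsUnit (P : ZMod Q) := by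
      rw [ZMod.coe_int_isUnit_iff_isCoprime]
      exact hP.symm
    have hSx : S x = ∑ a ∈ Finset.range Q,
        ψ (x + ZMod.toAddCircle ((a : ZMod Q) * (P : ZMod Q))) := by
      rw [sum_range_eq_sum_zmod (fun j => ψ (x + ZMod.toAddCircle (j * (P : ZMod Q)))), hS]
      exact (Fintype.sum_equiv (Units.mulRight hu.unit) _ _ (fun j => by simp)).symm
    rw [hSx, ← Finset.sum_sub_distrib]
    have hterm : ∀ a ∈ Finset.range Q, |ψ (x + a • (α : UnitAddCircle)) -
        ψ (x + ZMod.toAddCircle ((a : ZMod Q) * (P : ZMod Q)))| ≤ K * (1 / Q) := by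
      intro a ha
      refine (hψ _ _).trans ?_
      gcongr
      have : ((a : ZMod Q) * (P : ZMod Q)) = (((a : ℤ) * P : ℤ) : ZMod Q) := by push_cast; rfl
      rw [add_sub_add_left_eq_sub, this, ZMod.toAddCircle_intCast, nsmul_coe_eq,
        ← AddCircle.coe_sub]
      refine (norm_coe_le_abs _).trans ?_
      have := GoodDenom.bound hQ hb (Finset.mem_range.1 ha)
      push_cast
      refine this.trans ?_
      have : 0 < 1 / (2 * (Q : ℝ) ^ 2) := by positivity
      linarith
    calc _ ≤ ∑ a ∈ Finset.range Q, _ := Finset.abs_sum_le_sum_abs _ _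
      _ ≤ ∑ a ∈ Finset.range Q, K * (1 / Q) := Finset.sum_le_sum hterm
      _ = K := by simp; field_simp
  have h2 : ∀ y, |S x - S y| ≤ K := by
    intro y
    obtain ⟨r, hr, -⟩ := exists_rep (x - y)
    have hsh : S y = ∑ i : ZMod Q,
        ψ (y + ZMod.toAddCircle ((⌊r * Q⌋ : ℤ) : ZMod Q) + ZMod.toAddCircle i) := by
      simp only [hS]
      refine (Fintype.sum_equiv (Equiv.addLeft ((⌊r * Q⌋ : ℤ) : ZMod Q)) _ _ (fun i => ?_)).symm
      simp [add_assoc]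
    rw [hsh, hS, ← Finset.sum_sub_distrib]
    have hterm : ∀ i ∈ (Finset.univ : Finset (ZMod Q)), |ψ (x + ZMod.toAddCircle i) -
        ψ (y + ZMod.toAddCircle ((⌊r * Q⌋ : ℤ) : ZMod Q) + ZMod.toAddCircle i)| ≤ K * (1 / Q) := by
      intro i _
      refine (hψ _ _).trans ?_
      gcongr
      rw [add_sub_add_right_eq_sub, ← sub_sub, ← hr, ZMod.toAddCircle_intCast, ← AddCircle.coe_sub]
      refine (norm_coe_le_abs _).trans ?_
      have e : r - (⌊r * Q⌋ : ℝ) / Q = (r * Q - ⌊r * Q⌋) / Q := by field_simp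
      rw [e, abs_div, abs_of_pos hQ', abs_of_nonneg (sub_nonneg.2 (Int.floor_le _))]
      gcongr
      linarith [Int.lt_floor_add_one (r * Q)]
    calc _ ≤ ∑ i : ZMod Q, _ := Finset.abs_sum_le_sum_abs _ _
      _ ≤ ∑ i : ZMod Q, K * (1 / Q) := Finset.sum_le_sum hterm
      _ = K := by simp [ZMod.card]; field_simp
  have h_integral : ∀ j : ZMod Q, Integrable fun y => ψ (y + ZMod.toAddCircle j) :=
    fun j => hi.comp_add_right _
  have h3 : ∫ y, S y = Q * ∫ y, ψ y := by
    rw [hS, integral_finsetSum _ (fun j _ => h_integral j)]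
    simp [integral_add_right_eq_self, ZMod.card]
  have hSi : Integrable S := integrable_finsetSum _ (fun j _ => h_integral j)
  have h4 : |S x - ∫ y, S y| ≤ K := by
    have : S x - ∫ y, S y = ∫ y, (S x - S y) := by
      rw [integral_sub (integrable_const _) hSi]; simp
    rw [this]
    have := norm_integral_le_of_norm_le_const (μ := (volume : Measure UnitAddCircle))
      (f := fun y => S x - S y) (C := K) (Filter.Eventually.of_forall h2)
    simpa using this
  rw [← h3]
  have := abs_sub_le (∑ a ∈ Finset.range Q, ψ (x + a • (α : UnitAddCircle))) (S x) (∫ y, S y)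
  linarith

lemma sum_inv_sqrt_le (n : ℕ) :
    ∑ m ∈ Finset.range n, 1 / Real.sqrt ((m : ℝ) + 1) ≤ 2 * Real.sqrt n := by
  induction n with
  | zero => simp
  | succ n ih =>
    rw [Finset.sum_range_succ]
    have h1 : 0 < Real.sqrt ((n : ℝ) + 1) := Real.sqrt_pos.2 (by positivity)
    have h2 := Real.sq_sqrt (show (0 : ℝ) ≤ (n : ℝ) + 1 by positivity)
    have h3 := Real.sq_sqrt (show (0 : ℝ) ≤ (n : ℝ) by positivity)
    have h4 := Real.sqrt_nonneg (n : ℝ)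
    have : 1 / Real.sqrt ((n : ℝ) + 1) ≤ 2 * Real.sqrt (n + 1) - 2 * Real.sqrt n := by
      rw [div_le_iff₀ h1]
      nlinarith [sq_nonneg (Real.sqrt ((n : ℝ) + 1) - Real.sqrt n)]
    push_cast
    linarith

lemma log_le_two_sqrt {x : ℝ} (hx : 0 < x) : Real.log x ≤ 2 * Real.sqrt x := by
  have h := Real.log_sqrt hx.le
  have := Real.log_le_sub_one_of_pos (Real.sqrt_pos.2 hx)
  linarith

/-- Separation of the orbit of a rotation along a good denominator. -/
lemma GoodDenom.separation {α : ℝ} {Q : ℕ} {P : ℤ} (hQ : 0 < Q) (hP : IsCoprime P (Q : ℤ))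
    (h : |α - (P : ℝ) / Q| ≤ 1 / (Q : ℝ) ^ 2 + 1 / (2 * (Q : ℝ) ^ 3)) {b r : ℕ} (hb0 : 0 < b)
    (hb : b < Q) (hr : ((b : ℤ) * P) % Q = r) :
    ∃ m : ℕ, (m = r ∨ m = Q - r) ∧ 1 ≤ m ∧
      4 * (((m : ℝ) - 1) / Q + 1 / (2 * (Q : ℝ) ^ 2)) ≤ ‖ec (b • (α : UnitAddCircle)) - 1‖ := by
  have hQ' : (0 : ℝ) < Q := by exact_mod_cast hQ
  have hrQ : r < Q := by
    have := Int.emod_lt_of_pos ((b : ℤ) * P) (show (0 : ℤ) < Q by exact_mod_cast hQ)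
    omega
  have hr0 : 0 < r := by
    rcases Nat.eq_zero_or_pos r with h0 | h0
    · exfalso
      rw [h0] at hr
      have hd : (Q : ℤ) ∣ (b : ℤ) * P := Int.dvd_of_emod_eq_zero (by simpa using hr)
      have := (hP.symm).dvd_of_dvd_mul_right hd
      have := Int.le_of_dvd (by exact_mod_cast hb0) this
      omega
    · exact h0
  have hdist : ((min r (Q - r) : ℕ) : ℝ) / Q ≤ ‖(((b * P : ℝ) / Q : ℝ) : UnitAddCircle)‖ := by
    rw [UnitAddCircle.norm_eq]
    set k := round ((b * P : ℝ) / Q)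
    have h_integral : ((min r (Q - r) : ℕ) : ℤ) ≤ |(b : ℤ) * P - k * Q| := by
      have h1 := Int.emod_add_mul_ediv ((b : ℤ) * P) Q
      rw [hr] at h1
      set e := ((b : ℤ) * P) / Q
      have h2 : (b : ℤ) * P - k * Q = r + (e - k) * Q := by rw [← h1]; ring
      rw [h2]
      rcases lt_trichotomy (e - k) 0 with h3 | h3 | h3
      · have : (e - k) * Q ≤ -1 * Q := by
          apply mul_le_mul_of_nonneg_right _ (by positivity); omega
        rw [abs_of_neg (by omega)]
        omega
      · rw [h3]; simp
      · have : 1 * (Q : ℤ) ≤ (e - k) * Q := by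
          apply mul_le_mul_of_nonneg_right _ (by positivity); omega
        rw [abs_of_pos (by omega)]
        omega
    have e : (b * P : ℝ) / Q - k = ((b * P : ℝ) - k * Q) / Q := by field_simp
    rw [e, abs_div, abs_of_pos hQ']
    gcongr
    exact_mod_cast h_integral
  refine ⟨min r (Q - r), min_choice _ _, by omega, ?_⟩
  refine le_trans ?_ (norm_ec_sub_one_ge _)
  have h1 := GoodDenom.bound hQ h hb
  have h2 : ‖(((b * P : ℝ) / Q : ℝ) : UnitAddCircle)‖ ≤
      ‖b • (α : UnitAddCircle)‖ + |b * α - (b * P : ℝ) / Q| := by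
    have h3 := norm_sub_le (b • (α : UnitAddCircle)) ((b * α - (b * P : ℝ) / Q : ℝ) : UnitAddCircle)
    have h4 : b • (α : UnitAddCircle) - ((b * α - (b * P : ℝ) / Q : ℝ) : UnitAddCircle)
        = (((b * P : ℝ) / Q : ℝ) : UnitAddCircle) := by
      rw [nsmul_coe_eq, ← AddCircle.coe_sub]; congr 1; ring
    rw [h4] at h3
    linarith [norm_coe_le_abs (b * α - (b * P : ℝ) / Q)]
  rw [sub_div]
  have h5 : (1 : ℝ) / (2 * (Q : ℝ) ^ 2) = 1 / (2 * (Q : ℝ) ^ 2) := rfl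
  linarith

lemma separation_sum {α : ℝ} {Q : ℕ} (hα : GoodDenom α Q) {ν : ℝ} (hν : 0 < ν) (hν1 : ν ≤ 1) :
    ∑ b ∈ Finset.Ico 1 Q,
      max 0 (Real.log (2 * ν) - Real.log ‖ec (b • (α : UnitAddCircle)) - 1‖)
      ≤ 4 * Real.log Q + 8 * Real.sqrt ν * Q := by
  obtain ⟨hQ, P, hP, hb⟩ := hα
  have : NeZero Q := ⟨hQ.ne'⟩
  have hQ' : (0 : ℝ) < Q := by exact_mod_cast hQ
  have hQ1 : (1 : ℝ) ≤ Q := by exact_mod_cast hQ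
  have hlogQ : 0 ≤ Real.log Q := Real.log_nonneg hQ1
  set c : ℝ := 2 * Real.sqrt (ν * Q) with hc
  have hc0 : 0 ≤ c := by positivity
  set h : ℕ → ℝ := fun m => (if m = 1 then 2 * Real.log Q else 0) + c / Real.sqrt ((m - 1 : ℕ) : ℝ)
    with hh
  have hh0 : ∀ m, 0 ≤ h m := by
    intro m; simp only [hh]
    refine add_nonneg ?_ (by positivity)
    split_ifs <;> positivity
  have hterm : ∀ b ∈ Finset.Ico 1 Q,
      max 0 (Real.log (2 * ν) - Real.log ‖ec (b • (α : UnitAddCircle)) - 1‖) ≤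
        h ((b : ZMod Q) * (P : ZMod Q)).val + h (Q - ((b : ZMod Q) * (P : ZMod Q)).val) := by
    intro b hbm
    obtain ⟨hb1, hbQ⟩ := Finset.mem_Ico.1 hbm
    set r := ((b : ZMod Q) * (P : ZMod Q)).val with hr
    have hrr : ((b : ℤ) * P) % Q = r := by
      have : ((b : ZMod Q) * (P : ZMod Q)) = (((b : ℤ) * P : ℤ) : ZMod Q) := by push_cast; rfl
      rw [hr, this, ZMod.val_intCast]
    obtain ⟨m, hm, hm1, hmd⟩ := GoodDenom.separation hQ hP hb hb1 hbQ hrr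
    have hmain : max 0 (Real.log (2 * ν) - Real.log ‖ec (b • (α : UnitAddCircle)) - 1‖) ≤ h m := by
      refine max_le (hh0 m) ?_
      set d := ‖ec (b • (α : UnitAddCircle)) - 1‖
      have hm1' : (0 : ℝ) ≤ (m : ℝ) - 1 := by
        have : (1 : ℝ) ≤ m := by exact_mod_cast hm1
        linarith
      rcases eq_or_lt_of_le hm1 with h1 | h1
      · have hd : 2 / (Q : ℝ) ^ 2 ≤ d := by
          refine le_trans (le_of_eq ?_) hmd
          rw [← h1]; field_simp; norm_num
        have hd2 : Real.log (2 / (Q : ℝ) ^ 2) ≤ Real.log d :=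
          Real.log_le_log (by positivity) hd
        rw [Real.log_div (by norm_num) (by positivity), Real.log_pow] at hd2
        rw [Real.log_mul (by norm_num) hν.ne']
        have := Real.log_nonpos hν.le hν1
        rw [hh, ← h1]
        simp
        push_cast at hd2
        linarith
      · have hm2 : (0 : ℝ) < (m : ℝ) - 1 := by
          have : (1 : ℝ) < m := by exact_mod_cast h1
          linarith
        have hd : 4 * (((m : ℝ) - 1) / Q) ≤ d := by
          refine le_trans ?_ hmd
          have : (0 : ℝ) ≤ 1 / (2 * (Q : ℝ) ^ 2) := by positivity
          linarith
        have hd0 : 0 < d := lt_of_lt_of_le (by positivity) hd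
        rw [← Real.log_div (by positivity) hd0.ne']
        refine (log_le_two_sqrt (by positivity)).trans ?_
        have e1 : c / Real.sqrt ((m - 1 : ℕ) : ℝ) = 2 * Real.sqrt (ν * Q / (m - 1)) := by
          rw [Nat.cast_sub hm1, hc, Real.sqrt_div (by positivity)]; push_cast; ring
        have : h m = 2 * Real.sqrt (ν * Q / (m - 1)) := by
          simp only [hh]; rw [if_neg (by omega), zero_add, e1]
        rw [this]
        refine mul_le_mul_of_nonneg_left (Real.sqrt_le_sqrt ?_) (by norm_num)
        rw [div_le_div_iff₀ hd0 hm2]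
        have h3 : 4 * ((m : ℝ) - 1) ≤ d * Q := by
          have := mul_le_mul_of_nonneg_right hd hQ'.le
          refine le_trans (le_of_eq ?_) this
          field_simp
        nlinarith
    rcases hm with rfl | rfl
    · linarith [hh0 (Q - r)]
    · linarith [hh0 r]
  have hu : IsUnit (P : ZMod Q) := by
    rw [ZMod.coe_int_isUnit_iff_isCoprime]
    exact hP.symm
  have hsum1 : ∑ m ∈ Finset.range (Q + 1), h m ≤ 2 * Real.log Q + 4 * Real.sqrt ν * Q := by
    simp only [hh]
    rw [Finset.sum_add_distrib]
    refine add_le_add ?_ ?_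
    · rw [Finset.sum_ite_eq']
      split_ifs
      · exact le_rfl
      · positivity
    · rw [Finset.sum_range_succ', Nat.zero_sub]
      simp only [Nat.add_sub_cancel, Nat.cast_zero, Real.sqrt_zero, div_zero, add_zero]
      obtain ⟨Q', rfl⟩ : ∃ Q', Q = Q' + 1 := ⟨Q - 1, by omega⟩
      rw [Finset.sum_range_succ']
      simp only [Nat.cast_zero, Real.sqrt_zero, div_zero, add_zero]
      have := sum_inv_sqrt_le Q'
      calc ∑ k ∈ Finset.range Q', c / Real.sqrt ((k + 1 : ℕ) : ℝ)
          = c * ∑ k ∈ Finset.range Q', 1 / Real.sqrt ((k : ℝ) + 1) := by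
            rw [Finset.mul_sum]; refine Finset.sum_congr rfl fun k _ => ?_
            push_cast; ring
        _ ≤ c * (2 * Real.sqrt Q') := by gcongr
        _ ≤ c * (2 * Real.sqrt ((Q' + 1 : ℕ) : ℝ)) := by gcongr; omega
        _ = 4 * Real.sqrt ν * ((Q' + 1 : ℕ) : ℝ) := by
            rw [hc, Real.sqrt_mul hν.le]
            have := Real.mul_self_sqrt hQ'.le
            linear_combination 4 * Real.sqrt ν * this
  calc _ ≤ ∑ b ∈ Finset.Ico 1 Q, _ := Finset.sum_le_sum hterm
    _ ≤ ∑ b ∈ Finset.range Q, (h ((b : ZMod Q) * (P : ZMod Q)).val +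
          h (Q - ((b : ZMod Q) * (P : ZMod Q)).val)) := by
        refine Finset.sum_le_sum_of_subset_of_nonneg ?_ fun b _ _ => add_nonneg (hh0 _) (hh0 _)
        intro b hb; exact Finset.mem_range.2 (Finset.mem_Ico.1 hb).2
    _ = ∑ j : ZMod Q, (h j.val + h (Q - j.val)) := by
        refine (sum_range_eq_sum_zmod (fun b : ZMod Q => h (b * (P : ZMod Q)).val +
          h (Q - (b * (P : ZMod Q)).val))).trans ?_
        exact Fintype.sum_equiv (Units.mulRight hu.unit) _ _ (fun j => by simp)
    _ = ∑ j ∈ Finset.range Q, (h j + h (Q - j)) := by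
        rw [← sum_range_eq_sum_zmod (fun j : ZMod Q => h j.val + h (Q - j.val))]
        refine Finset.sum_congr rfl fun j hj => ?_
        rw [ZMod.val_natCast, Nat.mod_eq_of_lt (Finset.mem_range.1 hj)]
    _ ≤ ∑ j ∈ Finset.range (Q + 1), h j + ∑ j ∈ Finset.range (Q + 1), h (Q - j) := by
        rw [Finset.sum_add_distrib, Finset.sum_range_succ,
            Finset.sum_range_succ (fun j => h (Q - j))]
        linarith [hh0 Q, hh0 (Q - Q)]
    _ = 2 * ∑ j ∈ Finset.range (Q + 1), h j := by
        have := Finset.sum_range_reflect h (Q + 1)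
        simp only [Nat.add_sub_cancel] at this
        rw [this]; ring
    _ ≤ _ := by linarith

lemma abs_log_max_sub_le {u v ν : ℝ} (hν : 0 < ν) :
    |Real.log (max u ν) - Real.log (max v ν)| ≤ ν⁻¹ * |u - v| := by
  have key : ∀ u v : ℝ, Real.log (max u ν) - Real.log (max v ν) ≤ ν⁻¹ * |u - v| := by
    intro u v
    have hu : 0 < max u ν := lt_max_of_lt_right hν
    have hv : 0 < max v ν := lt_max_of_lt_right hν
    have h1 : max u ν ≤ max v ν + |u - v| := by
      refine max_le ?_ ?_
      · linarith [le_max_left v ν, le_abs_self (u - v)]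
      · linarith [le_max_right v ν, abs_nonneg (u - v)]
    rw [← Real.log_div hu.ne' hv.ne']
    refine (Real.log_le_sub_one_of_pos (div_pos hu hv)).trans ?_
    rw [div_sub_one hv.ne']
    calc (max u ν - max v ν) / max v ν ≤ |u - v| / max v ν := by gcongr; linarith
      _ ≤ |u - v| / ν := by gcongr; exact le_max_right _ _
      _ = ν⁻¹ * |u - v| := by ring
  rw [abs_le]
  constructor
  · have := key v u
    rw [abs_sub_comm] at this
    linarith
  · exact key u v

lemma log_max_ec_lipschitz (ζ : ℂ) {ν : ℝ} (hν : 0 < ν) (x y : UnitAddCircle) :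
    |Real.log (max ‖ec x - ζ‖ ν) - Real.log (max ‖ec y - ζ‖ ν)| ≤
      (ν⁻¹ * (2 * Real.pi)) * ‖x - y‖ := by
  refine (abs_log_max_sub_le hν).trans ?_
  rw [mul_assoc]
  gcongr
  refine le_trans (abs_norm_sub_norm_le _ _) ?_
  rw [sub_sub_sub_cancel_right]
  exact norm_ec_sub_le x y

lemma riemann_log_max_ec (ζ : ℂ) {ν : ℝ} (hν : 0 < ν) {α : ℝ} {Q : ℕ} (hα : GoodDenom α Q)
    (x : UnitAddCircle) :
    |∑ a ∈ Finset.range Q, Real.log (max ‖ec (x + a • (α : UnitAddCircle)) - ζ‖ ν) -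
      Q * ∫ y : UnitAddCircle, Real.log (max ‖ec y - ζ‖ ν)| ≤ 2 * (ν⁻¹ * (2 * Real.pi)) := by
  have hmeas : Measurable fun x : UnitAddCircle => ‖ec x - ζ‖ := by
    have := continuous_ec.measurable
    fun_prop
  exact riemann_sum (by positivity) (log_max_ec_lipschitz ζ hν)
    (integrable_log_max hmeas (integrable_log_ec_sub ζ) ν) hα x

lemma sum_trunc_sub_le {d : ℕ → ℝ} (hd : ∀ b, 0 ≤ d b) (h0 : d 0 = 0) {a₀ Q : ℕ} (ha : a₀ < Q) :
    ∑ a ∈ Finset.range Q, (d (a - a₀) + d (a₀ - a)) ≤ 2 * ∑ b ∈ Finset.range Q, d b := by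
  have h1 : ∑ a ∈ Finset.range Q, d (a - a₀) ≤ ∑ b ∈ Finset.range Q, d b := by
    rw [← Finset.sum_range_add_sum_Ico _ ha.le, Finset.sum_Ico_eq_sum_range]
    have e : ∑ k ∈ Finset.range a₀, d (k - a₀) = 0 :=
      Finset.sum_eq_zero fun k hk => by
        rw [Nat.sub_eq_zero_of_le (Finset.mem_range.1 hk).le, h0]
    rw [e, zero_add]
    simp only [Nat.add_sub_cancel_left]
    exact Finset.sum_le_sum_of_subset_of_nonneg
      (Finset.range_subset_range.2 (by omega)) fun _ _ _ => hd _
  have h2 : ∑ a ∈ Finset.range Q, d (a₀ - a) ≤ ∑ b ∈ Finset.range Q, d b := by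
    rw [← Finset.sum_range_add_sum_Ico _ (show a₀ + 1 ≤ Q from ha)]
    have e : ∑ k ∈ Finset.Ico (a₀ + 1) Q, d (a₀ - k) = 0 :=
      Finset.sum_eq_zero fun k hk => by
        have := (Finset.mem_Ico.1 hk).1
        rw [Nat.sub_eq_zero_of_le (by omega), h0]
    have e2 := Finset.sum_range_reflect d (a₀ + 1)
    simp only [Nat.add_sub_cancel] at e2
    rw [e, add_zero, e2]
    exact Finset.sum_le_sum_of_subset_of_nonneg
      (Finset.range_subset_range.2 (by omega)) fun _ _ _ => hd _
  rw [Finset.sum_add_distrib]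
  linarith

lemma sum_log_ec_ge_aux {α : ℝ} {Q : ℕ} (hα : GoodDenom α Q) {ν : ℝ} (hν : 0 < ν) (hν1 : ν ≤ 1)
    (ζ : ℂ) (x : UnitAddCircle) {s : ℝ} (hs : 0 ≤ s) :
    Q * Real.posLog ‖ζ‖ - 2 * (ν⁻¹ * (2 * Real.pi)) - 2 * (4 * Real.log Q + 8 * Real.sqrt ν * Q)
      - s - ∑ a ∈ Finset.range Q, logExcess s ‖ec (x + a • (α : UnitAddCircle)) - ζ‖
      ≤ ∑ a ∈ Finset.range Q, Real.log ‖ec (x + a • (α : UnitAddCircle)) - ζ‖ := by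
  have hQ := hα.1
  set g : ℕ → ℝ := fun a => ‖ec (x + a • (α : UnitAddCircle)) - ζ‖ with hg
  obtain ⟨a₀, ha₀, hmin⟩ := Finset.exists_min_image (Finset.range Q) g
    ⟨0, Finset.mem_range.2 hQ⟩
  set d : ℕ → ℝ := fun b => if b = 0 then 0 else
    max 0 (Real.log (2 * ν) - Real.log ‖ec (b • (α : UnitAddCircle)) - 1‖) with hd
  have hd0 : ∀ b, 0 ≤ d b := fun b => by
    simp only [hd]; split_ifs
    exacts [le_rfl, le_max_left _ _]
  have hsep : ∑ b ∈ Finset.range Q, d b ≤ 4 * Real.log Q + 8 * Real.sqrt ν * Q := by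
    rw [Finset.range_eq_Ico, Finset.sum_eq_sum_Ico_succ_bot hQ]
    refine le_trans (le_of_eq ?_) (separation_sum hα hν hν1)
    simp only [hd, if_pos, zero_add]
    refine Finset.sum_congr rfl fun b hb => ?_
    rw [if_neg (by have := (Finset.mem_Ico.1 hb).1; omega)]
  have h_integral : Real.posLog ‖ζ‖ ≤ ∫ y : UnitAddCircle, Real.log (max ‖ec y - ζ‖ ν) := by
    have hmeas : Measurable fun x : UnitAddCircle => ‖ec x - ζ‖ := by
      have := continuous_ec.measurable
      fun_prop
    rw [← integral_log_ec_sub]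
    refine integral_mono_ae (integrable_log_ec_sub ζ)
      (integrable_log_max hmeas (integrable_log_ec_sub ζ) ν) ?_
    filter_upwards [ae_ec_ne ζ] with y hy
    exact Real.log_le_log (norm_pos_iff.2 (sub_ne_zero.2 hy)) (le_max_left _ _)
  have hR := (abs_le.1 (riemann_log_max_ec ζ hν hα x)).1
  have hdefect : ∀ a ∈ Finset.range Q, Real.log (max (g a) ν) - Real.log (g a) ≤
      (if a = a₀ then s + logExcess s (g a) else d (a - a₀) + d (a₀ - a)) := by
    intro a ha
    split_ifs with h
    · rcases le_total (g a) ν with h1 | h1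
      · rw [max_eq_right h1]
        have h2 : -Real.log (g a) - s ≤ logExcess s (g a) := le_max_right _ _
        linarith [Real.log_nonpos hν.le hν1]
      · rw [max_eq_left h1, sub_self]
        exact add_nonneg hs (logExcess_nonneg _ _)
    · have hpos : 0 ≤ d (a - a₀) + d (a₀ - a) := add_nonneg (hd0 _) (hd0 _)
      rcases le_total (g a) ν with h1 | h1
      · rw [max_eq_right h1]
        have hdist : ‖ec ((a - a₀ + (a₀ - a)) • (α : UnitAddCircle)) - 1‖ ≤ 2 * g a := by
          have h3 : ‖ec (x + a • (α : UnitAddCircle)) - ec (x + a₀ • (α : UnitAddCircle))‖ ≤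
              2 * g a := by
            have := norm_sub_le (ec (x + a • (α : UnitAddCircle)) - ζ)
              (ec (x + a₀ • (α : UnitAddCircle)) - ζ)
            rw [sub_sub_sub_cancel_right] at this
            have := hmin a ha
            simp only [hg] at *
            linarith
          refine le_trans (le_of_eq ?_) h3
          rcases Nat.lt_or_gt_of_ne h with h4 | h4
          · rw [norm_sub_rev (ec (x + a • (α : UnitAddCircle))), ec_sub]
            congr 3
            rw [add_sub_add_left_eq_sub, show a - a₀ + (a₀ - a) = a₀ - a by omega,
              sub_nsmul _ h4.le, sub_eq_add_neg]
          · rw [ec_sub]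
            congr 3
            rw [add_sub_add_left_eq_sub, show a - a₀ + (a₀ - a) = a - a₀ by omega,
              sub_nsmul _ (le_of_lt h4), sub_eq_add_neg]
        set b := a - a₀ + (a₀ - a) with hb
        have hbd : d b ≤ d (a - a₀) + d (a₀ - a) := by
          rcases Nat.lt_or_gt_of_ne h with h4 | h4
          · rw [show b = a₀ - a by omega]; linarith [hd0 (a - a₀)]
          · rw [show b = a - a₀ by omega]; linarith [hd0 (a₀ - a)]
        refine le_trans ?_ hbd
        rcases eq_or_lt_of_le (norm_nonneg (ec (x + a • (α : UnitAddCircle)) - ζ)) with h5 | h5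
        · have : g a = 0 := h5.symm
          rw [this, Real.log_zero, sub_zero]
          exact (Real.log_nonpos hν.le hν1).trans (hd0 b)
        · have h6 : 0 < ‖ec (b • (α : UnitAddCircle)) - 1‖ := by
            obtain ⟨-, P, hP, hbP⟩ := hα
            have hbQ : b < Q := by
              have := Finset.mem_range.1 ha
              have := Finset.mem_range.1 ha₀
              omega
            have hQz : (Q : ℤ) ≠ 0 := by exact_mod_cast hQ.ne'
            obtain ⟨m, -, hm1, hm⟩ := GoodDenom.separation (r := (((b : ℤ) * P) % Q).toNat) hQ hP
              hbP (by omega) hbQ (by rw [Int.toNat_of_nonneg (Int.emod_nonneg _ hQz)])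
            refine lt_of_lt_of_le ?_ hm
            have : (1 : ℝ) ≤ m := by exact_mod_cast hm1
            have h7 : 0 ≤ ((m : ℝ) - 1) / Q := div_nonneg (by linarith) (Nat.cast_nonneg _)
            have h8 : (0 : ℝ) < Q := by exact_mod_cast hQ
            positivity
          have h9 : Real.log ‖ec (b • (α : UnitAddCircle)) - 1‖ ≤ Real.log 2 + Real.log (g a) := by
            rw [← Real.log_mul (by norm_num) h5.ne']
            exact Real.log_le_log h6 hdist
          have h10 : d b = max 0 (Real.log (2 * ν) -
              Real.log ‖ec (b • (α : UnitAddCircle)) - 1‖) := by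
            simp only [hd]; rw [if_neg (by omega)]
          rw [h10]
          refine le_trans ?_ (le_max_right _ _)
          rw [Real.log_mul (by norm_num) hν.ne']
          linarith
      · rw [max_eq_left h1, sub_self]; exact hpos
  have hdefect' : ∀ a ∈ Finset.range Q, Real.log (max (g a) ν) - Real.log (g a) ≤
      (if a = a₀ then s else 0) + logExcess s (g a) + (d (a - a₀) + d (a₀ - a)) := by
    intro a ha
    refine (hdefect a ha).trans ?_
    have := logExcess_nonneg s (g a)
    have := hd0 (a - a₀)
    have := hd0 (a₀ - a)
    split_ifs <;> linarith
  have hsum := Finset.sum_le_sum hdefect'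
  rw [Finset.sum_sub_distrib, Finset.sum_add_distrib, Finset.sum_add_distrib,
    Finset.sum_ite_eq', if_pos ha₀] at hsum
  have h11 := sum_trunc_sub_le hd0 (by simp [hd]) (Finset.mem_range.1 ha₀)
  have h12 : (Q : ℝ) * Real.posLog ‖ζ‖ ≤ Q * ∫ y : UnitAddCircle, Real.log (max ‖ec y - ζ‖ ν) := by
    gcongr
  simp only [hg] at hsum
  linarith

/-- Lower bound for the sum of `log ‖e^{2πi(x+aα)} - ζ‖` over a good denominator, uniform in `ζ`. -/
lemma sum_log_ec_ge {κ : ℝ} (hκ : 0 < κ) : ∃ Q₀ : ℕ, ∀ Q ≥ Q₀, ∀ α : ℝ, GoodDenom α Q →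
    ∀ (ζ : ℂ) (x : UnitAddCircle) (s : ℝ), 0 ≤ s →
    Q * (Real.posLog ‖ζ‖ - κ) - s -
      ∑ a ∈ Finset.range Q, logExcess s ‖ec (x + a • (α : UnitAddCircle)) - ζ‖
      ≤ ∑ a ∈ Finset.range Q, Real.log ‖ec (x + a • (α : UnitAddCircle)) - ζ‖ := by
  set ν : ℝ := min 1 ((κ / 64) ^ 2) with hν
  have hν0 : 0 < ν := lt_min one_pos (by positivity)
  have hν1 : ν ≤ 1 := min_le_left _ _
  have hsq : Real.sqrt ν ≤ κ / 64 := by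
    rw [← Real.sqrt_sq (show 0 ≤ κ / 64 by positivity)]
    exact Real.sqrt_le_sqrt (min_le_right _ _)
  have h1 : Filter.Tendsto (fun Q : ℕ => (2 * (ν⁻¹ * (2 * Real.pi))) / (Q : ℝ))
      Filter.atTop (nhds 0) :=
    tendsto_const_div_atTop_nhds_zero_nat _
  have h2 : Filter.Tendsto (fun Q : ℕ => Real.log (Q : ℝ) / (Q : ℝ)) Filter.atTop (nhds 0) := by
    have := (Real.isLittleO_log_id_atTop.tendsto_div_nhds_zero).comp tendsto_natCast_atTop_atTop
    exact this
  have h3 := (h1.eventually_le_const (show (0 : ℝ) < κ / 4 by positivity)).and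
    (h2.eventually_le_const (show (0 : ℝ) < κ / 32 by positivity))
  obtain ⟨Q₀, hQ₀⟩ := Filter.eventually_atTop.1 h3
  refine ⟨Q₀, fun Q hQ α hα ζ x s hs => ?_⟩
  have hQ' : (0 : ℝ) < Q := by exact_mod_cast hα.1
  obtain ⟨h4, h5⟩ := hQ₀ Q hQ
  rw [div_le_iff₀ hQ'] at h4 h5
  refine le_trans ?_ (sum_log_ec_ge_aux hα hν0 hν1 ζ x hs)
  have h6 : Real.sqrt ν * Q ≤ κ / 64 * Q := by gcongr
  have h7 : 0 < κ * Q := by positivity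
  have h8 : (Q : ℝ) * (Real.posLog ‖ζ‖ - κ) = Q * Real.posLog ‖ζ‖ - κ * Q := by ring
  rw [h8]
  linarith

lemma ec_neg (x : UnitAddCircle) : ec (-x) = (ec x)⁻¹ := by
  refine eq_inv_of_mul_eq_one_left ?_
  rw [← ec_add, neg_add_cancel, ec_zero]

lemma conj_ec (x : UnitAddCircle) : (starRingEnd ℂ) (ec x) = (ec x)⁻¹ := by
  rw [Complex.inv_def, Complex.normSq_eq_norm_sq, norm_ec]; simp

/-- Trigonometric polynomials of degree at most `n`. -/
def IsTrigPoly (n : ℕ) (f : UnitAddCircle → ℂ) : Prop :=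
  ∃ P : Polynomial ℂ, P.natDegree ≤ 2 * n ∧ ∀ x, ec x ^ n * f x = P.eval (ec x)

lemma IsTrigPoly.add {n : ℕ} {f g : UnitAddCircle → ℂ} (hf : IsTrigPoly n f)
    (hg : IsTrigPoly n g) : IsTrigPoly n (fun x => f x + g x) := by
  obtain ⟨P, hP, hP'⟩ := hf
  obtain ⟨R, hR, hR'⟩ := hg
  exact ⟨P + R, Polynomial.natDegree_add_le_of_degree_le hP hR, fun x => by
    rw [Polynomial.eval_add, mul_add, hP', hR']⟩

lemma IsTrigPoly.mul {m n : ℕ} {f g : UnitAddCircle → ℂ} (hf : IsTrigPoly m f)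
    (hg : IsTrigPoly n g) : IsTrigPoly (m + n) (fun x => f x * g x) := by
  obtain ⟨P, hP, hP'⟩ := hf
  obtain ⟨R, hR, hR'⟩ := hg
  exact ⟨P * R, (Polynomial.natDegree_mul_le_of_le hP hR).trans (by omega), fun x => by
    rw [Polynomial.eval_mul, ← hP', ← hR']; ring⟩

lemma isTrigPoly_const (n : ℕ) (a : ℂ) : IsTrigPoly n (fun _ => a) :=
  ⟨Polynomial.C a * Polynomial.X ^ n,
    (Polynomial.natDegree_C_mul_X_pow_le a n).trans (by omega), fun x => by
    rw [Polynomial.eval_mul, Polynomial.eval_C, Polynomial.eval_pow, Polynomial.eval_X, mul_comm]⟩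

lemma isTrigPoly_ec : IsTrigPoly 1 ec :=
  ⟨Polynomial.X ^ 2, by simp, fun x => by simp; ring⟩

lemma isTrigPoly_ec_neg : IsTrigPoly 1 (fun x => ec (-x)) :=
  ⟨1, by simp, fun x => by
    show ec x ^ 1 * ec (-x) = _
    rw [pow_one, ec_neg, mul_inv_cancel₀ (ec_ne_zero x), Polynomial.eval_one]⟩

lemma IsTrigPoly.conj {n : ℕ} {f : UnitAddCircle → ℂ} (hf : IsTrigPoly n f) :
    IsTrigPoly n (fun x => (starRingEnd ℂ) (f x)) := by
  obtain ⟨P, hP, hP'⟩ := hf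
  refine ⟨(P.map (starRingEnd ℂ)).reflect (2 * n), ?_, fun x => ?_⟩
  · refine (Polynomial.natDegree_reflect_le).trans (max_le le_rfl ?_)
    exact Polynomial.natDegree_map_le.trans hP
  · let : Invertible (ec x)⁻¹ := invertibleOfNonzero (inv_ne_zero (ec_ne_zero x))
    have h := Polynomial.eval₂_reflect_mul_pow (RingHom.id ℂ) (ec x)⁻¹ (2 * n)
      (P.map (starRingEnd ℂ)) (Polynomial.natDegree_map_le.trans hP)
    rw [invOf_eq_inv, inv_inv] at h
    change Polynomial.eval (ec x) _ * _ = Polynomial.eval (ec x)⁻¹ _ at h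
    have h2 : Polynomial.eval (ec x)⁻¹ (P.map (starRingEnd ℂ)) =
        (starRingEnd ℂ) (Polynomial.eval (ec x) P) := by
      rw [← conj_ec, Polynomial.eval_map, Polynomial.eval₂_hom]
    rw [h2, ← hP', map_mul, map_pow, conj_ec] at h
    have h3 := ec_ne_zero x
    rw [inv_pow, inv_pow, mul_comm, inv_mul_eq_iff_eq_mul₀ (pow_ne_zero _ h3)] at h
    rw [h, two_mul, pow_add]
    field_simp

lemma isTrigPoly_translate {n : ℕ} {f : UnitAddCircle → ℂ} (hf : IsTrigPoly n f)
    (y : UnitAddCircle) : IsTrigPoly n (fun x => f (x + y)) := by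
  obtain ⟨P, hP, hP'⟩ := hf
  refine ⟨Polynomial.C (ec y ^ n)⁻¹ * P.comp (Polynomial.C (ec y) * Polynomial.X), ?_, fun x => ?_⟩
  · refine (Polynomial.natDegree_C_mul_le _ _).trans ?_
    refine Polynomial.natDegree_comp_le.trans ?_
    refine (Nat.mul_le_mul hP (Polynomial.natDegree_C_mul_le _ _)).trans ?_
    rw [Polynomial.natDegree_X, mul_one]
  · have h := hP' (x + y)
    rw [Polynomial.eval_mul, Polynomial.eval_C, Polynomial.eval_comp, Polynomial.eval_mul,
      Polynomial.eval_C, Polynomial.eval_X, mul_comm (ec y), ← ec_add, ← h, ec_add]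
    have := ec_ne_zero y
    rw [mul_pow]
    field_simp

/-- The logarithm of a polynomial on the unit circle along a good denominator. -/
lemma sum_log_poly_ge {κ : ℝ} (hκ : 0 < κ) : ∃ Q₀ : ℕ, ∀ Q ≥ Q₀, ∀ α : ℝ, GoodDenom α Q →
    ∀ (d : ℕ) (P : Polynomial ℂ), P ≠ 0 → P.natDegree ≤ d → ∀ s : ℝ, 0 ≤ s →
    ∃ β : UnitAddCircle → ℝ, Integrable β ∧ (∀ x, 0 ≤ β x) ∧
      ∫ x, β x ≤ d * Q * Real.exp (-s) ∧
      (Integrable fun x => Real.log ‖P.eval (ec x)‖) ∧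
      ∀ᵐ x, Q * (∫ y : UnitAddCircle, Real.log ‖P.eval (ec y)‖) - d * (Q * κ + s) - β x ≤
        ∑ a ∈ Finset.range Q, Real.log ‖P.eval (ec (x + a • (α : UnitAddCircle)))‖ := by
  obtain ⟨Q₀, hQ₀⟩ := sum_log_ec_ge hκ
  refine ⟨Q₀, fun Q hQ α hα d P hP0 hPd s hs => ?_⟩
  have hlead : ‖P.leadingCoeff‖ ≠ 0 := by simpa using hP0
  have hfac : ∀ w : ℂ, P.eval w ≠ 0 → Real.log ‖P.eval w‖ =
      Real.log ‖P.leadingCoeff‖ + (P.roots.map fun r => Real.log ‖w - r‖).sum := by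
    intro w hw
    have h1 : P.eval w = P.leadingCoeff * (P.roots.map fun r => w - r).prod := by
      conv_lhs => rw [(IsAlgClosed.splits P).eq_prod_roots]
      rw [Polynomial.eval_mul, Polynomial.eval_C, Polynomial.eval_multiset_prod, Multiset.map_map]
      simp
    have h2 : ‖(P.roots.map fun r => w - r).prod‖ = (P.roots.map fun r => ‖w - r‖).prod := by
      have := map_multiset_prod (normHom : ℂ →*₀ ℝ) (P.roots.map fun r => w - r)
      rw [Multiset.map_map] at this
      exact this
    rw [h1, norm_mul, h2, Real.log_mul hlead]
    · congr 1
      have h3 : ∀ r ∈ P.roots, ‖w - r‖ ≠ 0 := by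
        intro r hr h
        rw [norm_eq_zero, sub_eq_zero] at h
        exact hw (h ▸ Polynomial.isRoot_of_mem_roots hr)
      clear h2 h1
      generalize P.roots = R at h3
      induction R using Multiset.induction_on with
      | empty => simp
      | cons r S ih =>
        rw [Multiset.map_cons, Multiset.prod_cons, Multiset.map_cons, Multiset.sum_cons,
          Real.log_mul (h3 r (by simp)), ih fun r' hr' => h3 r' (by simp [hr'])]
        intro h
        rw [Multiset.prod_eq_zero_iff] at h
        obtain ⟨r', hr', h4⟩ := Multiset.mem_map.1 h
        exact h3 r' (by simp [hr']) h4
    · rw [← h2]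
      intro h
      rw [norm_eq_zero] at h
      exact hw (by rw [h1, h, mul_zero])
  have hae : ∀ᵐ x : UnitAddCircle, P.eval (ec x) ≠ 0 := by
    have : ∀ᵐ x : UnitAddCircle, ∀ r ∈ P.roots.toFinset, ec x ≠ r := by
      rw [Filter.eventually_all_finset]
      exact fun r _ => ae_ec_ne r
    filter_upwards [this] with x hx h
    exact hx (ec x) (by simp [hP0, h]) rfl
  have key : ∀ S : Multiset ℂ,
      (Integrable fun x : UnitAddCircle => (S.map fun r => Real.log ‖ec x - r‖).sum) ∧
      (∫ x : UnitAddCircle, (S.map fun r => Real.log ‖ec x - r‖).sum) =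
        (S.map fun r => Real.posLog ‖r‖).sum ∧
      ∃ β : UnitAddCircle → ℝ, Integrable β ∧ (∀ x, 0 ≤ β x) ∧
        ∫ x, β x ≤ S.card * (Q * Real.exp (-s)) ∧
        ∀ x, Q * (S.map fun r => Real.posLog ‖r‖).sum - S.card * (Q * κ + s) - β x ≤
          ∑ a ∈ Finset.range Q,
              (S.map fun r => Real.log ‖ec (x + a • (α : UnitAddCircle)) - r‖).sum := by
    intro S
    induction S using Multiset.induction_on with
    | empty => exact ⟨by simp, by simp, fun _ => 0, by simp, by simp, by simp, by simp⟩
    | cons r S ih =>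
      obtain ⟨h1, h2, β, h3, h4, h5, h6⟩ := ih
      have hi : ∀ a : ℕ, Integrable fun x : UnitAddCircle =>
          logExcess s ‖ec (x + a • (α : UnitAddCircle)) - r‖ := fun a =>
        (integrable_logExcess s r).comp_add_right (a • (α : UnitAddCircle))
      refine ⟨?_, ?_, fun x => ∑ a ∈ Finset.range Q,
        logExcess s ‖ec (x + a • (α : UnitAddCircle)) - r‖ + β x, ?_, ?_, ?_, ?_⟩
      · simp only [Multiset.map_cons, Multiset.sum_cons]
        exact (integrable_log_ec_sub r).add h1
      · simp only [Multiset.map_cons, Multiset.sum_cons]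
        rw [integral_add (integrable_log_ec_sub r) h1, h2, integral_log_ec_sub]
      · exact (integrable_finsetSum _ fun a _ => hi a).add h3
      · exact fun x => add_nonneg (Finset.sum_nonneg fun a _ => logExcess_nonneg _ _) (h4 x)
      · rw [integral_add (integrable_finsetSum _ fun a _ => hi a) h3,
          integral_finsetSum _ fun a _ => hi a]
        have : ∑ a ∈ Finset.range Q, ∫ x : UnitAddCircle,
            logExcess s ‖ec (x + a • (α : UnitAddCircle)) - r‖ ≤
            ∑ a ∈ Finset.range Q, Real.exp (-s) := by
          refine Finset.sum_le_sum fun a _ => ?_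
          rw [integral_add_right_eq_self (fun x : UnitAddCircle => logExcess s ‖ec x - r‖)]
          exact integral_logExcess_le s r
        rw [Finset.sum_const, Finset.card_range, nsmul_eq_mul] at this
        rw [Multiset.card_cons]
        push_cast
        linarith
      · intro x
        simp only [Multiset.map_cons, Multiset.sum_cons, Finset.sum_add_distrib, Multiset.card_cons]
        have h7 := hQ₀ Q hQ α hα r x s hs
        have h8 := h6 x
        push_cast
        linarith
  obtain ⟨h1, h2, β, h3, h4, h5, h6⟩ := key P.roots
  have hcard : (P.roots.card : ℝ) ≤ d := by
    exact_mod_cast (Polynomial.card_roots' P).trans hPd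
  have hcongr : (fun x : UnitAddCircle => Real.log ‖P.eval (ec x)‖) =ᵐ[volume] fun x =>
      Real.log ‖P.leadingCoeff‖ + (P.roots.map fun r => Real.log ‖ec x - r‖).sum := by
    filter_upwards [hae] with x hx using hfac _ hx
  have h_integral : ∫ y : UnitAddCircle, Real.log ‖P.eval (ec y)‖ = Real.log ‖P.leadingCoeff‖ +
      (P.roots.map fun r => Real.posLog ‖r‖).sum := by
    rw [integral_congr_ae hcongr, integral_add (integrable_const _) h1, h2]
    simp
  refine ⟨β, h3, h4, h5.trans ?_, ((integrable_const _).add h1).congr hcongr.symm, ?_⟩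
  · rw [mul_assoc]; gcongr
  · have hae' : ∀ᵐ x : UnitAddCircle, ∀ a ∈ Finset.range Q,
        P.eval (ec (x + a • (α : UnitAddCircle))) ≠ 0 := by
      rw [Filter.eventually_all_finset]
      intro a _
      exact (measurePreserving_add_right (volume : Measure UnitAddCircle)
        (a • (α : UnitAddCircle))).quasiMeasurePreserving.ae
        (p := fun x => P.eval (ec x) ≠ 0) hae
    filter_upwards [hae'] with x hx
    rw [Finset.sum_congr rfl fun a ha => hfac _ (hx a ha), Finset.sum_add_distrib, h_integral,
      Finset.sum_const, Finset.card_range, nsmul_eq_mul]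
    have h7 := h6 x
    have h8 : (P.roots.card : ℝ) * (Q * κ + s) ≤ d * (Q * κ + s) := by gcongr
    linarith

lemma frob_sq (A : Matrix (Fin 2) (Fin 2) ℂ) :
    ‖A‖ ^ 2 = ‖A 0 0‖ ^ 2 + ‖A 0 1‖ ^ 2 + ‖A 1 0‖ ^ 2 + ‖A 1 1‖ ^ 2 := by
  rw [Matrix.frobenius_norm_def, ← Real.sqrt_eq_rpow, Real.sq_sqrt (by positivity)]
  simp [Fin.sum_univ_two]
  ring

lemma frob_eq_sqrt (A : Matrix (Fin 2) (Fin 2) ℂ) :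
    ‖A‖ = Real.sqrt (‖A 0 0‖ ^ 2 + ‖A 0 1‖ ^ 2 + ‖A 1 0‖ ^ 2 + ‖A 1 1‖ ^ 2) := by
  rw [← frob_sq, Real.sqrt_sq (norm_nonneg _)]

lemma frob_smul (c : ℂ) (A : Matrix (Fin 2) (Fin 2) ℂ) : ‖c • A‖ = ‖c‖ * ‖A‖ := by
  rw [← sq_eq_sq₀ (norm_nonneg _) (by positivity), mul_pow, frob_sq, frob_sq]
  simp [mul_pow]
  ring

lemma frob_entry_le (A : Matrix (Fin 2) (Fin 2) ℂ) (i j : Fin 2) : ‖A i j‖ ≤ ‖A‖ := by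
  rw [← sq_le_sq₀ (norm_nonneg _) (norm_nonneg _), frob_sq]
  have h1 := sq_nonneg ‖A 0 0‖
  have h2 := sq_nonneg ‖A 0 1‖
  have h3 := sq_nonneg ‖A 1 0‖
  have h4 := sq_nonneg ‖A 1 1‖
  fin_cases i <;> fin_cases j <;> simp <;> linarith

lemma frob_le_sum (A : Matrix (Fin 2) (Fin 2) ℂ) :
    ‖A‖ ≤ ‖A 0 0‖ + ‖A 0 1‖ + ‖A 1 0‖ + ‖A 1 1‖ := by
  rw [← sq_le_sq₀ (norm_nonneg _) (by positivity), frob_sq]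
  have h1 := norm_nonneg (A 0 0)
  have h2 := norm_nonneg (A 0 1)
  have h3 := norm_nonneg (A 1 0)
  have h4 := norm_nonneg (A 1 1)
  nlinarith [mul_nonneg h1 h2, mul_nonneg h1 h3, mul_nonneg h1 h4, mul_nonneg h2 h3,
    mul_nonneg h2 h4, mul_nonneg h3 h4]

lemma frob_one_le : ‖(1 : Matrix (Fin 2) (Fin 2) ℂ)‖ ≤ 2 := by
  rw [← sq_le_sq₀ (norm_nonneg _) (by norm_num), frob_sq]
  simp
  norm_num

lemma frob_adjugate (A : Matrix (Fin 2) (Fin 2) ℂ) : ‖A.adjugate‖ = ‖A‖ := by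
  rw [← sq_eq_sq₀ (norm_nonneg _) (norm_nonneg _), frob_sq, frob_sq, Matrix.adjugate_fin_two]
  simp
  ring

lemma two_norm_det_le (A : Matrix (Fin 2) (Fin 2) ℂ) : 2 * ‖A.det‖ ≤ ‖A‖ ^ 2 := by
  rw [frob_sq, Matrix.det_fin_two]
  have h := norm_sub_le (A 0 0 * A 1 1) (A 0 1 * A 1 0)
  rw [norm_mul, norm_mul] at h
  nlinarith [sq_nonneg (‖A 0 0‖ - ‖A 1 1‖), sq_nonneg (‖A 0 1‖ - ‖A 1 0‖)]

lemma frob_mul_le (A B : Matrix (Fin 2) (Fin 2) ℂ) : ‖A * B‖ ≤ ‖A‖ * ‖B‖ :=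
  Matrix.frobenius_norm_mul A B

lemma continuous_frob {X : Type*} [TopologicalSpace X] {M : X → Matrix (Fin 2) (Fin 2) ℂ}
    (h : ∀ i j, Continuous fun x => M x i j) : Continuous fun x => ‖M x‖ := by
  simp_rw [frob_eq_sqrt]
  exact Real.continuous_sqrt.comp ((((h 0 0).norm.pow 2).add ((h 0 1).norm.pow 2)).add
    ((h 1 0).norm.pow 2) |>.add ((h 1 1).norm.pow 2))

/-- The iterates of a matrix cocycle over a rotation of the circle. -/
def ct (α : ℝ) (A : UnitAddCircle → Matrix (Fin 2) (Fin 2) ℂ) :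
    ℕ → UnitAddCircle → Matrix (Fin 2) (Fin 2) ℂ
  | 0, _ => 1
  | n + 1, x => A (x + n • (α : UnitAddCircle)) * ct α A n x

lemma ct_add (α : ℝ) (A : UnitAddCircle → Matrix (Fin 2) (Fin 2) ℂ) (m n : ℕ)
    (x : UnitAddCircle) :
    ct α A (m + n) x = ct α A m (x + n • (α : UnitAddCircle)) * ct α A n x := by
  induction m with
  | zero => simp [ct]
  | succ m ih =>
    rw [show m + 1 + n = (m + n) + 1 by ring, ct, ih, ct, mul_assoc, add_assoc, ← add_smul,
      add_comm n m]

/-- The weight whose square is the modulus of the determinant. -/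
def wt (c : ℝ) (ζ₁ ζ₂ : ℂ) (x : UnitAddCircle) : ℝ := c * ‖ec x - ζ₁‖ * ‖ec x - ζ₂‖

/-- Matrix cocycles given by trigonometric polynomials of degree one, with determinant of
modulus `wt ^ 2`. -/
structure IsTrigCocycle (c B : ℝ) (ζ₁ ζ₂ : ℂ)
    (A : UnitAddCircle → Matrix (Fin 2) (Fin 2) ℂ) : Prop where
  c_pos : 0 < c
  one_le : 1 ≤ B
  norm_one : ‖ζ₁‖ = 1
  norm_two : ‖ζ₂‖ = 1
  coeff : ∃ A₀ A₁ A₂ : Matrix (Fin 2) (Fin 2) ℂ, ‖A₀‖ ≤ B / 3 ∧ ‖A₁‖ ≤ B / 3 ∧ ‖A₂‖ ≤ B / 3 ∧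
    ∀ x, A x = ec (-x) • A₀ + A₁ + ec x • A₂
  det : ∀ x, ‖(A x).det‖ = wt c ζ₁ ζ₂ x ^ 2

namespace IsTrigCocycle

variable {c B : ℝ} {ζ₁ ζ₂ : ℂ} {A A' : UnitAddCircle → Matrix (Fin 2) (Fin 2) ℂ} {α α' : ℝ}

lemma norm_le (H : IsTrigCocycle c B ζ₁ ζ₂ A) (x : UnitAddCircle) : ‖A x‖ ≤ B := by
  obtain ⟨A₀, A₁, A₂, h0, h1, h2, h⟩ := H.coeff
  rw [h]
  refine (norm_add_le _ _).trans ?_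
  have := norm_add_le (ec (-x) • A₀) A₁
  rw [frob_smul, norm_ec, one_mul] at this ⊢
  linarith

lemma lip (H : IsTrigCocycle c B ζ₁ ζ₂ A) (x y : UnitAddCircle) :
    ‖A x - A y‖ ≤ 5 * B * ‖x - y‖ := by
  obtain ⟨A₀, A₁, A₂, h0, h1, h2, h⟩ := H.coeff
  have h3 : A x - A y = (ec (-x) - ec (-y)) • A₀ + (ec x - ec y) • A₂ := by
    rw [h, h, sub_smul, sub_smul]; abel
  rw [h3]
  refine (norm_add_le _ _).trans ?_
  rw [frob_smul, frob_smul]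
  have h4 := norm_ec_sub_le x y
  have h5 := norm_ec_sub_le (-x) (-y)
  rw [show -x - -y = -(x - y) by abel, norm_neg] at h5
  have h6 : 2 * Real.pi * ‖x - y‖ ≤ 6.4 * ‖x - y‖ := by
    have := Real.pi_lt_d2
    gcongr
    linarith
  have hB : 0 ≤ B / 3 := (norm_nonneg _).trans h0
  have h7 : ‖ec (-x) - ec (-y)‖ * ‖A₀‖ ≤ (6.4 * ‖x - y‖) * (B / 3) := by
    gcongr; exact h5.trans h6
  have h8 : ‖ec x - ec y‖ * ‖A₂‖ ≤ (6.4 * ‖x - y‖) * (B / 3) := by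
    gcongr; exact h4.trans h6
  have h9 : 0 ≤ B * ‖x - y‖ := mul_nonneg (by linarith) (norm_nonneg _)
  linarith

lemma B_pos (H : IsTrigCocycle c B ζ₁ ζ₂ A) : 0 < B := one_pos.trans_le H.one_le

lemma norm_ct_le (H : IsTrigCocycle c B ζ₁ ζ₂ A) (n : ℕ) (x : UnitAddCircle) :
    ‖ct α A n x‖ ≤ 2 * B ^ n := by
  induction n with
  | zero => simpa [ct] using frob_one_le
  | succ n ih =>
    refine (frob_mul_le _ _).trans ?_
    have := mul_le_mul (H.norm_le (x + n • (α : UnitAddCircle))) ih (norm_nonneg _) H.B_pos.le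
    rw [pow_succ]
    linarith

lemma lip_ct (H : IsTrigCocycle c B ζ₁ ζ₂ A) (n : ℕ) :
    ∃ K : ℝ, 0 ≤ K ∧ ∀ x y, ‖ct α A n x - ct α A n y‖ ≤ K * ‖x - y‖ := by
  induction n with
  | zero => exact ⟨0, le_rfl, fun x y => by simp [ct]⟩
  | succ n ih =>
    obtain ⟨K, hK, h⟩ := ih
    have hB := H.B_pos
    refine ⟨B * K + 5 * B * (2 * B ^ n), by positivity, fun x y => ?_⟩
    have h1 : ct α A (n + 1) x - ct α A (n + 1) y =
        A (x + n • (α : UnitAddCircle)) * (ct α A n x - ct α A n y) +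
        (A (x + n • (α : UnitAddCircle)) - A (y + n • (α : UnitAddCircle))) * ct α A n y := by
      rw [ct, ct, mul_sub, sub_mul]; abel
    rw [h1]
    refine (norm_add_le _ _).trans ?_
    have h2 := (frob_mul_le (A (x + n • (α : UnitAddCircle))) (ct α A n x - ct α A n y)).trans
      (mul_le_mul (H.norm_le _) (h x y) (norm_nonneg _) hB.le)
    have h3 := H.lip (x + n • (α : UnitAddCircle)) (y + n • (α : UnitAddCircle))
    rw [add_sub_add_right_eq_sub] at h3
    have h4 := (frob_mul_le (A (x + n • (α : UnitAddCircle)) - A (y + n • (α : UnitAddCircle)))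
      (ct α A n y)).trans
      (mul_le_mul h3 (H.norm_ct_le n y) (norm_nonneg _) (by positivity))
    linarith

lemma ct_sub_le (H : IsTrigCocycle c B ζ₁ ζ₂ A) (H' : IsTrigCocycle c B ζ₁ ζ₂ A') {δ : ℝ}
    (hα : |α' - α| ≤ δ) (hA : ∀ x, ‖A' x - A x‖ ≤ δ) (n : ℕ) (x : UnitAddCircle) :
    ‖ct α' A' n x - ct α A n x‖ ≤ 12 * n ^ 2 * B ^ (n + 1) * δ := by
  have hδ : 0 ≤ δ := (abs_nonneg _).trans hα
  have hB := H.B_pos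
  induction n with
  | zero => simp [ct]
  | succ n ih =>
    have h1 : ct α' A' (n + 1) x - ct α A (n + 1) x =
        (A' (x + n • (α' : UnitAddCircle)) - A (x + n • (α : UnitAddCircle))) * ct α' A' n x +
        A (x + n • (α : UnitAddCircle)) * (ct α' A' n x - ct α A n x) := by
      rw [ct, ct, mul_sub, sub_mul]; abel
    have h2 : ‖A' (x + n • (α' : UnitAddCircle)) - A (x + n • (α : UnitAddCircle))‖ ≤
        δ + 5 * B * (n * δ) := by
      have h3 := norm_sub_le_norm_sub_add_norm_sub (A' (x + n • (α' : UnitAddCircle)))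
        (A (x + n • (α' : UnitAddCircle))) (A (x + n • (α : UnitAddCircle)))
      have h4 := H.lip (x + n • (α' : UnitAddCircle)) (x + n • (α : UnitAddCircle))
      rw [add_sub_add_left_eq_sub, nsmul_coe_eq, nsmul_coe_eq, ← AddCircle.coe_sub] at h4
      have h5 := norm_coe_le_abs (n * α' - n * α)
      rw [← mul_sub, abs_mul, Nat.abs_cast] at h5
      have h6 : ‖((n * α' - n * α : ℝ) : UnitAddCircle)‖ ≤ n * δ := by
        rw [← mul_sub]; exact h5.trans (by gcongr)
      have h7 : 5 * B * ‖((n * α' - n * α : ℝ) : UnitAddCircle)‖ ≤ 5 * B * (n * δ) := by gcongr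
      have h8 := hA (x + n • (α' : UnitAddCircle))
      simp only [nsmul_coe_eq] at *
      linarith
    rw [h1]
    refine (norm_add_le _ _).trans ?_
    have h3 := (frob_mul_le (A' (x + n • (α' : UnitAddCircle)) - A (x + n • (α : UnitAddCircle)))
      (ct α' A' n x)).trans (mul_le_mul h2 (H'.norm_ct_le n x) (norm_nonneg _) (by positivity))
    have h4 := (frob_mul_le (A (x + n • (α : UnitAddCircle))) (ct α' A' n x - ct α A n x)).trans
      (mul_le_mul (H.norm_le _) ih (norm_nonneg _) hB.le)
    have h5 : (δ + 5 * B * (n * δ)) * (2 * B ^ n) ≤ (12 * n + 2) * B ^ (n + 2) * δ := by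
      have h6 : B ^ n ≤ B ^ (n + 2) := pow_le_pow_right₀ H.one_le (by omega)
      have h7 : B ^ (n + 1) ≤ B ^ (n + 2) := pow_le_pow_right₀ H.one_le (by omega)
      have h8 : δ * B ^ n ≤ δ * B ^ (n + 2) := by gcongr
      have h9 : n * δ * B ^ (n + 1) ≤ n * δ * B ^ (n + 2) := by gcongr
      have h10 : 0 ≤ n * δ * B ^ (n + 2) := by positivity
      have h11 : (δ + 5 * B * (n * δ)) * (2 * B ^ n) =
          2 * (δ * B ^ n) + 10 * (n * δ * B ^ (n + 1)) := by
        ring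
      rw [h11]
      linarith
    have h12 : 0 ≤ (12 * n + 10) * B ^ (n + 2) * δ := by positivity
    push_cast
    calc _ ≤ (12 * n + 2) * B ^ (n + 2) * δ + B * (12 * n ^ 2 * B ^ (n + 1) * δ) := by linarith
      _ ≤ (12 * n + 2) * B ^ (n + 2) * δ + B * (12 * n ^ 2 * B ^ (n + 1) * δ) +
          (12 * n + 10) * B ^ (n + 2) * δ := by linarith
      _ = _ := by ring

lemma norm_det_ct (H : IsTrigCocycle c B ζ₁ ζ₂ A) (n : ℕ) (x : UnitAddCircle) :
    ‖(ct α A n x).det‖ = (∏ j ∈ Finset.range n, wt c ζ₁ ζ₂ (x + j • (α : UnitAddCircle))) ^ 2 := by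
  induction n with
  | zero => simp [ct]
  | succ n ih =>
    rw [ct, Matrix.det_mul, norm_mul, ih, H.det, Finset.prod_range_succ]
    ring

lemma wt_nonneg (H : IsTrigCocycle c B ζ₁ ζ₂ A) (x : UnitAddCircle) : 0 ≤ wt c ζ₁ ζ₂ x := by
  have := H.c_pos
  unfold wt
  positivity

lemma prod_wt_le (H : IsTrigCocycle c B ζ₁ ζ₂ A) (n : ℕ) (x : UnitAddCircle) :
    ∏ j ∈ Finset.range n, wt c ζ₁ ζ₂ (x + j • (α : UnitAddCircle)) ≤ ‖ct α A n x‖ := by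
  have h := two_norm_det_le (ct α A n x)
  rw [H.norm_det_ct] at h
  refine abs_le_of_sq_le_sq' ?_ (norm_nonneg _) |>.2
  have := sq_nonneg (∏ j ∈ Finset.range n, wt c ζ₁ ζ₂ (x + j • (α : UnitAddCircle)))
  linarith

lemma isTrigPoly_entry (H : IsTrigCocycle c B ζ₁ ζ₂ A) (i j : Fin 2) :
    IsTrigPoly 1 fun x => A x i j := by
  obtain ⟨A₀, A₁, A₂, -, -, -, h⟩ := H.coeff
  have : (fun x => A x i j) = fun x => ec (-x) * A₀ i j + A₁ i j + ec x * A₂ i j := by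
    funext x; rw [h]; simp
  rw [this]
  exact ((isTrigPoly_ec_neg.mul (isTrigPoly_const 0 _)).add (isTrigPoly_const 1 _)).add
    (isTrigPoly_ec.mul (isTrigPoly_const 0 _))

lemma isTrigPoly_ct (H : IsTrigCocycle c B ζ₁ ζ₂ A) (n : ℕ) (i j : Fin 2) :
    IsTrigPoly n fun x => ct α A n x i j := by
  induction n generalizing i j with
  | zero => exact isTrigPoly_const 0 _
  | succ n ih =>
    have : (fun x => ct α A (n + 1) x i j) = fun x =>
        A (x + n • (α : UnitAddCircle)) i 0 * ct α A n x 0 j +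
        A (x + n • (α : UnitAddCircle)) i 1 * ct α A n x 1 j := by
      funext x; rw [ct, Matrix.mul_apply, Fin.sum_univ_two]
    rw [this, add_comm n 1]
    exact ((isTrigPoly_translate (H.isTrigPoly_entry i 0) _).mul (ih 0 j)).add
      ((isTrigPoly_translate (H.isTrigPoly_entry i 1) _).mul (ih 1 j))

lemma exists_poly (H : IsTrigCocycle c B ζ₁ ζ₂ A) (α : ℝ) (n : ℕ) :
    ∃ P : Polynomial ℂ, P.natDegree ≤ 4 * n ∧ ∀ x, ‖P.eval (ec x)‖ = ‖ct α A n x‖ ^ 2 := by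
  have h : ∀ i j, IsTrigPoly (n + n) fun x =>
      ct α A n x i j * (starRingEnd ℂ) (ct α A n x i j) := fun i j =>
    (H.isTrigPoly_ct n i j).mul (H.isTrigPoly_ct n i j).conj
  obtain ⟨P, hP, hP'⟩ := (((h 0 0).add (h 0 1)).add (h 1 0)).add (h 1 1)
  refine ⟨P, hP.trans (by omega), fun x => ?_⟩
  rw [← hP', norm_mul, norm_pow, norm_ec, one_pow, one_mul, frob_sq]
  simp only [Complex.mul_conj, Complex.normSq_eq_norm_sq]
  rw [← Complex.ofReal_add, ← Complex.ofReal_add, ← Complex.ofReal_add, Complex.norm_real,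
    Real.norm_eq_abs, abs_of_nonneg (by positivity)]

lemma continuous_ct (H : IsTrigCocycle c B ζ₁ ζ₂ A) (α : ℝ) (n : ℕ) :
    Continuous fun x => ‖ct α A n x‖ := by
  refine continuous_frob fun i j => ?_
  obtain ⟨P, -, hP⟩ := H.isTrigPoly_ct (α := α) n i j
  have : (fun x => ct α A n x i j) = fun x => P.eval (ec x) / ec x ^ n := by
    funext x
    rw [← hP, mul_div_cancel_left₀ _ (pow_ne_zero _ (ec_ne_zero x))]
  rw [this]
  exact (P.continuous.comp continuous_ec).div (continuous_ec.pow n)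
    fun x => pow_ne_zero _ (ec_ne_zero x)

end IsTrigCocycle

/-- Logarithm of the norm of the iterates of a cocycle. -/
def lphi (α : ℝ) (A : UnitAddCircle → Matrix (Fin 2) (Fin 2) ℂ) (n : ℕ) (x : UnitAddCircle) : ℝ :=
  Real.log ‖ct α A n x‖

/-- Mean of the logarithm of the norm of the iterates of a cocycle. -/
def lI (α : ℝ) (A : UnitAddCircle → Matrix (Fin 2) (Fin 2) ℂ) (n : ℕ) : ℝ :=
  ∫ x, lphi α A n x

/-- The forward orbit of `x` avoids the zeros of the weight. -/
def Reg (α c : ℝ) (ζ₁ ζ₂ : ℂ) (x : UnitAddCircle) : Prop :=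
  ∀ j : ℕ, 0 < wt c ζ₁ ζ₂ (x + j • (α : UnitAddCircle))

lemma Reg.shift {α c : ℝ} {ζ₁ ζ₂ : ℂ} {x : UnitAddCircle} (h : Reg α c ζ₁ ζ₂ x) (n : ℕ) :
    Reg α c ζ₁ ζ₂ (x + n • (α : UnitAddCircle)) := fun j => by
  rw [add_assoc, ← add_smul]; exact h (n + j)

lemma volume_real_ge_le {β : UnitAddCircle → ℝ} (h0 : ∀ x, 0 ≤ β x) (hi : Integrable β) {ε : ℝ}
    (hε : 0 < ε) {M : ℝ} (hM : ∫ x, β x ≤ ε * M) :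
    (volume : Measure UnitAddCircle).real {x | ε ≤ β x} ≤ M := by
  have := mul_meas_ge_le_integral_of_nonneg (Filter.Eventually.of_forall h0) hi ε
  exact le_of_mul_le_mul_left (this.trans hM) hε

lemma ae_shift {p : UnitAddCircle → Prop} (h : ∀ᵐ x, p x) (y : UnitAddCircle) :
    ∀ᵐ x, p (x + y) :=
  (measurePreserving_add_right (volume : Measure UnitAddCircle) y).quasiMeasurePreserving.ae
    (p := p) h

namespace IsTrigCocycle

variable {c B : ℝ} {ζ₁ ζ₂ : ℂ} {A A' : UnitAddCircle → Matrix (Fin 2) (Fin 2) ℂ} {α α' : ℝ}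

lemma ae_wt_pos (H : IsTrigCocycle c B ζ₁ ζ₂ A) : ∀ᵐ x, 0 < wt c ζ₁ ζ₂ x := by
  filter_upwards [ae_ec_ne ζ₁, ae_ec_ne ζ₂] with x h1 h2
  have := H.c_pos
  have h3 := norm_pos_iff.2 (sub_ne_zero.2 h1)
  have h4 := norm_pos_iff.2 (sub_ne_zero.2 h2)
  unfold wt
  positivity

lemma ae_reg (H : IsTrigCocycle c B ζ₁ ζ₂ A) (α : ℝ) : ∀ᵐ x, Reg α c ζ₁ ζ₂ x := by
  unfold Reg
  rw [ae_all_iff]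
  exact fun j => ae_shift H.ae_wt_pos _

lemma wt_eq (H : IsTrigCocycle c B ζ₁ ζ₂ A) : (fun x => Real.log (wt c ζ₁ ζ₂ x)) =ᵐ[volume]
    fun x => Real.log c + Real.log ‖ec x - ζ₁‖ + Real.log ‖ec x - ζ₂‖ := by
  filter_upwards [ae_ec_ne ζ₁, ae_ec_ne ζ₂] with x h1 h2
  have := H.c_pos
  have h3 := norm_pos_iff.2 (sub_ne_zero.2 h1)
  have h4 := norm_pos_iff.2 (sub_ne_zero.2 h2)
  rw [wt, Real.log_mul (by positivity) h4.ne', Real.log_mul this.ne' h3.ne']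

lemma integrable_log_wt (H : IsTrigCocycle c B ζ₁ ζ₂ A) :
    Integrable fun x => Real.log (wt c ζ₁ ζ₂ x) :=
  (((integrable_const _).add (integrable_log_ec_sub ζ₁)).add (integrable_log_ec_sub ζ₂)).congr
    H.wt_eq.symm

lemma integral_log_wt (H : IsTrigCocycle c B ζ₁ ζ₂ A) :
    ∫ x, Real.log (wt c ζ₁ ζ₂ x) = Real.log c := by
  have h : Integrable fun x => Real.log c + Real.log ‖ec x - ζ₁‖ :=
    (integrable_const _).add (integrable_log_ec_sub ζ₁)
  rw [integral_congr_ae H.wt_eq, integral_add h (integrable_log_ec_sub ζ₂),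
    integral_add (integrable_const _) (integrable_log_ec_sub ζ₁), integral_log_ec_sub,
        integral_log_ec_sub, H.norm_one, H.norm_two]
  simp

lemma wt_le (H : IsTrigCocycle c B ζ₁ ζ₂ A) (x : UnitAddCircle) : wt c ζ₁ ζ₂ x ≤ 4 * c := by
  have h1 := norm_sub_le (ec x) ζ₁
  have h2 := norm_sub_le (ec x) ζ₂
  rw [norm_ec, H.norm_one] at h1
  rw [norm_ec, H.norm_two] at h2
  have := H.c_pos
  calc wt c ζ₁ ζ₂ x ≤ c * (1 + 1) * (1 + 1) := by unfold wt; gcongr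
    _ = _ := by ring

lemma log_wt_le (H : IsTrigCocycle c B ζ₁ ζ₂ A) {x : UnitAddCircle} (hx : 0 < wt c ζ₁ ζ₂ x) :
    Real.log (wt c ζ₁ ζ₂ x) ≤ |Real.log c| + 2 := by
  have h := Real.log_le_log hx (H.wt_le x)
  rw [Real.log_mul (by norm_num) H.c_pos.ne', show (4 : ℝ) = 2 * 2 by norm_num,
    Real.log_mul (by norm_num) (by norm_num)] at h
  have h2 := Real.log_two_lt_d9
  have := le_abs_self (Real.log c)
  linarith

lemma log_B_nonneg (H : IsTrigCocycle c B ζ₁ ζ₂ A) : 0 ≤ Real.log B := Real.log_nonneg H.one_le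

lemma lphi_le (H : IsTrigCocycle c B ζ₁ ζ₂ A) (α : ℝ) (n : ℕ) (x : UnitAddCircle) :
    lphi α A n x ≤ n * Real.log B + 1 := by
  have hB := H.log_B_nonneg
  rcases (norm_nonneg (ct α A n x)).eq_or_lt with h | h
  · rw [lphi, ← h, Real.log_zero]; positivity
  · refine (Real.log_le_log h (H.norm_ct_le n x)).trans ?_
    rw [Real.log_mul (by norm_num) (pow_pos H.B_pos _).ne', Real.log_pow]
    have := Real.log_two_lt_d9
    linarith

lemma norm_ct_pos (H : IsTrigCocycle c B ζ₁ ζ₂ A) {x : UnitAddCircle} (hx : Reg α c ζ₁ ζ₂ x)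
    (n : ℕ) : 0 < ‖ct α A n x‖ :=
  (Finset.prod_pos fun j _ => hx j).trans_le (H.prod_wt_le n x)

lemma lphi_ge (H : IsTrigCocycle c B ζ₁ ζ₂ A) {x : UnitAddCircle} (hx : Reg α c ζ₁ ζ₂ x) (n : ℕ) :
    ∑ j ∈ Finset.range n, Real.log (wt c ζ₁ ζ₂ (x + j • (α : UnitAddCircle))) ≤ lphi α A n x := by
  rw [← Real.log_prod fun j _ => (hx j).ne']
  exact Real.log_le_log (Finset.prod_pos fun j _ => hx j) (H.prod_wt_le n x)

lemma measurable_lphi (H : IsTrigCocycle c B ζ₁ ζ₂ A) (α : ℝ) (n : ℕ) :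
    Measurable (lphi α A n) :=
  Real.measurable_log.comp (H.continuous_ct α n).measurable

lemma integrable_sum_log_wt (H : IsTrigCocycle c B ζ₁ ζ₂ A) (α : ℝ) (n : ℕ) :
    Integrable fun x => ∑ j ∈ Finset.range n,
      Real.log (wt c ζ₁ ζ₂ (x + j • (α : UnitAddCircle))) :=
  integrable_finsetSum _ fun j _ => H.integrable_log_wt.comp_add_right (j • (α : UnitAddCircle))

lemma abs_lphi_le (H : IsTrigCocycle c B ζ₁ ζ₂ A) {x : UnitAddCircle} (hx : Reg α c ζ₁ ζ₂ x)
    (n : ℕ) : |lphi α A n x| ≤ n * Real.log B + 1 +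
      ∑ j ∈ Finset.range n, |Real.log (wt c ζ₁ ζ₂ (x + j • (α : UnitAddCircle)))| := by
  have h1 := H.lphi_le α n x
  have h2 := H.lphi_ge hx n
  have h3 : ∑ j ∈ Finset.range n, -|Real.log (wt c ζ₁ ζ₂ (x + j • (α : UnitAddCircle)))| ≤
    ∑ j ∈ Finset.range n, Real.log (wt c ζ₁ ζ₂ (x + j • (α : UnitAddCircle))) :=
    Finset.sum_le_sum fun j _ => neg_abs_le _
  have h4 : 0 ≤ ∑ j ∈ Finset.range n, |Real.log (wt c ζ₁ ζ₂ (x + j • (α : UnitAddCircle)))| :=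
    Finset.sum_nonneg fun j _ => abs_nonneg _
  have h5 : 0 ≤ n * Real.log B := mul_nonneg (Nat.cast_nonneg _) H.log_B_nonneg
  rw [Finset.sum_neg_distrib] at h3
  rw [abs_le]
  constructor <;> linarith

lemma integrable_lphi (H : IsTrigCocycle c B ζ₁ ζ₂ A) (α : ℝ) (n : ℕ) :
    Integrable (lphi α A n) := by
  refine Integrable.mono' (g := fun x => n * Real.log B + 1 +
      ∑ j ∈ Finset.range n, |Real.log (wt c ζ₁ ζ₂ (x + j • (α : UnitAddCircle)))|) ?_
    (H.measurable_lphi α n).aestronglyMeasurable ?_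
  · exact (integrable_const _).add (integrable_finsetSum _ fun j _ =>
      (H.integrable_log_wt.comp_add_right (j • (α : UnitAddCircle))).abs)
  · filter_upwards [H.ae_reg α] with x hx using H.abs_lphi_le hx n

lemma lphi_add_le (H : IsTrigCocycle c B ζ₁ ζ₂ A) {x : UnitAddCircle} (hx : Reg α c ζ₁ ζ₂ x)
    (m n : ℕ) : lphi α A (m + n) x ≤ lphi α A m (x + n • (α : UnitAddCircle)) + lphi α A n x := by
  unfold lphi
  rw [← Real.log_mul (H.norm_ct_pos (hx.shift n) m).ne' (H.norm_ct_pos hx n).ne']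
  refine Real.log_le_log (H.norm_ct_pos hx _) ?_
  rw [ct_add]
  exact frob_mul_le _ _

lemma lI_add_le (H : IsTrigCocycle c B ζ₁ ζ₂ A) (α : ℝ) (m n : ℕ) :
    lI α A (m + n) ≤ lI α A m + lI α A n := by
  have h1 := (H.integrable_lphi α m).comp_add_right (n • (α : UnitAddCircle))
  have h2 : ∫ x, lphi α A m (x + n • (α : UnitAddCircle)) = lI α A m :=
    integral_add_right_eq_self (lphi α A m) _
  rw [← h2]
  unfold lI
  rw [← integral_add h1 (H.integrable_lphi α n)]
  refine integral_mono_ae (H.integrable_lphi α _) (h1.add (H.integrable_lphi α n)) ?_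
  filter_upwards [H.ae_reg α] with x hx using H.lphi_add_le hx m n

lemma lI_ge (H : IsTrigCocycle c B ζ₁ ζ₂ A) (α : ℝ) (n : ℕ) :
    n * Real.log c ≤ lI α A n := by
  have h : ∫ x, ∑ j ∈ Finset.range n, Real.log (wt c ζ₁ ζ₂ (x + j • (α : UnitAddCircle))) =
      n * Real.log c := by
    rw [integral_finsetSum _ fun j _ =>
      H.integrable_log_wt.comp_add_right (j • (α : UnitAddCircle))]
    have : ∀ j ∈ Finset.range n, ∫ x, Real.log (wt c ζ₁ ζ₂ (x + j • (α : UnitAddCircle))) =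
        Real.log c := fun j _ => by
      rw [integral_add_right_eq_self (fun x => Real.log (wt c ζ₁ ζ₂ x)), H.integral_log_wt]
    rw [Finset.sum_congr rfl this]
    simp
  rw [← h]
  refine integral_mono_ae (H.integrable_sum_log_wt α n) (H.integrable_lphi α n) ?_
  filter_upwards [H.ae_reg α] with x hx using H.lphi_ge hx n

/-- Existence of the Lyapunov exponent. -/
lemma exists_lyap (H : IsTrigCocycle c B ζ₁ ζ₂ A) (α : ℝ) : ∃ L : ℝ,
    Filter.Tendsto (fun n : ℕ => lI α A n / n) Filter.atTop (nhds L) ∧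
    (∀ n : ℕ, n * L ≤ lI α A n) ∧ Real.log c ≤ L := by
  have hs : Subadditive (lI α A) := fun m n => H.lI_add_le α m n
  have hb : BddBelow (Set.range fun n : ℕ => lI α A n / n) := by
    refine ⟨min 0 (Real.log c), ?_⟩
    rintro _ ⟨n, rfl⟩
    rcases Nat.eq_zero_or_pos n with rfl | hn
    · simp
    · refine (min_le_right _ _).trans ?_
      rw [le_div_iff₀ (by exact_mod_cast hn), mul_comm]
      exact H.lI_ge α n
  have ht := hs.tendsto_lim hb
  refine ⟨hs.lim, ht, fun n => ?_, ?_⟩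
  · rcases Nat.eq_zero_or_pos n with rfl | hn
    · have := H.lI_add_le α 0 0
      rw [add_zero] at this
      push_cast; linarith
    · have := hs.lim_le_div hb hn.ne'
      rwa [le_div_iff₀ (by exact_mod_cast hn), mul_comm] at this
  · refine ge_of_tendsto ht ?_
    filter_upwards [Filter.eventually_gt_atTop 0] with n hn
    rw [le_div_iff₀ (by exact_mod_cast hn), mul_comm]
    exact H.lI_ge α n

lemma lphi_shift_one (H : IsTrigCocycle c B ζ₁ ζ₂ A) {x : UnitAddCircle} (hx : Reg α c ζ₁ ζ₂ x)
    (n : ℕ) : lphi α A n (x + (α : UnitAddCircle)) + 2 * Real.log (wt c ζ₁ ζ₂ x) ≤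
      2 * Real.log B + lphi α A n x := by
  have hw : 0 < wt c ζ₁ ζ₂ x := by simpa using hx 0
  have hx1 : Reg α c ζ₁ ζ₂ (x + (α : UnitAddCircle)) := by simpa using hx.shift 1
  have h1 := H.norm_ct_pos hx1 n
  have h2 := H.norm_ct_pos hx n
  have e1 := ct_add α A n 1 x
  have e2 : ct α A (n + 1) x = A (x + n • (α : UnitAddCircle)) * ct α A n x := rfl
  have e3 : ct α A 1 x = A x := by simp [ct]
  rw [e3, one_smul, e2] at e1
  have e4 : (A x).det • ct α A n (x + (α : UnitAddCircle)) =
      A (x + n • (α : UnitAddCircle)) * ct α A n x * (A x).adjugate := by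
    rw [e1, mul_assoc, Matrix.mul_adjugate, mul_smul_comm, mul_one]
  have h3 : wt c ζ₁ ζ₂ x ^ 2 * ‖ct α A n (x + (α : UnitAddCircle))‖ ≤ B ^ 2 * ‖ct α A n x‖ := by
    rw [← H.det, ← frob_smul, e4]
    refine (frob_mul_le _ _).trans ?_
    rw [frob_adjugate]
    calc _ ≤ (B * ‖ct α A n x‖) * B := by
          have hB := H.B_pos
          gcongr
          · exact (frob_mul_le _ _).trans (by gcongr; exact H.norm_le _)
          · exact H.norm_le _
      _ = _ := by ring
  have h4 := Real.log_le_log (by positivity) h3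
  rw [Real.log_mul (by positivity) h1.ne', Real.log_mul (pow_pos H.B_pos 2).ne' h2.ne',
    Real.log_pow, Real.log_pow] at h4
  push_cast at h4
  unfold lphi
  linarith

lemma lphi_shift (H : IsTrigCocycle c B ζ₁ ζ₂ A) {x : UnitAddCircle} (hx : Reg α c ζ₁ ζ₂ x)
    (n a : ℕ) : lphi α A n (x + a • (α : UnitAddCircle)) +
      2 * ∑ j ∈ Finset.range a, Real.log (wt c ζ₁ ζ₂ (x + j • (α : UnitAddCircle))) ≤
      2 * a * Real.log B + lphi α A n x := by
  induction a with
  | zero => simp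
  | succ a ih =>
    have h := H.lphi_shift_one (hx.shift a) n
    rw [add_assoc, ← succ_nsmul] at h
    rw [Finset.sum_range_succ]
    push_cast
    linarith

end IsTrigCocycle

/-- Lower bound for sums of the logarithm of the weight over short orbits, off a small set. -/
lemma sum_log_wt_ge {κ : ℝ} (hκ : 0 < κ) (hκ1 : κ ≤ 1) : ∃ Q₀ : ℕ, ∀ Q ≥ Q₀, ∀ α : ℝ,
    GoodDenom α Q → ∀ (c B : ℝ) (ζ₁ ζ₂ : ℂ) (A : UnitAddCircle → Matrix (Fin 2) (Fin 2) ℂ),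
    IsTrigCocycle c B ζ₁ ζ₂ A → ∀ σ : ℝ, 0 ≤ σ → σ ≤ 1 →
    ∃ bad : Set UnitAddCircle, volume.real bad ≤ 2 * Real.exp (-(σ * Q)) ∧
      ∀ x, Reg α c ζ₁ ζ₂ x → x ∉ bad → ∀ a ≤ Q,
      -(2 * |Real.log c| + 7) * Q ≤
        ∑ j ∈ Finset.range a, Real.log (wt c ζ₁ ζ₂ (x + j • (α : UnitAddCircle))) := by
  obtain ⟨Q₀, hQ₀⟩ := sum_log_ec_ge hκ
  refine ⟨Q₀, fun Q hQ α hα c B ζ₁ ζ₂ A H σ hσ hσ1 => ?_⟩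
  have hQpos : (0 : ℝ) < Q := by exact_mod_cast hα.1
  set β : UnitAddCircle → ℝ := fun x =>
    ∑ a ∈ Finset.range Q, (logExcess (σ * Q) ‖ec (x + a • (α : UnitAddCircle)) - ζ₁‖ +
      logExcess (σ * Q) ‖ec (x + a • (α : UnitAddCircle)) - ζ₂‖) with hβ
  have hi : ∀ ζ (a : ℕ), Integrable fun x : UnitAddCircle =>
      logExcess (σ * Q) ‖ec (x + a • (α : UnitAddCircle)) - ζ‖ := fun ζ a =>
    (integrable_logExcess (σ * Q) ζ).comp_add_right (a • (α : UnitAddCircle))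
  have hi2 : ∀ ζ (a : ℕ), ∫ x : UnitAddCircle,
      logExcess (σ * Q) ‖ec (x + a • (α : UnitAddCircle)) - ζ‖
          ≤ Real.exp (-(σ * Q)) := fun ζ a => by
    rw [integral_add_right_eq_self (fun x : UnitAddCircle => logExcess (σ * Q) ‖ec x - ζ‖)]
    exact integral_logExcess_le _ _
  have hβ0 : ∀ x, 0 ≤ β x := fun x =>
    Finset.sum_nonneg fun a _ => add_nonneg (logExcess_nonneg _ _) (logExcess_nonneg _ _)
  have hβi : Integrable β := integrable_finsetSum _ fun a _ => (hi ζ₁ a).add (hi ζ₂ a)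
  have hβI : ∫ x, β x ≤ Q * (2 * Real.exp (-(σ * Q))) := by
    have hi3 : ∀ a ∈ Finset.range Q, Integrable fun x : UnitAddCircle =>
        logExcess (σ * Q) ‖ec (x + a • (α : UnitAddCircle)) - ζ₁‖ +
        logExcess (σ * Q) ‖ec (x + a • (α : UnitAddCircle)) - ζ₂‖ :=
      fun a _ => (hi ζ₁ a).add (hi ζ₂ a)
    simp only [hβ]
    rw [integral_finsetSum _ hi3]
    refine (Finset.sum_le_sum (g := fun _ => 2 * Real.exp (-(σ * Q))) fun a _ => ?_).trans ?_
    · rw [integral_add (hi ζ₁ a) (hi ζ₂ a)]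
      have := hi2 ζ₁ a
      have := hi2 ζ₂ a
      linarith
    · simp
  refine ⟨{x | (Q : ℝ) ≤ β x}, volume_real_ge_le hβ0 hβi hQpos hβI, fun x hx hbad a ha => ?_⟩
  have hbad' : β x < Q := not_le.1 hbad
  have hs : 0 ≤ σ * Q := by positivity
  have h1 := hQ₀ Q hQ α hα ζ₁ x (σ * Q) hs
  have h2 := hQ₀ Q hQ α hα ζ₂ x (σ * Q) hs
  rw [H.norm_one] at h1
  rw [H.norm_two] at h2
  have hp1 : Real.posLog 1 = 0 := by simp [Real.posLog]
  rw [hp1] at h1 h2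
  have h3 : ∑ j ∈ Finset.range Q, Real.log (wt c ζ₁ ζ₂ (x + j • (α : UnitAddCircle))) =
      Q * Real.log c + ∑ j ∈ Finset.range Q, Real.log ‖ec (x + j • (α : UnitAddCircle)) - ζ₁‖ +
      ∑ j ∈ Finset.range Q, Real.log ‖ec (x + j • (α : UnitAddCircle)) - ζ₂‖ := by
    have h4 : ∀ j ∈ Finset.range Q, Real.log (wt c ζ₁ ζ₂ (x + j • (α : UnitAddCircle))) =
        Real.log c + Real.log ‖ec (x + j • (α : UnitAddCircle)) - ζ₁‖ +
        Real.log ‖ec (x + j • (α : UnitAddCircle)) - ζ₂‖ := fun j _ => by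
      have h5 := (hx j).ne'
      unfold wt at h5 ⊢
      have h6 := right_ne_zero_of_mul h5
      have h7 := left_ne_zero_of_mul h5
      rw [Real.log_mul h7 h6, Real.log_mul (left_ne_zero_of_mul h7) (right_ne_zero_of_mul h7)]
    rw [Finset.sum_congr rfl h4, Finset.sum_add_distrib, Finset.sum_add_distrib]
    simp
  have h4 : β x = ∑ a ∈ Finset.range Q,
        logExcess (σ * Q) ‖ec (x + a • (α : UnitAddCircle)) - ζ₁‖ +
      ∑ a ∈ Finset.range Q, logExcess (σ * Q) ‖ec (x + a • (α : UnitAddCircle)) - ζ₂‖ :=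
    Finset.sum_add_distrib
  have h5 : ∑ j ∈ Finset.range Q, Real.log (wt c ζ₁ ζ₂ (x + j • (α : UnitAddCircle))) =
      ∑ j ∈ Finset.range a, Real.log (wt c ζ₁ ζ₂ (x + j • (α : UnitAddCircle))) +
      ∑ j ∈ Finset.Ico a Q, Real.log (wt c ζ₁ ζ₂ (x + j • (α : UnitAddCircle))) :=
    (Finset.sum_range_add_sum_Ico _ ha).symm
  have h6 : ∑ j ∈ Finset.Ico a Q, Real.log (wt c ζ₁ ζ₂ (x + j • (α : UnitAddCircle))) ≤
      Q * (|Real.log c| + 2) := by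
    refine (Finset.sum_le_card_nsmul _ _ _ fun j _ => H.log_wt_le (hx j)).trans ?_
    rw [nsmul_eq_mul, Nat.card_Ico]
    have : ((Q - a : ℕ) : ℝ) ≤ Q := by exact_mod_cast Nat.sub_le _ _
    gcongr
  have h7 : -(Q * |Real.log c|) ≤ Q * Real.log c := by
    have := neg_abs_le (Real.log c)
    nlinarith
  have h8 : Q * κ ≤ Q * 1 := by gcongr
  have h9 : σ * Q ≤ 1 * Q := by gcongr
  linarith

/-- Large deviation estimate along a good denominator. -/
lemma large_deviation (c B : ℝ) {κ σ : ℝ} (hκ : 0 < κ) (hκ1 : κ ≤ 1) (hσ : 0 < σ) (hσ1 : σ ≤ 1) :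
    ∃ Q₀ : ℕ, ∀ Q ≥ Q₀, ∀ α : ℝ, GoodDenom α Q →
    ∀ (ζ₁ ζ₂ : ℂ) (A : UnitAddCircle → Matrix (Fin 2) (Fin 2) ℂ),
    IsTrigCocycle c B ζ₁ ζ₂ A → ∀ n : ℕ, 1 ≤ n →
    ∃ bad : Set UnitAddCircle, MeasurableSet bad ∧
      volume.real bad ≤ 4 / σ * Real.exp (-(σ * Q)) ∧
      ∀ᵐ x, x ∉ bad → lI α A n - n * (2 * κ + 3 * σ) -
        (2 * Real.log B + 4 * |Real.log c| + 14) * Q ≤ lphi α A n x := by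
  obtain ⟨Q₁, hQ₁⟩ := sum_log_poly_ge hκ
  obtain ⟨Q₂, hQ₂⟩ := sum_log_wt_ge hκ hκ1
  refine ⟨max Q₁ Q₂, fun Q hQ α hα ζ₁ ζ₂ A H n hn => ?_⟩
  have hQpos : (0 : ℝ) < Q := by exact_mod_cast hα.1
  have hnpos : (0 : ℝ) < n := by exact_mod_cast hn
  obtain ⟨P, hPd, hP⟩ := H.exists_poly α n
  have hP0 : P ≠ 0 := by
    rintro rfl
    obtain ⟨x, hx⟩ := (H.ae_reg α).exists
    have := hP x
    have h2 := H.norm_ct_pos hx n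
    rw [Polynomial.eval_zero, norm_zero] at this
    exact (pow_pos h2 2).ne this
  obtain ⟨β, hβi, hβ0, hβI, -, hβ⟩ := hQ₁ Q (le_trans (le_max_left _ _) hQ) α hα (4 * n) P hP0 hPd
    (σ * Q) (by positivity)
  obtain ⟨bad₂, hbad₂, hw⟩ := hQ₂ Q (le_trans (le_max_right _ _) hQ) α hα c B ζ₁ ζ₂ A H σ hσ.le hσ1
  have hbad₁ := volume_real_ge_le hβ0 hβi (ε := 2 * n * (Q * σ)) (by positivity)
    (M := 2 / σ * Real.exp (-(σ * Q))) (hβI.trans (le_of_eq (by push_cast; field_simp; ring)))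
  refine ⟨toMeasurable volume ({x | 2 * n * (Q * σ) ≤ β x} ∪ bad₂), measurableSet_toMeasurable _ _,
    ?_, ?_⟩
  · rw [measureReal_def, measure_toMeasurable, ← measureReal_def]
    refine (measureReal_union_le _ _).trans ?_
    have : 2 * Real.exp (-(σ * Q)) ≤ 2 / σ * Real.exp (-(σ * Q)) := by
      gcongr
      rw [le_div_iff₀ hσ]; linarith
    have h4 : 4 / σ * Real.exp (-(σ * Q)) = 2 / σ * Real.exp (-(σ * Q)) +
      2 / σ * Real.exp (-(σ * Q)) := by ring
    linarith
  · have hlog : ∀ x, Real.log ‖P.eval (ec x)‖ = 2 * lphi α A n x := fun x => by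
      rw [hP, Real.log_pow]; rfl
    have h_integral : ∫ x, Real.log ‖P.eval (ec x)‖ = 2 * lI α A n := by
      simp_rw [hlog]; rw [integral_const_mul]; rfl
    filter_upwards [hβ, H.ae_reg α] with x hx hreg hbad
    have hbad' := fun h => hbad (subset_toMeasurable _ _ h)
    have hb1 : β x < 2 * n * (Q * σ) := not_le.1 fun h => hbad' (Or.inl h)
    have hb2 : x ∉ bad₂ := fun h => hbad' (Or.inr h)
    rw [h_integral] at hx
    simp_rw [hlog] at hx
    rw [← Finset.mul_sum] at hx
    obtain ⟨a, ha, h1⟩ : ∃ a ∈ Finset.range Q, lI α A n - n * (2 * κ + 3 * σ) ≤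
        lphi α A n (x + a • (α : UnitAddCircle)) := by
      by_contra! hcon
      have h2 := Finset.sum_lt_sum_of_nonempty ⟨0, Finset.mem_range.2 hα.1⟩ hcon
      rw [Finset.sum_const, Finset.card_range, nsmul_eq_mul] at h2
      push_cast at hx
      linarith
    have h2 := hw x hreg hb2 a (Finset.mem_range.1 ha).le
    have h3 := H.lphi_shift hreg n a
    have h4 : 2 * a * Real.log B ≤ 2 * Q * Real.log B := by
      have : (a : ℝ) ≤ Q := by exact_mod_cast (Finset.mem_range.1 ha).le
      have := H.log_B_nonneg
      gcongr
    linarith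

lemma exists_goodDenom {α : ℝ} (hα : Irrational α) (N : ℕ) :
    ∃ Q ≥ N, ∀ α' : ℝ, |α' - α| ≤ 1 / (2 * (Q : ℝ) ^ 3) → GoodDenom α' Q := by
  have hinf := Real.infinite_rat_abs_sub_lt_one_div_den_sq_of_irrational hα
  obtain ⟨q, hq, hqN⟩ : ∃ q : ℚ, |α - q| < 1 / (q.den : ℝ) ^ 2 ∧ N ≤ q.den := by
    by_contra! hcon
    refine hinf ?_
    let M : ℤ := ⌈(N : ℝ) * (|α| + 1)⌉
    refine Set.Finite.of_injOn (f := fun q : ℚ => (q.num, q.den))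
      (t := (Set.Icc (-M) M) ×ˢ (Set.Iic N)) ?_ ?_ (Set.toFinite _)
    · intro q hq
      have h1 := hcon q hq
      have hden : (0 : ℝ) < q.den := by exact_mod_cast q.den_pos
      have hden1 : (1 : ℝ) ≤ q.den := by exact_mod_cast q.den_pos
      have h2 : |(q.num : ℝ)| ≤ M := by
        have h3 : |(q : ℝ)| ≤ |α| + 1 := by
          have h4 : |α - q| < 1 / (q.den : ℝ) ^ 2 := hq
          have h5 : 1 / (q.den : ℝ) ^ 2 ≤ 1 := by
            rw [div_le_one (by positivity)]; exact one_le_pow₀ hden1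
          have h6 := abs_sub_abs_le_abs_sub (q : ℝ) α
          rw [abs_sub_comm] at h6
          linarith
        have h4 : (q : ℝ) = q.num / q.den := by exact_mod_cast (Rat.num_div_den q).symm
        rw [h4, abs_div, abs_of_pos hden, div_le_iff₀ hden] at h3
        have h5 : (q.den : ℝ) ≤ N := by exact_mod_cast h1.le
        refine h3.trans (le_trans ?_ (Int.le_ceil _))
        rw [mul_comm]
        gcongr
      have h3 := abs_le.1 h2
      refine ⟨⟨?_, ?_⟩, h1.le⟩
      · exact_mod_cast h3.1
      · exact_mod_cast h3.2
    · intro q _ r _ h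
      simp only [Prod.mk.injEq] at h
      exact Rat.ext h.1 h.2
  refine ⟨q.den, hqN, fun α' h => ⟨q.den_pos, q.num, ?_, ?_⟩⟩
  · have := q.reduced
    rw [Int.isCoprime_iff_nat_coprime]
    simpa using this
  · have h4 : (q : ℝ) = q.num / q.den := by exact_mod_cast (Rat.num_div_den q).symm
    rw [← h4]
    have := abs_sub_le α' α q
    linarith

lemma abs_log_max_le_of_le_one {u ν : ℝ} (hu : 0 < u) (hν : 0 < ν) (hν1 : ν ≤ 1) :
    |Real.log (max u ν)| ≤ |Real.log u| := by
  rcases le_total ν u with h | h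
  · rw [max_eq_left h]
  · rw [max_eq_right h, abs_of_nonpos (Real.log_nonpos hν.le hν1),
      abs_of_nonpos (Real.log_nonpos hu.le (h.trans hν1))]
    linarith [Real.log_le_log hu h]

lemma exists_integral_log_max_le {f : UnitAddCircle → ℝ} (hm : Measurable f)
    (hpos : ∀ᵐ x, 0 < f x)
    (hf : Integrable fun x => Real.log (f x)) {ε : ℝ} (hε : 0 < ε) :
    ∃ ν : ℝ, 0 < ν ∧ ν ≤ 1 ∧
      ∫ x, Real.log (max (f x) ν) ≤ (∫ x, Real.log (f x)) + ε := by
  have h : Filter.Tendsto (fun n : ℕ => ∫ x, Real.log (max (f x) (1 / ((n : ℝ) + 1))))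
      Filter.atTop (nhds (∫ x, Real.log (f x))) := by
    refine tendsto_integral_of_dominated_convergence (fun x => |Real.log (f x)|) ?_ hf.abs ?_ ?_
    · exact fun n => (Real.measurable_log.comp (hm.max measurable_const)).aestronglyMeasurable
    · intro n
      filter_upwards [hpos] with x hx
      refine abs_log_max_le_of_le_one hx (by positivity) ?_
      rw [div_le_one (by positivity)]
      linarith [Nat.cast_nonneg (α := ℝ) n]
    · filter_upwards [hpos] with x hx
      refine tendsto_const_nhds.congr' ?_
      have := tendsto_one_div_add_atTop_nhds_zero_nat (𝕜 := ℝ)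
      filter_upwards [this.eventually_le_const hx] with n hn
      rw [max_eq_left hn]
  obtain ⟨n, hn⟩ := (h.eventually_le_const
    (show ∫ x, Real.log (f x) < (∫ x, Real.log (f x)) + ε by linarith)).exists
  refine ⟨1 / ((n : ℝ) + 1), by positivity, ?_, hn⟩
  rw [div_le_one (by positivity)]
  linarith [Nat.cast_nonneg (α := ℝ) n]

lemma sum_range_mul (f : ℕ → ℝ) (k Q : ℕ) :
    ∑ n ∈ Finset.range (k * Q), f n =
      ∑ i ∈ Finset.range k, ∑ a ∈ Finset.range Q, f (i * Q + a) := by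
  induction k with
  | zero => simp
  | succ k ih => rw [add_mul, one_mul, Finset.sum_range_add, ih, Finset.sum_range_succ]

lemma sum_orbit_le {ψ : UnitAddCircle → ℝ} {α M : ℝ} {Q : ℕ}
    (h : ∀ x, ∑ a ∈ Finset.range Q, ψ (x + a • (α : UnitAddCircle)) ≤ M) (k : ℕ)
    (x : UnitAddCircle) :
    ∑ n ∈ Finset.range (k * Q), ψ (x + n • (α : UnitAddCircle)) ≤ k * M := by
  rw [sum_range_mul (fun n => ψ (x + n • (α : UnitAddCircle)))]
  refine (Finset.sum_le_card_nsmul _ _ M fun i _ => ?_).trans (by simp)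
  simp_rw [add_smul, ← add_assoc]
  exact h _

namespace IsTrigCocycle

variable {c B : ℝ} {ζ₁ ζ₂ : ℂ} {A A' : UnitAddCircle → Matrix (Fin 2) (Fin 2) ℂ} {α α' : ℝ}

/-- Uniform upper bound for the product of the weights along an orbit. -/
lemma sum_log_wt_le {η : ℝ} (hη : 0 < η) : ∃ Q₀ : ℕ, ∀ Q ≥ Q₀, ∀ α : ℝ, GoodDenom α Q →
    ∀ (c B : ℝ) (ζ₁ ζ₂ : ℂ) (A : UnitAddCircle → Matrix (Fin 2) (Fin 2) ℂ),
    IsTrigCocycle c B ζ₁ ζ₂ A → ∀ (k : ℕ) (x : UnitAddCircle),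
    ∏ j ∈ Finset.range (k * Q), wt c ζ₁ ζ₂ (x + j • (α : UnitAddCircle)) ≤
      Real.exp ((k * Q : ℕ) * (Real.log c + η)) := by
  set ν : ℝ := η / 4 with hνdef
  have hν : 0 < ν := by positivity
  obtain ⟨Q₀, hQ₀⟩ := exists_nat_ge (8 * (ν⁻¹ * (2 * Real.pi)) / η)
  refine ⟨Q₀, fun Q hQ α hα c B ζ₁ ζ₂ A H k x => ?_⟩
  have hp1 : Real.posLog 1 = 0 := by simp [Real.posLog]
  have hQr : 8 * (ν⁻¹ * (2 * Real.pi)) ≤ Q * η := by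
    rw [← div_le_iff₀ hη]
    exact hQ₀.trans (by exact_mod_cast hQ)
  have hblock : ∀ x, ∑ a ∈ Finset.range Q,
      (fun y => Real.log c + Real.log (max ‖ec y - ζ₁‖ ν) + Real.log (max ‖ec y - ζ₂‖ ν))
        (x + a • (α : UnitAddCircle)) ≤ Q * (Real.log c + η) := by
    intro x
    have h1 := (abs_le.1 (riemann_log_max_ec ζ₁ hν hα x)).2
    have h2 := (abs_le.1 (riemann_log_max_ec ζ₂ hν hα x)).2
    have h3 := integral_log_max_ec_le ζ₁ ν hν
    have h4 := integral_log_max_ec_le ζ₂ ν hν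
    rw [H.norm_one, hp1] at h3
    rw [H.norm_two, hp1] at h4
    simp only [Finset.sum_add_distrib, Finset.sum_const, Finset.card_range, nsmul_eq_mul]
    have h5 : (Q : ℝ) * ∫ y : UnitAddCircle, Real.log (max ‖ec y - ζ₁‖ ν) ≤ Q * (0 + ν) := by gcongr
    have h6 : (Q : ℝ) * ∫ y : UnitAddCircle, Real.log (max ‖ec y - ζ₂‖ ν) ≤ Q * (0 + ν) := by gcongr
    have h7 : (Q : ℝ) * ν = Q * η / 4 := by rw [hνdef]; ring
    linarith
  have hsum := sum_orbit_le (ψ := fun y => Real.log c + Real.log (max ‖ec y - ζ₁‖ ν) +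
    Real.log (max ‖ec y - ζ₂‖ ν)) hblock k x
  by_cases h0 : ∀ j ∈ Finset.range (k * Q), 0 < wt c ζ₁ ζ₂ (x + j • (α : UnitAddCircle))
  · have h1 := Finset.prod_pos h0
    rw [← Real.log_le_iff_le_exp h1, Real.log_prod fun j hj => (h0 j hj).ne']
    refine le_trans (Finset.sum_le_sum fun j hj => ?_) (hsum.trans (le_of_eq (by push_cast; ring)))
    have h2 := (h0 j hj).ne'
    unfold wt at h2 ⊢
    have h6 := right_ne_zero_of_mul h2
    have h7 := left_ne_zero_of_mul h2
    have h8 := right_ne_zero_of_mul h7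
    rw [Real.log_mul h7 h6, Real.log_mul (left_ne_zero_of_mul h7) h8]
    have h9 : ∀ u : ℝ, 0 ≤ u → u ≠ 0 → Real.log u ≤ Real.log (max u ν) := fun u hu0 hu =>
      Real.log_le_log (lt_of_le_of_ne hu0 hu.symm) (le_max_left _ _)
    have h10 := h9 _ (norm_nonneg _) h8
    have h11 := h9 _ (norm_nonneg _) h6
    linarith
  · push Not at h0
    obtain ⟨j, hj, h1⟩ := h0
    rw [Finset.prod_eq_zero hj (le_antisymm h1 (H.wt_nonneg _))]
    positivity

/-- Uniform upper bound for the iterates, stable under perturbation of the cocycle. -/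
lemma norm_ct_le_exp (H : IsTrigCocycle c B ζ₁ ζ₂ A) {L : ℝ}
    (hL : Filter.Tendsto (fun n : ℕ => lI α A n / n) Filter.atTop (nhds L)) {η : ℝ} (hη : 0 < η) :
    ∃ δ > 0, ∃ Q₀ : ℕ, ∀ Q ≥ Q₀, ∀ (α' : ℝ) (A' : UnitAddCircle → Matrix (Fin 2) (Fin 2) ℂ),
      IsTrigCocycle c B ζ₁ ζ₂ A' → GoodDenom α' Q → |α' - α| ≤ δ → (∀ x, ‖A' x - A x‖ ≤ δ) →
      ∀ k : ℕ, 1 ≤ k → ∀ x, ‖ct α' A' (k * Q) x‖ ≤ Real.exp ((k * Q : ℕ) * (L + η)) := by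
  obtain ⟨m, hm1, hmL⟩ : ∃ m : ℕ, 0 < m ∧ lI α A m ≤ m * (L + η / 8) := by
    have h := (hL.eventually_le_const (show L < L + η / 8 by linarith)).and
      (Filter.eventually_gt_atTop 0)
    obtain ⟨m, h1, h2⟩ := h.exists
    have h3 : (0 : ℝ) < m := by exact_mod_cast h2
    rw [div_le_iff₀ h3] at h1
    exact ⟨m, h2, by linarith⟩
  have hm : (0 : ℝ) < m := by exact_mod_cast hm1
  obtain ⟨ν, hν, hν1, hνI⟩ := exists_integral_log_max_le (H.continuous_ct α m).measurable
    ((H.ae_reg α).mono fun x hx => H.norm_ct_pos hx m) (H.integrable_lphi α m)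
    (show 0 < m * (η / 8) by positivity)
  change _ ≤ lI α A m + _ at hνI
  obtain ⟨K, hK, hKl⟩ := H.lip_ct (α := α) m
  set ψ : UnitAddCircle → ℝ := fun x => Real.log (max ‖ct α A m x‖ ν) with hψ
  have hψl : ∀ x y, |ψ x - ψ y| ≤ (ν⁻¹ * K) * ‖x - y‖ := fun x y => by
    refine (abs_log_max_sub_le hν).trans ?_
    rw [mul_assoc]
    gcongr
    exact (abs_norm_sub_norm_le _ _).trans (hKl x y)
  have hψi : Integrable ψ := integrable_log_max (H.continuous_ct α m).measurable
    (H.integrable_lphi α m) ν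
  have hB := H.B_pos
  set C : ℝ := 12 * m ^ 2 * B ^ (m + 1) with hC
  have hCpos : 0 < C := by positivity
  set δ : ℝ := ν * (m * (η / 8)) / C with hδ
  have hδpos : 0 < δ := by positivity
  set R : ℝ := m * |Real.log ν| + 2 * (m * (m * Real.log B + 1)) with hR
  obtain ⟨Q₀, hQ₀⟩ := exists_nat_ge (max (m : ℝ) (max (2 * (ν⁻¹ * K) / (m * (η / 8)))
    (R / (m * (η / 4)))))
  refine ⟨δ, hδpos, Q₀, fun Q hQ α' A' H' hgood hα hA k hk x => ?_⟩
  have hQQ : (Q₀ : ℝ) ≤ Q := by exact_mod_cast hQ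
  have hQm : (m : ℝ) ≤ Q := (le_max_left _ _).trans (hQ₀.trans hQQ)
  have hQK : 2 * (ν⁻¹ * K) ≤ Q * (m * (η / 8)) := by
    rw [← div_le_iff₀ (by positivity)]
    exact (le_max_left _ _).trans ((le_max_right _ _).trans (hQ₀.trans hQQ))
  have hQR : R ≤ Q * (m * (η / 4)) := by
    rw [← div_le_iff₀ (by positivity)]
    exact (le_max_right _ _).trans ((le_max_right _ _).trans (hQ₀.trans hQQ))
  have hblock : ∀ x, ∑ a ∈ Finset.range Q, ψ (x + a • (α' : UnitAddCircle)) ≤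
      Q * (m * (L + 3 * η / 8)) := fun x => by
    have h1 := (abs_le.1 (riemann_sum (by positivity) hψl hψi hgood x)).2
    have h2 : (Q : ℝ) * ∫ y, ψ y ≤ Q * (m * (L + η / 8) + m * (η / 8)) := by
      gcongr; linarith
    linarith
  have hsum := sum_orbit_le hblock k x
  set N := k * Q with hN
  have hQN : Q ≤ N := Nat.le_mul_of_pos_left _ hk
  have hmN : m ≤ N := le_trans (by exact_mod_cast hQm) hQN
  have hclose : ∀ y, Real.log (max ‖ct α' A' m y‖ ν) ≤ ψ y + m * (η / 8) := fun y => by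
    have h1 := (abs_le.1 (abs_log_max_sub_le (u := ‖ct α' A' m y‖) (v := ‖ct α A m y‖) hν)).2
    have h2 := (abs_norm_sub_norm_le (ct α' A' m y) (ct α A m y)).trans
      (H.ct_sub_le H' hα hA m y)
    have h3 : ν⁻¹ * |‖ct α' A' m y‖ - ‖ct α A m y‖| ≤ ν⁻¹ * (C * δ) := by gcongr
    have h4 : ν⁻¹ * (C * δ) = m * (η / 8) := by rw [hδ]; field_simp
    linarith
  rcases (norm_nonneg (ct α' A' N x)).eq_or_lt with h0 | h0
  · rw [← h0]; positivity
  rw [← Real.log_le_iff_le_exp h0]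
  have hpos : ∀ n ≤ N, 0 < ‖ct α' A' n x‖ := by
    intro n hn
    have h1 := h0
    rw [← Nat.sub_add_cancel hn, ct_add] at h1
    exact pos_of_mul_pos_right (h1.trans_le (frob_mul_le _ _)) (norm_nonneg _)
  have hsub : ∀ d n, d + n ≤ N → ∀ v > 0, ‖ct α' A' d (x + n • (α' : UnitAddCircle))‖ ≤ v →
      lphi α' A' (d + n) x ≤ Real.log v + lphi α' A' n x := by
    intro d n hdn v hv hle
    unfold lphi
    rw [← Real.log_mul hv.ne' (hpos n (by omega)).ne']
    refine Real.log_le_log (hpos _ hdn) ?_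
    rw [ct_add]
    exact (frob_mul_le _ _).trans (by gcongr)
  have hstep : ∀ n ∈ Finset.range (N - m), lphi α' A' (m + n) x - lphi α' A' n x ≤
      ψ (x + n • (α' : UnitAddCircle)) + m * (η / 8) := by
    intro n hn
    have := hsub m n (by have := Finset.mem_range.1 hn; omega)
      (max ‖ct α' A' m (x + n • (α' : UnitAddCircle))‖ ν) (lt_max_of_lt_right hν) (le_max_left _ _)
    have := hclose (x + n • (α' : UnitAddCircle))
    linarith
  have hs1 := Finset.sum_le_sum hstep
  rw [Finset.sum_sub_distrib, Finset.sum_add_distrib, Finset.sum_const, Finset.card_range,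
    nsmul_eq_mul] at hs1
  have htel : ∑ n ∈ Finset.range (N - m), lphi α' A' (m + n) x - ∑ n ∈ Finset.range (N - m),
      lphi α' A' n x = ∑ n ∈ Finset.range m, lphi α' A' (N - m + n) x -
      ∑ n ∈ Finset.range m, lphi α' A' n x := by
    have h1 := Finset.sum_range_add (fun n => lphi α' A' n x) m (N - m)
    have h2 := Finset.sum_range_add (fun n => lphi α' A' n x) (N - m) m
    rw [add_comm m (N - m)] at h1
    linarith
  rw [htel] at hs1
  have hlow : ∑ n ∈ Finset.range m, (lphi α' A' N x - (m * Real.log B + 1)) ≤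
      ∑ n ∈ Finset.range m, lphi α' A' (N - m + n) x := by
    refine Finset.sum_le_sum fun n hn => ?_
    have hn' := Finset.mem_range.1 hn
    have h1 := hsub (m - n) (N - m + n) (by omega) (2 * B ^ (m - n)) (by positivity)
      (H'.norm_ct_le _ _)
    rw [show m - n + (N - m + n) = N by omega, Real.log_mul (by norm_num) (by positivity),
      Real.log_pow] at h1
    have h2 : ((m - n : ℕ) : ℝ) * Real.log B ≤ m * Real.log B := by
      have := H.log_B_nonneg
      gcongr
      exact Nat.sub_le _ _
    have := Real.log_two_lt_d9
    linarith
  have hup : ∑ n ∈ Finset.range m, lphi α' A' n x ≤ ∑ n ∈ Finset.range m, (m * Real.log B + 1) := by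
    refine Finset.sum_le_sum fun n hn => ?_
    have h1 := H'.lphi_le α' n x
    have h2 : (n : ℝ) * Real.log B ≤ m * Real.log B := by
      have := H.log_B_nonneg
      have := (Finset.mem_range.1 hn).le
      gcongr
    linarith
  rw [Finset.sum_const, Finset.card_range, nsmul_eq_mul] at hlow hup
  have hψsum : ∑ n ∈ Finset.range (N - m), ψ (x + n • (α' : UnitAddCircle)) ≤
      k * (Q * (m * (L + 3 * η / 8))) + m * |Real.log ν| := by
    have h1 := Finset.sum_range_add (fun n => ψ (x + n • (α' : UnitAddCircle))) (N - m) m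
    rw [Nat.sub_add_cancel hmN] at h1
    have h2 : ∑ n ∈ Finset.range m, -|Real.log ν| ≤
        ∑ n ∈ Finset.range m, ψ (x + (N - m + n) • (α' : UnitAddCircle)) :=
      Finset.sum_le_sum fun n _ =>
        (neg_abs_le _).trans (Real.log_le_log hν (le_max_right _ _))
    rw [Finset.sum_const, Finset.card_range, nsmul_eq_mul] at h2
    linarith
  have hNr : (N : ℝ) = k * Q := by rw [hN]; push_cast; ring
  have hNm : ((N - m : ℕ) : ℝ) * (m * (η / 8)) ≤ N * (m * (η / 8)) := by
    gcongr; exact Nat.sub_le _ _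
  have hRN : R ≤ N * (m * (η / 4)) := by
    have : (Q : ℝ) ≤ N := by exact_mod_cast hQN
    exact hQR.trans (by gcongr)
  have hfin : m * lphi α' A' N x ≤ m * (N * (L + η)) := by
    have h1 : k * (Q * (m * (L + 3 * η / 8))) = (N : ℝ) * (m * (L + 3 * η / 8)) := by
      rw [hNr]; ring
    rw [h1] at hψsum
    have h2 : 0 ≤ (N : ℝ) * (m * (η / 4)) := by positivity
    have hlow' : m * lphi α' A' N x - m * (m * Real.log B + 1) ≤
      ∑ n ∈ Finset.range m, lphi α' A' (N - m + n) x := by linarith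
    clear_value R
    linarith
  exact le_of_mul_le_mul_left hfin hm

end IsTrigCocycle

lemma frob_le_two_mul_entry (A : Matrix (Fin 2) (Fin 2) ℂ) : ∃ i j, ‖A‖ ≤ 2 * ‖A i j‖ := by
  obtain ⟨⟨i, j⟩, -, h⟩ := Finset.exists_max_image (Finset.univ : Finset (Fin 2 × Fin 2))
    (fun p => ‖A p.1 p.2‖) ⟨(0, 0), Finset.mem_univ _⟩
  refine ⟨i, j, ?_⟩
  have h' : ∀ a b, ‖A a b‖ ^ 2 ≤ ‖A i j‖ ^ 2 := fun a b =>
    pow_le_pow_left₀ (norm_nonneg _) (h (a, b) (Finset.mem_univ _)) 2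
  refine le_of_sq_le_sq ?_ (by positivity)
  rw [frob_sq]
  linarith [h' 0 0, h' 0 1, h' 1 0, h' 1 1]

/-- Quantitative form of the fact that, for a matrix `Y` close to rank one, norms of triple products
nearly factorize. -/
lemma frob_triple (X Y Z : Matrix (Fin 2) (Fin 2) ℂ) :
    ‖X * Y‖ * ‖Y * Z‖ ≤ 4 * (‖X * Y * Z‖ * ‖Y‖ + ‖Y.det‖ * (‖X‖ * ‖Z‖)) := by
  obtain ⟨k, l, h1⟩ := frob_le_two_mul_entry (X * Y)
  obtain ⟨i, j, h2⟩ := frob_le_two_mul_entry (Y * Z)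
  have key : ∃ a b : Fin 2, ‖(X * Y) k l * (Y * Z) i j‖ ≤
      ‖(X * Y * Z) k j * Y i l‖ + ‖Y.det * (X k a * Z b j)‖ := by
    fin_cases i <;> fin_cases l
    · refine ⟨1, 1, le_trans (le_of_eq (congrArg _ ?_)) (norm_sub_le _ _)⟩
      simp [Matrix.mul_apply, Fin.sum_univ_two, Matrix.det_fin_two]; ring
    · refine ⟨1, 0, le_trans (le_of_eq (congrArg _ ?_)) (norm_add_le _ _)⟩
      simp [Matrix.mul_apply, Fin.sum_univ_two, Matrix.det_fin_two]; ring
    · refine ⟨0, 1, le_trans (le_of_eq (congrArg _ ?_)) (norm_add_le _ _)⟩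
      simp [Matrix.mul_apply, Fin.sum_univ_two, Matrix.det_fin_two]; ring
    · refine ⟨0, 0, le_trans (le_of_eq (congrArg _ ?_)) (norm_sub_le _ _)⟩
      simp [Matrix.mul_apply, Fin.sum_univ_two, Matrix.det_fin_two]; ring
  obtain ⟨a, b, h3⟩ := key
  simp only [norm_mul] at h3
  have h4 : ‖X * Y‖ * ‖Y * Z‖ ≤ (2 * ‖(X * Y) k l‖) * (2 * ‖(Y * Z) i j‖) := by gcongr
  have h5 : ‖(X * Y * Z) k j‖ * ‖Y i l‖ ≤ ‖X * Y * Z‖ * ‖Y‖ := by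
    gcongr <;> exact frob_entry_le _ _ _
  have h6 : ‖Y.det‖ * (‖X k a‖ * ‖Z b j‖) ≤ ‖Y.det‖ * (‖X‖ * ‖Z‖) := by
    gcongr <;> exact frob_entry_le _ _ _
  linarith

lemma setIntegral_compare {F G R : UnitAddCircle → ℝ} (hF : Integrable F) (hG : Integrable G)
    (hR : Integrable R) {E : Set UnitAddCircle} (hE : MeasurableSet E) {a : ℝ} (ha : 0 ≤ a)
    (h1 : ∀ᵐ x, x ∉ E → G x - a ≤ F x) (h2 : ∀ᵐ x, G x - R x ≤ F x) :
    (∫ x, G x) - a - ∫ x in E, R x ≤ ∫ x, F x := by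
  have hi : Integrable (E.indicator R) := hR.indicator hE
  have h3 : Integrable fun x => G x - a := hG.sub (integrable_const a)
  have h4 : ∫ x, (G x - a) - E.indicator R x ≤ ∫ x, F x := by
    refine integral_mono_ae (h3.sub hi) hF ?_
    filter_upwards [h1, h2] with x hx1 hx2
    by_cases hx : x ∈ E
    · simp only [Set.indicator_of_mem hx]; linarith
    · simp only [Set.indicator_of_notMem hx]; linarith [hx1 hx]
  rw [integral_sub h3 hi, integral_sub hG (integrable_const a), integral_indicator hE] at h4
  simpa using h4

namespace IsTrigCocycle

variable {c B : ℝ} {ζ₁ ζ₂ : ℂ} {A A' : UnitAddCircle → Matrix (Fin 2) (Fin 2) ℂ} {α α' : ℝ}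

lemma exists_tail (H : IsTrigCocycle c B ζ₁ ζ₂ A) {ε : ℝ} (hε : 0 < ε) : ∃ T : ℝ, 0 ≤ T ∧
    ∀ E : Set UnitAddCircle, MeasurableSet E → ∀ y : UnitAddCircle,
    ∫ x in E, |Real.log (wt c ζ₁ ζ₂ (x + y))| ≤ T * volume.real E + ε := by
  set g : UnitAddCircle → ℝ := fun x => |Real.log (wt c ζ₁ ζ₂ x)| with hg
  have hgi : Integrable g := H.integrable_log_wt.abs
  have hlim : Filter.Tendsto (fun n : ℕ => ∫ x, max (g x - n) 0) Filter.atTop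
      (nhds (∫ x : UnitAddCircle, (0 : ℝ))) := by
    refine tendsto_integral_of_dominated_convergence g ?_ hgi ?_ ?_
    · exact fun n => ((hgi.sub (integrable_const _)).sup (integrable_const 0)).aestronglyMeasurable
    · refine fun n => Filter.Eventually.of_forall fun x => ?_
      have h0 : 0 ≤ g x := abs_nonneg _
      rw [Real.norm_of_nonneg (le_max_right _ _)]
      exact max_le (by linarith [(Nat.cast_nonneg n : (0 : ℝ) ≤ n)]) h0
    · refine Filter.Eventually.of_forall fun x => ?_
      obtain ⟨m, hm⟩ := exists_nat_ge (g x)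
      refine tendsto_const_nhds.congr' ?_
      filter_upwards [Filter.eventually_ge_atTop m] with n hn
      have : (m : ℝ) ≤ n := by exact_mod_cast hn
      rw [max_eq_right (by linarith)]
  simp only [integral_zero] at hlim
  obtain ⟨n, hn⟩ := (hlim.eventually_le_const hε).exists
  refine ⟨n, Nat.cast_nonneg n, fun E hE y => ?_⟩
  have hti : Integrable fun x => max (g x - n) 0 :=
    (hgi.sub (integrable_const _)).sup (integrable_const 0)
  have hty : Integrable fun x => max (g (x + y) - n) 0 := hti.comp_add_right y
  have h1 : ∫ x in E, g (x + y) ≤ ∫ x in E, ((n : ℝ) + max (g (x + y) - n) 0) := by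
    refine integral_mono (hgi.comp_add_right y).integrableOn
      ((integrable_const _).add hty).integrableOn fun x => ?_
    simp only
    linarith [le_max_left (g (x + y) - n) 0]
  have h2 : ∫ x in E, max (g (x + y) - n) 0 ≤ ∫ x, max (g (x + y) - n) 0 :=
    setIntegral_le_integral hty (Filter.Eventually.of_forall fun x => le_max_right _ _)
  have h3 : ∫ x, max (g (x + y) - n) 0 = ∫ x, max (g x - n) 0 :=
    integral_add_right_eq_self (μ := volume) (fun x => max (g x - n) 0) y
  rw [integral_add (integrable_const _).integrableOn hty.integrableOn, setIntegral_const,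
    smul_eq_mul] at h1
  change ∫ x in E, g (x + y) ≤ _
  linarith

lemma exists_tail_sum (H : IsTrigCocycle c B ζ₁ ζ₂ A) {ε : ℝ} (hε : 0 < ε) : ∃ T : ℝ, 0 ≤ T ∧
    ∀ E : Set UnitAddCircle, MeasurableSet E → ∀ (α : ℝ) (n : ℕ),
    ∫ x in E, ∑ j ∈ Finset.range n, |Real.log (wt c ζ₁ ζ₂ (x + j • (α : UnitAddCircle)))| ≤
      n * (T * volume.real E + ε) := by
  obtain ⟨T, hT, h⟩ := H.exists_tail hε
  refine ⟨T, hT, fun E hE α n => ?_⟩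
  rw [integral_finsetSum _ fun j _ =>
    ((H.integrable_log_wt.comp_add_right (j • (α : UnitAddCircle))).abs).integrableOn]
  refine (Finset.sum_le_card_nsmul _ _ (T * volume.real E + ε) fun j _ => h E hE _).trans ?_
  rw [Finset.card_range, nsmul_eq_mul]

/-- Pointwise avalanche principle along an orbit. -/
lemma lphi_avalanche (H : IsTrigCocycle c B ζ₁ ζ₂ A) {x : UnitAddCircle} (hx : Reg α c ζ₁ ζ₂ x)
    {N k : ℕ} {u v d : ℝ} (hu : 0 < u) (hv : 0 < v)
    (hN : ∀ x, ‖ct α A N x‖ ≤ v) (hd : ∀ x, ‖(ct α A N x).det‖ ≤ d) (huv : 64 * d * v ^ 2 ≤ u ^ 2)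
    (hpair : ∀ j < k, u ≤ ‖ct α A (2 * N) (x + (j * N) • (α : UnitAddCircle))‖) :
    lphi α A N x + ∑ j ∈ Finset.range k, (lphi α A (2 * N) (x + (j * N) • (α : UnitAddCircle)) -
      lphi α A N (x + (j * N) • (α : UnitAddCircle))) - k * Real.log 8 ≤
      lphi α A ((k + 1) * N) x := by
  have hdpos : 0 ≤ d := (norm_nonneg _).trans (hd x)
  have main : ∀ j < k, ‖ct α A (2 * N) (x + (j * N) • (α : UnitAddCircle))‖ *
      ‖ct α A ((j + 1) * N) x‖ ≤ 8 * (‖ct α A ((j + 2) * N) x‖ *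
      ‖ct α A N (x + (j * N) • (α : UnitAddCircle))‖) := by
    intro j
    induction j with
    | zero =>
      intro _
      have := H.norm_ct_pos hx (2 * N)
      have := H.norm_ct_pos hx N
      simp only [zero_mul, zero_smul, add_zero, zero_add, one_mul]
      have : 0 < ‖ct α A (2 * N) x‖ * ‖ct α A N x‖ := by positivity
      linarith
    | succ j ih =>
      intro hj
      have h1 := ih (by omega)
      set y := x + ((j + 1) * N) • (α : UnitAddCircle) with hy
      have h2 := hpair (j + 1) hj
      have hY : ct α A (2 * N) y = ct α A N (y + N • (α : UnitAddCircle)) * ct α A N y := by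
        rw [two_mul, ct_add]
      have hZ : ct α A ((j + 2) * N) x = ct α A N y * ct α A ((j + 1) * N) x := by
        rw [show (j + 2) * N = N + (j + 1) * N by ring, ct_add]
      have hW : ct α A ((j + 1 + 2) * N) x =
          ct α A N (y + N • (α : UnitAddCircle)) * ct α A N y * ct α A ((j + 1) * N) x := by
        rw [show (j + 1 + 2) * N = 2 * N + (j + 1) * N by ring, ct_add, ← hY]
      have h3 := frob_triple (ct α A N (y + N • (α : UnitAddCircle))) (ct α A N y)
        (ct α A ((j + 1) * N) x)
      rw [← hW, ← hY, ← hZ] at h3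
      rw [show j + 1 + 1 = j + 2 by ring]
      set p2 := ‖ct α A ((j + 2) * N) x‖
      set p1 := ‖ct α A ((j + 1) * N) x‖
      set p3 := ‖ct α A ((j + 1 + 2) * N) x‖
      set s := ‖ct α A (2 * N) y‖
      have h4 : u * p1 ≤ 8 * (p2 * v) :=
        (mul_le_mul_of_nonneg_right (hpair j (by omega)) (norm_nonneg _)).trans (h1.trans (by
          gcongr; exact hN _))
      have h5 : ‖(ct α A N y).det‖ * (‖ct α A N (y + N • (α : UnitAddCircle))‖ * p1) ≤
          d * (v * p1) := by
        gcongr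
        · exact hd _
        · exact hN _
      have h6 : 8 * (d * (v * p1)) ≤ s * p2 := by
        have h7 : u * (8 * (d * (v * p1))) ≤ u * (s * p2) := by
          calc u * (8 * (d * (v * p1))) = 8 * d * v * (u * p1) := by ring
            _ ≤ 8 * d * v * (8 * (p2 * v)) := by gcongr
            _ = 64 * d * v ^ 2 * p2 := by ring
            _ ≤ u ^ 2 * p2 := by gcongr
            _ = u * (u * p2) := by ring
            _ ≤ u * (s * p2) := by gcongr
        exact le_of_mul_le_mul_left h7 hu
      linarith
  have hlog : ∀ j ∈ Finset.range k, lphi α A (2 * N) (x + (j * N) • (α : UnitAddCircle)) -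
      lphi α A N (x + (j * N) • (α : UnitAddCircle)) - Real.log 8 ≤
      lphi α A ((j + 1 + 1) * N) x - lphi α A ((j + 1) * N) x := by
    intro j hj
    have h1 := main j (Finset.mem_range.1 hj)
    have p1 := H.norm_ct_pos (hx.shift (j * N)) (2 * N)
    have p2 := H.norm_ct_pos (hx.shift (j * N)) N
    have p3 := H.norm_ct_pos hx ((j + 1) * N)
    have p4 := H.norm_ct_pos hx ((j + 2) * N)
    have h2 := Real.log_le_log (by positivity) h1
    rw [Real.log_mul p1.ne' p3.ne', Real.log_mul (by norm_num) (by positivity),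
      Real.log_mul p4.ne' p2.ne'] at h2
    unfold lphi
    rw [show j + 1 + 1 = j + 2 by ring]
    linarith
  have hs := Finset.sum_le_sum hlog
  rw [Finset.sum_range_sub (fun j => lphi α A ((j + 1) * N) x), Finset.sum_sub_distrib,
    Finset.sum_const, Finset.card_range, nsmul_eq_mul, zero_add, one_mul] at hs
  linarith

/-- Integrated avalanche principle. -/
lemma lI_avalanche (H : IsTrigCocycle c B ζ₁ ζ₂ A) {T ε : ℝ} (hT0 : 0 ≤ T)
    (hT : ∀ E : Set UnitAddCircle, MeasurableSet E → ∀ (α : ℝ) (n : ℕ),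
      ∫ x in E, ∑ j ∈ Finset.range n, |Real.log (wt c ζ₁ ζ₂ (x + j • (α : UnitAddCircle)))| ≤
      n * (T * volume.real E + ε))
    {N k : ℕ} {u v d : ℝ} (hu : 0 < u) (hv : 0 < v)
    (hN : ∀ x, ‖ct α A N x‖ ≤ v) (hd : ∀ x, ‖(ct α A N x).det‖ ≤ d) (huv : 64 * d * v ^ 2 ≤ u ^ 2)
    {bad : Set UnitAddCircle} (hbad : MeasurableSet bad)
    (hpair : ∀ᵐ x, x ∉ bad → u ≤ ‖ct α A (2 * N) x‖) :
    (k + 1) * (lI α A (2 * N) - lI α A N) - (k + 1) * Real.log 8 -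
      2 * (k + 1) * (N * (T * (k * volume.real bad) + ε) +
        (N * Real.log B + 1) * (k * volume.real bad)) ≤ lI α A ((k + 1) * N) := by
  set s : ℕ → UnitAddCircle := fun j => (j * N) • (α : UnitAddCircle) with hs
  set E : Set UnitAddCircle := ⋃ j ∈ Finset.range k, (fun x => x + s j) ⁻¹' bad with hEdef
  have hE : MeasurableSet E := Finset.measurableSet_biUnion _ fun j _ =>
    (measurable_add_const (s j)) hbad
  have hvol : volume.real E ≤ k * volume.real bad := by
    refine (measureReal_biUnion_finset_le _ _).trans (le_of_eq ?_)
    have : ∀ j ∈ Finset.range k, volume.real ((fun x => x + s j) ⁻¹' bad) = volume.real bad :=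
      fun j _ => by
        rw [measureReal_def, measureReal_def, measure_preimage_add_right]
    rw [Finset.sum_congr rfl this, Finset.sum_const, Finset.card_range, nsmul_eq_mul]
  set G : UnitAddCircle → ℝ := fun x => lphi α A N x +
    ∑ j ∈ Finset.range k, (lphi α A (2 * N) (x + s j) - lphi α A N (x + s j)) with hG
  have hGi1 : ∀ j ∈ Finset.range k, Integrable fun x =>
      lphi α A (2 * N) (x + s j) - lphi α A N (x + s j) := fun j _ =>
    ((H.integrable_lphi α (2 * N)).comp_add_right (s j)).sub
      ((H.integrable_lphi α N).comp_add_right (s j))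
  have hGi : Integrable G := (H.integrable_lphi α N).add (integrable_finsetSum _ hGi1)
  have hGint : ∫ x, G x = lI α A N + k * (lI α A (2 * N) - lI α A N) := by
    rw [hG, integral_add (H.integrable_lphi α N) (integrable_finsetSum _ hGi1),
      integral_finsetSum _ hGi1]
    have : ∀ j ∈ Finset.range k, ∫ x, (lphi α A (2 * N) (x + s j) - lphi α A N (x + s j)) =
        lI α A (2 * N) - lI α A N := fun j _ => by
      rw [integral_sub ((H.integrable_lphi α (2 * N)).comp_add_right (s j))
        ((H.integrable_lphi α N).comp_add_right (s j)),
        integral_add_right_eq_self (lphi α A (2 * N)), integral_add_right_eq_self (lphi α A N)]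
      rfl
    rw [Finset.sum_congr rfl this, Finset.sum_const, Finset.card_range, nsmul_eq_mul]
    rfl
  set S : UnitAddCircle → ℝ := fun x => ∑ j ∈ Finset.range ((k + 1) * N),
    |Real.log (wt c ζ₁ ζ₂ (x + j • (α : UnitAddCircle)))| with hS
  have hSi : Integrable S := integrable_finsetSum _ fun j _ =>
    (H.integrable_log_wt.comp_add_right (j • (α : UnitAddCircle))).abs
  set b : ℝ := 2 * ((k + 1) * (N * Real.log B + 1)) with hb
  have hNB : 0 ≤ N * Real.log B := mul_nonneg (Nat.cast_nonneg _) H.log_B_nonneg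
  have hRi : Integrable fun x => 2 * S x + b := (hSi.const_mul 2).add (integrable_const b)
  have hcomp := setIntegral_compare (F := lphi α A ((k + 1) * N)) (G := G)
    (R := fun x => 2 * S x + b) (H.integrable_lphi α _) hGi hRi hE (a := k * Real.log 8)
    (mul_nonneg (Nat.cast_nonneg _) (Real.log_nonneg (by norm_num))) ?_ ?_
  · have h1 : ∫ x in E, (2 * S x + b) = 2 * (∫ x in E, S x) + volume.real E * b := by
      rw [integral_add (hSi.const_mul 2).integrableOn (integrable_const b).integrableOn,
        integral_const_mul, setIntegral_const, smul_eq_mul]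
    have h2 : ∫ x in E, S x ≤ ((k + 1) * N) * (T * (k * volume.real bad) + ε) := by
      refine (hT E hE α ((k + 1) * N)).trans ?_
      push_cast
      gcongr
    have h3 : volume.real E * b ≤ (k * volume.real bad) * b := by
      gcongr
    have h4 := H.lI_add_le α N N
    rw [← two_mul] at h4
    change _ ≤ lI α A ((k + 1) * N) at hcomp
    rw [hGint, h1] at hcomp
    have h5 : 0 ≤ Real.log 8 := Real.log_nonneg (by norm_num)
    have h6 : (k * volume.real bad) * b =
      2 * (k + 1) * ((N * Real.log B + 1) * (k * volume.real bad)) := by rw [hb]; ring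
    clear_value b
    linarith
  · have hall : ∀ᵐ x, ∀ j : ℕ, x + s j ∉ bad → u ≤ ‖ct α A (2 * N) (x + s j)‖ := by
      rw [ae_all_iff]
      exact fun j => ae_shift hpair (s j)
    filter_upwards [hall, H.ae_reg α] with x hx hreg hxE
    have hnot : ∀ j < k, x + s j ∉ bad := fun j hj h =>
      hxE (Set.mem_biUnion (Finset.mem_coe.2 (Finset.mem_range.2 hj)) h)
    exact H.lphi_avalanche hreg hu hv hN hd huv fun j hj => hx j (hnot j hj)
  · filter_upwards [H.ae_reg α] with x hreg
    have h1 : -S x ≤ lphi α A ((k + 1) * N) x := by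
      refine le_trans ?_ (H.lphi_ge hreg _)
      rw [hS, ← Finset.sum_neg_distrib]
      exact Finset.sum_le_sum fun j _ => neg_abs_le _
    have h2 : G x ≤ (N * Real.log B + 1) + ∑ j ∈ Finset.range k,
        ((2 * N * Real.log B + 1) + ∑ i ∈ Finset.range N,
          |Real.log (wt c ζ₁ ζ₂ (x + (j * N + i) • (α : UnitAddCircle)))|) := by
      refine add_le_add (H.lphi_le α N x) (Finset.sum_le_sum fun j _ => ?_)
      have h3 := H.lphi_le α (2 * N) (x + s j)
      have h4 := H.lphi_ge (hreg.shift (j * N)) N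
      have h5 : -∑ i ∈ Finset.range N,
          |Real.log (wt c ζ₁ ζ₂ (x + (j * N + i) • (α : UnitAddCircle)))| ≤
          lphi α A N (x + s j) := by
        refine le_trans ?_ h4
        rw [← Finset.sum_neg_distrib]
        refine Finset.sum_le_sum fun i _ => ?_
        rw [add_assoc, ← add_smul]
        exact neg_abs_le _
      push_cast at h3
      linarith
    have h3 : ∑ j ∈ Finset.range k, ∑ i ∈ Finset.range N,
        |Real.log (wt c ζ₁ ζ₂ (x + (j * N + i) • (α : UnitAddCircle)))| ≤ S x := by
      rw [← sum_range_mul (fun n => |Real.log (wt c ζ₁ ζ₂ (x + n • (α : UnitAddCircle)))|)]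
      refine Finset.sum_le_sum_of_subset_of_nonneg ?_ fun _ _ _ => abs_nonneg _
      exact Finset.range_mono (Nat.mul_le_mul_right _ (Nat.le_succ k))
    rw [Finset.sum_add_distrib, Finset.sum_const, Finset.card_range, nsmul_eq_mul] at h2
    have h4 : (N * Real.log B + 1) + k * (2 * N * Real.log B + 1) ≤ b := by
      have : 0 ≤ (k : ℝ) := Nat.cast_nonneg _
      rw [hb]; linarith
    linarith

/-- Comparison of the mean of a perturbed cocycle with that of the original one. -/
lemma lI_perturb (H : IsTrigCocycle c B ζ₁ ζ₂ A) (H' : IsTrigCocycle c B ζ₁ ζ₂ A') {T ε : ℝ}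
    (hT : ∀ E : Set UnitAddCircle, MeasurableSet E → ∀ (α : ℝ) (n : ℕ),
      ∫ x in E, ∑ j ∈ Finset.range n, |Real.log (wt c ζ₁ ζ₂ (x + j • (α : UnitAddCircle)))| ≤
      n * (T * volume.real E + ε))
    {n : ℕ} {u : ℝ} (hu : 0 < u)
    (hclose : ∀ x, ‖ct α' A' n x - ct α A n x‖ ≤ u / 2)
    {bad : Set UnitAddCircle} (hbad : MeasurableSet bad)
    (hgood : ∀ᵐ x, x ∉ bad → u ≤ ‖ct α A n x‖) :
    lI α A n - Real.log 2 - (n * (T * volume.real bad + ε) +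
      (n * Real.log B + 1) * volume.real bad) ≤ lI α' A' n := by
  set S : UnitAddCircle → ℝ := fun x => ∑ j ∈ Finset.range n,
    |Real.log (wt c ζ₁ ζ₂ (x + j • (α' : UnitAddCircle)))| with hS
  have hSi : Integrable S := integrable_finsetSum _ fun j _ =>
    (H.integrable_log_wt.comp_add_right (j • (α' : UnitAddCircle))).abs
  set b : ℝ := n * Real.log B + 1 with hb
  have hRi : Integrable fun x => S x + b := hSi.add (integrable_const b)
  have hcomp := setIntegral_compare (F := lphi α' A' n) (G := lphi α A n)
    (R := fun x => S x + b) (H'.integrable_lphi α' _) (H.integrable_lphi α _) hRi hbad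
    (a := Real.log 2) (Real.log_nonneg (by norm_num)) ?_ ?_
  · have h1 : ∫ x in bad, (S x + b) = (∫ x in bad, S x) + volume.real bad * b := by
      rw [integral_add hSi.integrableOn (integrable_const b).integrableOn,
        setIntegral_const, smul_eq_mul]
    have h2 := hT bad hbad α' n
    rw [h1] at hcomp
    change lI α A n - _ - _ ≤ lI α' A' n at hcomp
    change ∫ x in bad, S x ≤ _ at h2
    linarith
  · filter_upwards [hgood] with x hx hxb
    have h1 := hx hxb
    have h2 := hclose x
    have h3 := norm_sub_norm_le (ct α A n x) (ct α' A' n x)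
    rw [norm_sub_rev] at h3
    unfold lphi
    have h4 : 0 < ‖ct α A n x‖ := by linarith
    rw [← Real.log_div h4.ne' (by norm_num)]
    exact Real.log_le_log (by positivity) (by linarith)
  · filter_upwards [H'.ae_reg α'] with x hreg
    have h1 : -S x ≤ lphi α' A' n x := by
      refine le_trans ?_ (H'.lphi_ge hreg _)
      rw [hS, ← Finset.sum_neg_distrib]
      exact Finset.sum_le_sum fun j _ => neg_abs_le _
    have h2 := H.lphi_le α n x
    linarith

end IsTrigCocycle

/-- A decreasing sequence satisfying an approximate avalanche rule over a long range stays close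
to its initial value. -/
lemma antitone_avalanche {b : ℕ → ℝ} (hb : Antitone b) {L η ε₁ ε₂ e : ℝ} {h J S : ℕ}
    (hη : 0 ≤ η) (hη1 : η ≤ 1) (hε₁ : 0 ≤ ε₁) (hε₂ : ε₂ ≤ 1) (he : 0 ≤ e) (hh : 1 ≤ h)
    (hJ : 2 * h ≤ J) (h0 : b 0 ≤ L + η) (h1 : L - ε₁ ≤ b 1)
    (rule : ∀ i, L - ε₂ ≤ b (i + 1) → ∀ m ≤ J, 2 * b (i + 1) - b i - e ≤ b (i + m))
    (hsmall : 2 * ε₁ + η + e + S * (2 / h + e) ≤ ε₂) :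
    ∀ i ≤ S * h, L - ε₂ ≤ b i := by
  have hhpos : (0 : ℝ) < h := by exact_mod_cast hh
  have hstep : 0 ≤ 2 / (h : ℝ) + e := by positivity
  have hle : ∀ s : ℕ, s ≤ S → 2 * ε₁ + η + e + s * (2 / h + e) ≤ ε₂ := fun s hs => by
    have : (s : ℝ) * (2 / h + e) ≤ S * (2 / h + e) := by gcongr
    linarith
  have main : ∀ s : ℕ, s + 1 ≤ S →
      L - (2 * ε₁ + η + e + (s + 1 : ℕ) * (2 / h + e)) ≤ b ((s + 1) * h) := by
    intro s
    induction s with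
    | zero =>
      intro hs
      have h2 := hle 1 hs
      have h3 := rule 0 (by push_cast at h2; rw [zero_add]; linarith) h (by omega)
      simp only [zero_add, one_mul] at h3 ⊢
      push_cast
      linarith
    | succ s ih =>
      intro hs
      have h2 := ih (by omega)
      have h3 := hle (s + 1) (by omega)
      obtain ⟨i, hi, hlt⟩ : ∃ i ∈ Finset.range h,
          b (s * h + i) - b (s * h + (i + 1)) ≤ 2 / h := by
        by_contra! hcon
        have h4 := Finset.sum_lt_sum_of_nonempty ⟨0, Finset.mem_range.2 hh⟩ hcon
        rw [Finset.sum_const, Finset.card_range, nsmul_eq_mul,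
          Finset.sum_range_sub' (fun i => b (s * h + i)), add_zero,
          show s * h + h = (s + 1) * h by ring, mul_div_cancel₀ _ hhpos.ne'] at h4
        have h5 := hb (Nat.zero_le (s * h))
        linarith
      have hi' := Finset.mem_range.1 hi
      rw [← add_assoc] at hlt
      have h4 : b ((s + 1) * h) ≤ b (s * h + i + 1) := hb (by rw [add_mul, one_mul]; omega)
      have h5 := rule (s * h + i) (by linarith) (2 * h - i) (by omega)
      rw [show s * h + i + (2 * h - i) = (s + 1 + 1) * h by
        rw [add_mul, add_mul, one_mul]; omega] at h5
      push_cast at h2 ⊢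
      linarith
  intro i hi
  rcases Nat.eq_zero_or_pos S with rfl | hS
  · have h2 := hb (Nat.zero_le 1)
    simp only [zero_mul, Nat.le_zero] at hi
    subst hi
    push_cast at hsmall
    linarith
  · obtain ⟨s, rfl⟩ := Nat.exists_eq_succ_of_ne_zero hS.ne'
    have h2 := main s le_rfl
    have h3 := hle (s + 1) le_rfl
    have h4 := hb hi
    simp only [Nat.succ_eq_add_one] at h4
    linarith

namespace IsTrigCocycle

variable {c B : ℝ} {ζ₁ ζ₂ : ℂ} {A A' : UnitAddCircle → Matrix (Fin 2) (Fin 2) ℂ} {α α' : ℝ}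

lemma lI_rule (H : IsTrigCocycle c B ζ₁ ζ₂ A) {T ε : ℝ} (hT0 : 0 ≤ T)
    (hT : ∀ E : Set UnitAddCircle, MeasurableSet E → ∀ (α : ℝ) (n : ℕ),
      ∫ x in E, ∑ j ∈ Finset.range n, |Real.log (wt c ζ₁ ζ₂ (x + j • (α : UnitAddCircle)))| ≤
      n * (T * volume.real E + ε))
    {L κ η β e : ℝ} {N Q m : ℕ} (hQ : 1 ≤ Q) (hQN : Q ≤ N) (he : 0 ≤ e)
    (hN : ∀ x, ‖ct α A N x‖ ≤ Real.exp (N * (L + η)))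
    (hw : ∀ x, ∏ j ∈ Finset.range N, wt c ζ₁ ζ₂ (x + j • (α : UnitAddCircle)) ≤
      Real.exp (N * (Real.log c + η)))
    (hgap : Real.log 64 ≤ N * (2 * (L - Real.log c) - 4 * κ - 4 * η))
    {bad : Set UnitAddCircle} (hbad : MeasurableSet bad)
    (hgood : ∀ᵐ x, x ∉ bad → (2 * N : ℕ) * (L - κ) ≤ lphi α A (2 * N) x)
    (hβ : 2 ^ m * volume.real bad ≤ β)
    (he1 : Real.log 8 ≤ Q * (e / 4)) (he2 : 2 * ε ≤ e / 4)
    (he3 : 2 * (T + Real.log B + 1) * β ≤ e / 4) :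
    2 * (lI α A (2 * N) / (2 * N : ℕ)) - lI α A N / N - e ≤
      lI α A (N * 2 ^ m) / (N * 2 ^ m : ℕ) := by
  have hNpos : (0 : ℝ) < N := by exact_mod_cast (by omega : 0 < N)
  have hQN' : (Q : ℝ) ≤ N := by exact_mod_cast hQN
  have hQ' : (1 : ℝ) ≤ Q := by exact_mod_cast hQ
  obtain ⟨k, hk⟩ : ∃ k : ℕ, 2 ^ m = k + 1 :=
      ⟨2 ^ m - 1, by have := Nat.one_le_two_pow (n := m); omega⟩
  have hk' : (2 : ℝ) ^ m = k + 1 := by exact_mod_cast hk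
  have hpair : ∀ᵐ x, x ∉ bad → Real.exp ((2 * N : ℕ) * (L - κ)) ≤ ‖ct α A (2 * N) x‖ := by
    filter_upwards [hgood, H.ae_reg α] with x hx hreg hxb
    rw [← Real.le_log_iff_exp_le (H.norm_ct_pos hreg _)]
    exact hx hxb
  have key := H.lI_avalanche (α := α) (k := k) (N := N) hT0 hT
      (Real.exp_pos ((2 * N : ℕ) * (L - κ)))
    (Real.exp_pos _) hN (d := Real.exp (N * (Real.log c + η)) ^ 2) (fun x => by
      rw [H.norm_det_ct]
      have := hw x
      have h0 : 0 ≤ ∏ j ∈ Finset.range N, wt c ζ₁ ζ₂ (x + j • (α : UnitAddCircle)) :=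
        Finset.prod_nonneg fun j _ => H.wt_nonneg _
      gcongr) (by
      rw [← Real.exp_log (show (0 : ℝ) < 64 by norm_num), ← Real.exp_nat_mul, ← Real.exp_nat_mul,
        ← Real.exp_nat_mul, ← Real.exp_add, ← Real.exp_add, Real.exp_le_exp]
      push_cast
      linarith) hbad hpair
  have hv0 : 0 ≤ volume.real bad := measureReal_nonneg
  have hkv : k * volume.real bad ≤ β := by
    refine le_trans ?_ hβ
    gcongr
    linarith
  have hβ0 : 0 ≤ β := le_trans (by positivity) hβ
  have hB0 := H.log_B_nonneg
  have h1 : N * (T * (k * volume.real bad) + ε) + (N * Real.log B + 1) * (k * volume.real bad) ≤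
      N * (T * β + ε) + (N * Real.log B + N * 1) * β := by
    gcongr
    linarith
  have h2 : 2 * ((k : ℝ) + 1) * (N * (T * (k * volume.real bad) + ε) +
      (N * Real.log B + 1) * (k * volume.real bad)) ≤ 2 * (k + 1) *
      (N * (T * β + ε) + (N * Real.log B + N * 1) * β) := by
    gcongr
  have h3 : 2 * ((k : ℝ) + 1) * (N * (T * β + ε) + (N * Real.log B + N * 1) * β) =
      (k + 1) * N * (2 * ε + 2 * (T + Real.log B + 1) * β) := by ring
  have h4 : ((k : ℝ) + 1) * N * (2 * ε + 2 * (T + Real.log B + 1) * β) ≤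
      (k + 1) * N * (e / 4 + e / 4) := by gcongr
  have h5 : ((k : ℝ) + 1) * Real.log 8 ≤ (k + 1) * (N * (e / 4)) := by
    gcongr
    exact he1.trans (by gcongr)
  have h6 : 0 ≤ ((k : ℝ) + 1) * (N * (e / 4)) := by positivity
  rw [hk, mul_comm N (k + 1)]
  push_cast
  rw [le_div_iff₀ (by positivity)]
  have h7 : (2 * (lI α A (2 * N) / (2 * N)) - lI α A N / N - e) * (((k : ℝ) + 1) * N) =
      (k + 1) * (lI α A (2 * N) - lI α A N) - 4 * ((k + 1) * (N * (e / 4))) := by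
    field_simp
  rw [h7]
  linarith

lemma perturb_small {B L κ : ℝ} (hB : 1 ≤ B) {k₀ Q : ℕ} (hk₀ : 1 ≤ k₀) (hQ : 1 ≤ Q) :
    12 * ((2 * (k₀ * Q) : ℕ) : ℝ) ^ 2 * B ^ (2 * (k₀ * Q) + 1) *
      Real.exp (-((2 * k₀ * (1 + 2 * Real.log B + |L| + κ) + 4) * Q)) ≤
      Real.exp ((2 * (k₀ * Q) : ℕ) * (L - κ)) / 2 := by
  set n := 2 * (k₀ * Q) with hn
  have hn1 : 1 ≤ n := by
    have := Nat.mul_pos hk₀ hQ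
    omega
  have hn1' : (1 : ℝ) ≤ n := by exact_mod_cast hn1
  have hQ' : (1 : ℝ) ≤ Q := by exact_mod_cast hQ
  have h1 : (n : ℝ) ^ 2 ≤ 2 * Real.exp n := by
    have := Real.quadratic_le_exp_of_nonneg (x := (n : ℝ)) (by positivity)
    linarith
  have h2 : B ^ (n + 1) = Real.exp ((n + 1 : ℕ) * Real.log B) := by
    rw [Real.exp_nat_mul, Real.exp_log (by linarith)]
  have h3 : (48 : ℝ) ≤ Real.exp 4 := by
    have h4 := Real.exp_one_gt_d9
    have h5 : Real.exp 4 = Real.exp 1 ^ 4 := by rw [← Real.exp_nat_mul]; norm_num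
    have h6 : (2.7 : ℝ) ^ 4 ≤ Real.exp 1 ^ 4 := by gcongr; linarith
    rw [h5]; norm_num at h6 ⊢; linarith
  have hcn : (2 * k₀ * (1 + 2 * Real.log B + |L| + κ) + 4) * (Q : ℝ) =
      n * (1 + 2 * Real.log B + |L| + κ) + 4 * Q := by rw [hn]; push_cast; ring
  rw [hcn]
  have h7 : 12 * (n : ℝ) ^ 2 * B ^ (n + 1) *
      Real.exp (-(n * (1 + 2 * Real.log B + |L| + κ) + 4 * Q)) ≤
      (Real.exp 4 / 4) * (2 * Real.exp n) * Real.exp ((n + 1 : ℕ) * Real.log B) *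
      Real.exp (-(n * (1 + 2 * Real.log B + |L| + κ) + 4 * Q)) := by
    rw [h2]
    gcongr
    linarith
  refine h7.trans ?_
  have h8 : (Real.exp 4 / 4) * (2 * Real.exp n) * Real.exp ((n + 1 : ℕ) * Real.log B) *
      Real.exp (-(n * (1 + 2 * Real.log B + |L| + κ) + 4 * Q)) =
      Real.exp (4 + n + (n + 1 : ℕ) * Real.log B -
        (n * (1 + 2 * Real.log B + |L| + κ) + 4 * Q)) / 2 := by
    rw [Real.exp_sub, Real.exp_add, Real.exp_add, Real.exp_neg]
    ring
  rw [h8]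
  gcongr
  have h9 : Real.log B ≤ n * Real.log B := le_mul_of_one_le_left (Real.log_nonneg hB) hn1'
  have h10 : (n : ℝ) * (-|L|) ≤ n * L := by gcongr; exact neg_abs_le L
  push_cast
  linarith

end IsTrigCocycle

lemma two_pow_mul_exp_le {σ : ℝ} (hσ : 0 < σ) {Q m : ℕ} (hm : (m : ℝ) ≤ σ * Q / 4) {v : ℝ}
    (hv : v ≤ 4 / σ * Real.exp (-(σ * Q))) :
    2 ^ m * v ≤ 4 / σ * Real.exp (-(σ * Q) / 2) := by
  have h1 : (2 : ℝ) ^ m ≤ Real.exp (σ * Q / 4) ^ 2 := by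
    have h2 : (2 : ℝ) ≤ Real.exp 1 := by linarith [Real.exp_one_gt_d9]
    calc (2 : ℝ) ^ m ≤ Real.exp 1 ^ m := by gcongr
      _ = Real.exp m := by rw [← Real.exp_nat_mul]; simp
      _ ≤ Real.exp (σ * Q / 4) := by gcongr
      _ ≤ Real.exp (σ * Q / 4) ^ 2 := by
        have h3 : 1 ≤ Real.exp (σ * Q / 4) :=
          Real.one_le_exp ((Nat.cast_nonneg m).trans hm)
        exact le_self_pow₀ h3 (by norm_num)
  calc 2 ^ m * v ≤ 2 ^ m * (4 / σ * Real.exp (-(σ * Q))) := by gcongr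
    _ ≤ Real.exp (σ * Q / 4) ^ 2 * (4 / σ * Real.exp (-(σ * Q))) := by gcongr
    _ = _ := by
      rw [← Real.exp_nat_mul, mul_left_comm, ← Real.exp_add]
      congr 2
      push_cast
      ring

lemma eventually_le_mul_nat (a : ℝ) {b : ℝ} (hb : 0 < b) :
    ∀ᶠ Q : ℕ in Filter.atTop, a ≤ b * Q :=
  (tendsto_natCast_atTop_atTop.const_mul_atTop hb).eventually_ge_atTop a

lemma eventually_mul_exp_neg_le (a : ℝ) {b e : ℝ} (hb : 0 < b) (he : 0 < e) :
    ∀ᶠ Q : ℕ in Filter.atTop, a * Real.exp (-(b * Q)) ≤ e := by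
  have h : Filter.Tendsto (fun Q : ℕ => a * Real.exp (-(b * Q))) Filter.atTop (nhds (a * 0)) :=
    (Real.tendsto_exp_neg_atTop_nhds_zero.comp
      (tendsto_natCast_atTop_atTop.const_mul_atTop hb)).const_mul a
  rw [mul_zero] at h
  exact h.eventually_le_const he

lemma exp_neg_le_inv_cube {s : ℝ} (hs : 4 ≤ s) {Q : ℕ} (hQ : 1 ≤ Q) :
    Real.exp (-(s * Q)) ≤ 1 / (2 * (Q : ℝ) ^ 3) := by
  have hQ' : (1 : ℝ) ≤ Q := by exact_mod_cast hQ
  rw [Real.exp_neg, one_div]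
  refine inv_anti₀ (by positivity) ?_
  have h1 : (Q : ℝ) ≤ Real.exp Q := by linarith [Real.add_one_le_exp (Q : ℝ)]
  have h2 : 2 ≤ Real.exp (Q : ℝ) := by linarith [Real.add_one_le_exp (Q : ℝ)]
  calc 2 * (Q : ℝ) ^ 3 ≤ Real.exp Q * Real.exp Q ^ 3 := by gcongr
    _ = Real.exp (4 * Q) := by
      rw [← Real.exp_nat_mul, ← Real.exp_add]; congr 1; push_cast; ring
    _ ≤ Real.exp (s * Q) := by gcongr

namespace IsTrigCocycle

variable {c B : ℝ} {ζ₁ ζ₂ : ℂ} {A A' : UnitAddCircle → Matrix (Fin 2) (Fin 2) ℂ} {α α' : ℝ}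

set_option maxHeartbeats 1600000 in
/-- Stability of the Lyapunov exponent: the finite-scale exponents of small perturbations of an
irrational cocycle with `log c < L` stay close to `L` up to scales exponentially large
in `Q`. -/
theorem exists_uniform_lower (H : IsTrigCocycle c B ζ₁ ζ₂ A) (hα : Irrational α) {L : ℝ}
    (hL : Filter.Tendsto (fun n : ℕ => lI α A n / n) Filter.atTop (nhds L))
    (hLn : ∀ n : ℕ, n * L ≤ lI α A n) {κ : ℝ} (hκ : 0 < κ) (hκ1 : κ ≤ 1)
    (hκL : 100 * κ ≤ L - Real.log c) :
    ∃ c₃ : ℝ, 0 < c₃ ∧ ∃ k₀ : ℕ, 1 ≤ k₀ ∧ ∀ D N₁ : ℕ, ∃ Q ≥ N₁, 1 ≤ Q ∧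
      ∀ (α' : ℝ) (A' : UnitAddCircle → Matrix (Fin 2) (Fin 2) ℂ), IsTrigCocycle c B ζ₁ ζ₂ A' →
      |α' - α| ≤ Real.exp (-(c₃ * Q)) → (∀ x, ‖A' x - A x‖ ≤ Real.exp (-(c₃ * Q))) →
      (∀ i ≤ D * Q, (k₀ * Q * 2 ^ i : ℕ) * (L - κ) ≤ lI α' A' (k₀ * Q * 2 ^ i)) ∧
      (∀ k : ℕ, 1 ≤ k → ∀ x, ‖ct α' A' (k * Q) x‖ ≤ Real.exp ((k * Q : ℕ) * (L + κ))) ∧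
      (∀ (k : ℕ) (x : UnitAddCircle), ∏ j ∈ Finset.range (k * Q),
        wt c ζ₁ ζ₂ (x + j • (α' : UnitAddCircle)) ≤
        Real.exp ((k * Q : ℕ) * (Real.log c + κ))) := by
  have hB0 := H.log_B_nonneg
  set C₆ : ℝ := 2 * Real.log B + 4 * |Real.log c| + 14 with hC₆
  have hC₆0 : 0 < C₆ := by positivity
  set k₀ : ℕ := ⌈2 * C₆ / κ⌉₊ + 1 with hk₀
  have hk₀1 : 1 ≤ k₀ := by omega
  have hk₀C : 2 * C₆ ≤ k₀ * κ := by
    rw [← div_le_iff₀ hκ]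
    refine (Nat.le_ceil _).trans ?_
    rw [hk₀]; push_cast; linarith
  set c₃ : ℝ := 2 * k₀ * (1 + 2 * Real.log B + |L| + κ) + 4 with hc₃
  have hc₃4 : 4 ≤ c₃ := by
    have : 0 ≤ 2 * k₀ * (1 + 2 * Real.log B + |L| + κ) := by positivity
    linarith
  refine ⟨c₃, by linarith, k₀, hk₀1, fun D N₁ => ?_⟩
  set σ : ℝ := κ / 24 with hσ
  have hσ0 : 0 < σ := by positivity
  set S : ℕ := ⌈16 * D / σ⌉₊ with hS
  set e : ℝ := κ / (32 * (S + 1)) with he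
  have he0 : 0 < e := by positivity
  obtain ⟨T, hT0, hT⟩ := H.exists_tail_sum (show 0 < e / 8 by positivity)
  obtain ⟨Q₁, hQ₁⟩ := large_deviation c B (κ := κ / 16) (σ := σ) (by positivity) (by linarith) hσ0
    (by linarith)
  obtain ⟨δ, hδ, Q₂, hQ₂⟩ := H.norm_ct_le_exp hL (show 0 < κ / 16 by positivity)
  obtain ⟨Q₃, hQ₃⟩ := sum_log_wt_le (show 0 < κ / 16 by positivity)
  have hev : ∀ᶠ Q : ℕ in Filter.atTop, Real.log 8 ≤ (e / 4) * Q ∧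
      (2 * (T + Real.log B + 1) * (4 / σ)) * Real.exp (-(σ / 2 * Q)) ≤ e / 4 ∧
      16 ≤ σ * Q ∧ 512 * S ≤ (κ * σ) * Q ∧ Real.log 64 ≤ κ * Q ∧
      1 * Real.exp (-(c₃ * Q)) ≤ δ := by
    filter_upwards [eventually_le_mul_nat (Real.log 8) (show 0 < e / 4 by positivity),
      eventually_mul_exp_neg_le (2 * (T + Real.log B + 1) * (4 / σ)) (show 0 < σ / 2 by positivity)
        (show 0 < e / 4 by positivity), eventually_le_mul_nat 16 hσ0,
      eventually_le_mul_nat (512 * S) (show 0 < κ * σ by positivity),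
      eventually_le_mul_nat (Real.log 64) hκ,
      eventually_mul_exp_neg_le 1 (show 0 < c₃ by linarith) hδ] with Q a1 a2 a3 a4 a5 a6
    exact ⟨a1, a2, a3, a4, a5, a6⟩
  obtain ⟨Q₄, hQ₄⟩ := Filter.eventually_atTop.1 hev
  obtain ⟨Q, hQ, hgoodQ⟩ := exists_goodDenom hα (max N₁ (max Q₁ (max Q₂ (max Q₃ (max Q₄ 1)))))
  simp only [ge_iff_le, max_le_iff] at hQ
  obtain ⟨q0, q1, q2, q3, q4, q5⟩ := hQ
  obtain ⟨a1, a2, a3, a4, a5, a6⟩ := hQ₄ Q q4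
  rw [one_mul] at a6
  refine ⟨Q, q0, q5, fun α' A' H' hα' hA' => ?_⟩
  have hQr : (1 : ℝ) ≤ Q := by exact_mod_cast q5
  have hgα : GoodDenom α Q := hgoodQ α (by simp)
  have hgα' : GoodDenom α' Q := hgoodQ α' (hα'.trans (exp_neg_le_inv_cube hc₃4 q5))
  have hup := hQ₂ Q q2 α' A' H' hgα' (hα'.trans a6) fun x => (hA' x).trans a6
  have hwt := hQ₃ Q q3 α' hgα' c B ζ₁ ζ₂ A' H'
  refine ⟨?_, fun k hk x => (hup k hk x).trans ?_, fun k x => (hwt k x).trans ?_⟩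
  rotate_left
  · gcongr; linarith
  · gcongr; linarith
  set β : ℝ := 4 / σ * Real.exp (-(σ * Q) / 2) with hβ
  have hβe : 2 * (T + Real.log B + 1) * β ≤ e / 4 := by
    refine le_trans (le_of_eq ?_) a2
    rw [hβ, show -(σ * Q) / 2 = -(σ / 2 * Q) by ring]
    ring
  set b : ℕ → ℝ := fun i => lI α' A' (k₀ * Q * 2 ^ i) / (k₀ * Q * 2 ^ i : ℕ) with hb
  have hk₀Q : 1 ≤ k₀ * Q := Nat.mul_pos hk₀1 q5
  have hNpos : ∀ i : ℕ, 1 ≤ k₀ * Q * 2 ^ i := fun i => Nat.mul_pos hk₀Q (by positivity)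
  have hdbl : ∀ i : ℕ, k₀ * Q * 2 ^ (i + 1) = 2 * (k₀ * Q * 2 ^ i) := fun i => by ring
  have hLDT : ∀ (α₁ : ℝ) (A₁ : UnitAddCircle → Matrix (Fin 2) (Fin 2) ℂ),
      IsTrigCocycle c B ζ₁ ζ₂ A₁ → GoodDenom α₁ Q → ∀ i : ℕ,
      (2 * (k₀ * Q * 2 ^ i) : ℕ) * (L - κ / 4) ≤ lI α₁ A₁ (2 * (k₀ * Q * 2 ^ i)) →
      ∃ bad : Set UnitAddCircle, MeasurableSet bad ∧
      volume.real bad ≤ 4 / σ * Real.exp (-(σ * Q)) ∧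
      ∀ᵐ x, x ∉ bad → (2 * (k₀ * Q * 2 ^ i) : ℕ) * (L - κ) ≤
        lphi α₁ A₁ (2 * (k₀ * Q * 2 ^ i)) x := by
    intro α₁ A₁ H₁ hg i hI
    set n := 2 * (k₀ * Q * 2 ^ i) with hn
    obtain ⟨bad, h1, h2, h3⟩ := hQ₁ Q q1 α₁ hg ζ₁ ζ₂ A₁ H₁ n (by have := hNpos i; omega)
    refine ⟨bad, h1, h2, h3.mono fun x hx hxb => ?_⟩
    have h4 := hx hxb
    have h5 : C₆ * Q ≤ n * (κ / 4) := by
      have h6 : (1 : ℝ) ≤ 2 ^ i := one_le_pow₀ (by norm_num)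
      calc C₆ * Q ≤ (k₀ * κ / 2) * Q := by gcongr; linarith
        _ = (k₀ * κ / 2) * Q * 1 := by ring
        _ ≤ (k₀ * κ / 2) * Q * 2 ^ i := by gcongr
        _ = n * (κ / 4) := by rw [hn]; push_cast; ring
    have h6 : (n : ℝ) * (2 * (κ / 16) + 3 * σ) = n * (κ / 4) := by rw [hσ]; ring
    have h7 : 0 ≤ (n : ℝ) * (κ / 4) := by positivity
    rw [h6] at h4
    linarith
  have hupN : ∀ (i : ℕ) (x), ‖ct α' A' (k₀ * Q * 2 ^ i) x‖ ≤
      Real.exp ((k₀ * Q * 2 ^ i : ℕ) * (L + κ / 16)) := fun i x => by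
    have := hup (k₀ * 2 ^ i) (Nat.mul_pos hk₀1 (by positivity)) x
    rwa [show k₀ * 2 ^ i * Q = k₀ * Q * 2 ^ i by ring] at this
  have hwtN : ∀ (i : ℕ) (x : UnitAddCircle), ∏ j ∈ Finset.range (k₀ * Q * 2 ^ i),
      wt c ζ₁ ζ₂ (x + j • (α' : UnitAddCircle)) ≤
      Real.exp ((k₀ * Q * 2 ^ i : ℕ) * (Real.log c + κ / 16)) := fun i x => by
    have := hwt (k₀ * 2 ^ i) x
    rwa [show k₀ * 2 ^ i * Q = k₀ * Q * 2 ^ i by ring] at this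
  set J : ℕ := ⌊σ * Q / 4⌋₊ with hJ
  have hJle : (J : ℝ) ≤ σ * Q / 4 := Nat.floor_le (by positivity)
  have hJgt : σ * Q / 4 < J + 1 := Nat.lt_floor_add_one _
  set h : ℕ := J / 2 with hh
  have hJ2 : J ≤ 2 * h + 1 := by omega
  have hhge : σ * Q / 16 ≤ h := by
    have : (J : ℝ) ≤ 2 * h + 1 := by exact_mod_cast hJ2
    linarith
  have hhpos : (0 : ℝ) < h := by linarith
  have hh1 : 1 ≤ h := by exact_mod_cast hhpos
  have hanti : Antitone b := by
    refine antitone_nat_of_succ_le fun i => ?_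
    have h1 := H'.lI_add_le α' (k₀ * Q * 2 ^ i) (k₀ * Q * 2 ^ i)
    have h2 : (0 : ℝ) < (k₀ * Q * 2 ^ i : ℕ) := by exact_mod_cast hNpos i
    rw [← two_mul, ← hdbl] at h1
    simp only [hb]
    rw [div_le_div_iff₀ (by exact_mod_cast hNpos (i + 1)) h2, hdbl i, ← hdbl i]
    have h3 : ((k₀ * Q * 2 ^ (i + 1) : ℕ) : ℝ) = 2 * (k₀ * Q * 2 ^ i : ℕ) := by
      rw [hdbl]; push_cast; ring
    rw [h3]
    have h4 := mul_le_mul_of_nonneg_right h1 h2.le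
    linarith
  have hb0 : b 0 ≤ L + (κ / 16 + e) := by
    have h1 : lI α' A' (k₀ * Q * 2 ^ 0) ≤ (k₀ * Q * 2 ^ 0 : ℕ) * (L + κ / 16) := by
      have h2 : lI α' A' (k₀ * Q * 2 ^ 0) ≤
          ∫ x : UnitAddCircle, ((k₀ * Q * 2 ^ 0 : ℕ) * (L + κ / 16) : ℝ) := by
        refine integral_mono_ae (H'.integrable_lphi α' _) (integrable_const _) ?_
        filter_upwards [H'.ae_reg α'] with x hreg
        exact (Real.log_le_iff_le_exp (H'.norm_ct_pos hreg _)).2 (hupN 0 x)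
      simpa using h2
    have h2 : (0 : ℝ) < (k₀ * Q * 2 ^ 0 : ℕ) := by exact_mod_cast hNpos 0
    have h3 : b 0 ≤ L + κ / 16 := by
      simp only [hb]
      rw [div_le_iff₀ h2, mul_comm (L + κ / 16)]
      exact h1
    linarith
  have hb1 : L - e ≤ b 1 := by
    have hn : k₀ * Q * 2 ^ 1 = 2 * (k₀ * Q) := by ring
    have hn0 : (0 : ℝ) < (2 * (k₀ * Q) : ℕ) := by exact_mod_cast (by omega : 0 < 2 * (k₀ * Q))
    have hI := hLn (2 * (k₀ * Q))
    obtain ⟨bad, h1, h2, h3⟩ := hLDT α A H hgα 0 (by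
      rw [pow_zero, mul_one]
      refine le_trans ?_ hI
      gcongr
      linarith)
    rw [pow_zero, mul_one] at h3
    have h4 := H.lI_perturb H' (α := α) (α' := α') hT (n := 2 * (k₀ * Q)) (Real.exp_pos
      ((2 * (k₀ * Q) : ℕ) * (L - κ))) (fun x => (H.ct_sub_le H' hα' hA' _ x).trans
        (perturb_small H.one_le hk₀1 q5)) h1 (by
      filter_upwards [h3, H.ae_reg α] with x hx hreg hxb
      rw [← Real.le_log_iff_exp_le (H.norm_ct_pos hreg _)]
      exact hx hxb)
    have h5 : volume.real bad ≤ β := by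
      have := two_pow_mul_exp_le hσ0 (Q := Q) (m := 0) (by simp; positivity) h2
      simpa using this
    simp only [hb, hn]
    rw [le_div_iff₀ hn0]
    set n := 2 * (k₀ * Q) with hndef
    have hn1 : (1 : ℝ) ≤ n := by exact_mod_cast hn0
    have h6 : n * (T * volume.real bad + e / 8) + (n * Real.log B + 1) * volume.real bad ≤
        n * (T * β + e / 8) + (n * Real.log B + n) * β := by
      gcongr
    have h7 : Real.log 2 ≤ n * (e / 4) := by
      have h8 : Real.log 2 ≤ Real.log 8 := Real.log_le_log (by norm_num) (by norm_num)
      have h9 : (Q : ℝ) ≤ n := by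
        have : Q ≤ k₀ * Q := Nat.le_mul_of_pos_left Q hk₀1
        have : Q ≤ 2 * (k₀ * Q) := by omega
        exact_mod_cast this
      have h10 : e / 4 * Q ≤ e / 4 * n := by gcongr
      linarith
    have h8 : (n : ℝ) * (2 * (T + Real.log B + 1) * β) ≤ n * (e / 4) := by gcongr
    have h9 : 0 ≤ (n : ℝ) * (e / 4) := by positivity
    linarith
  have hrule : ∀ i, L - κ / 4 ≤ b (i + 1) → ∀ m ≤ J, 2 * b (i + 1) - b i - e ≤ b (i + m) := by
    intro i hi m hm
    have h2 : (0 : ℝ) < (k₀ * Q * 2 ^ (i + 1) : ℕ) := by exact_mod_cast hNpos (i + 1)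
    have h3 : (2 * (k₀ * Q * 2 ^ i) : ℕ) * (L - κ / 4) ≤ lI α' A' (2 * (k₀ * Q * 2 ^ i)) := by
      simp only [hb] at hi
      rw [le_div_iff₀ h2, hdbl, mul_comm (L - κ / 4)] at hi
      exact hi
    obtain ⟨bad, h4, h5, h6⟩ := hLDT α' A' H' hgα' i h3
    have hQN : Q ≤ k₀ * Q * 2 ^ i := by
      have h8 : Q ≤ k₀ * Q := Nat.le_mul_of_pos_left _ hk₀1
      exact h8.trans (Nat.le_mul_of_pos_right _ (by positivity))
    have hQN' : (Q : ℝ) ≤ (k₀ * Q * 2 ^ i : ℕ) := by exact_mod_cast hQN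
    have h7 := H'.lI_rule (m := m) hT0 hT q5 hQN he0.le (hupN i) (hwtN i) (by
      have h8 : κ * Q ≤ κ * (k₀ * Q * 2 ^ i : ℕ) := by gcongr
      have h9 : (k₀ * Q * 2 ^ i : ℕ) * κ ≤ ((k₀ * Q * 2 ^ i : ℕ) : ℝ) *
        (2 * (L - Real.log c) - 4 * κ - 4 * (κ / 16)) := by
        gcongr
        linarith
      linarith) h4 h6 (two_pow_mul_exp_le hσ0 (le_trans (by exact_mod_cast hm) hJle) h5)
      (by linarith) (by linarith) hβe
    simp only [hb]
    rw [hdbl i, show k₀ * Q * 2 ^ (i + m) = k₀ * Q * 2 ^ i * 2 ^ m by ring]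
    exact h7
  have hS1 : (0 : ℝ) < S + 1 := by positivity
  have hef : e * (S + 1) = κ / 32 := by rw [he]; field_simp
  have hSh : (S : ℝ) * (2 / h) ≤ κ / 16 := by
    rw [mul_div_assoc', div_le_iff₀ hhpos]
    have : κ / 16 * (σ * Q / 16) ≤ κ / 16 * h := by gcongr
    linarith
  have hSe : 0 ≤ e * S := by positivity
  have hfin := antitone_avalanche (S := S) hanti (η := κ / 16 + e) (ε₁ := e) (ε₂ := κ / 4) (e := e)
    (by positivity) (by linarith) he0.le (by linarith) he0.le hh1 (by omega) hb0 hb1 hrule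
    (by linarith)
  intro i hi
  have hiS : i ≤ S * h := by
    refine hi.trans ?_
    have h1 : 16 * D / σ ≤ S := Nat.le_ceil _
    rw [div_le_iff₀ hσ0] at h1
    have h2 : (D : ℝ) * Q ≤ S * h := by
      have h3 : (S : ℝ) * (σ * Q / 16) ≤ S * h := by gcongr
      have h4 : 16 * (D : ℝ) * Q ≤ S * σ * Q := by gcongr
      linarith
    exact_mod_cast h2
  have h1 := hfin i hiS
  have h2 : (0 : ℝ) < (k₀ * Q * 2 ^ i : ℕ) := by exact_mod_cast hNpos i
  simp only [hb] at h1
  rw [le_div_iff₀ h2] at h1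
  have h3 : (0 : ℝ) ≤ (k₀ * Q * 2 ^ i : ℕ) * κ := by positivity
  linarith

end IsTrigCocycle

/-- The function `f` on the circle. -/
def fT (t l2 : ℝ) (x : UnitAddCircle) : ℝ :=
  (1 / (-(1 + t ^ 2))) * (2 * t * l2 * (ec x).re + (t ^ 2 - 1) * sq1 l2)

/-- The function `g` on the circle. -/
def gT (t l2 : ℝ) (x : UnitAddCircle) : ℂ :=
  ((1 / (-(1 + t ^ 2)) : ℝ) : ℂ) *
    (-((t ^ 2 * l2 : ℝ) : ℂ) * ec x + ((l2 : ℝ) : ℂ) * ec (-x) + ((2 * t * sq1 l2 : ℝ) : ℂ))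

/-- The matrix `D_z` on the circle. -/
def szego (t l1 l2 : ℝ) (z : ℂ) (x : UnitAddCircle) : Matrix (Fin 2) (Fin 2) ℂ :=
  !![z ^ 2 + sq1 l1 * z * gT t l2 x, -(z * (starRingEnd ℂ) (gT t l2 x)) - sq1 l1;
     -(sq1 l1 * z ^ 2) - z * gT t l2 x, sq1 l1 * z * (starRingEnd ℂ) (gT t l2 x) + 1]

lemma ec_neg_coe (x : ℝ) :
    ec (-(x : UnitAddCircle)) = Complex.exp (-(2 * Real.pi * x) * Complex.I) := by
  rw [ec_neg, ec_coe, ← Complex.exp_neg, neg_mul]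

lemma fS_eq_fT (t l x : ℝ) : fS t l x = fT t l x := by
  have : (2 * Real.pi * x * Complex.I : ℂ) = ((2 * Real.pi * x : ℝ) : ℂ) * Complex.I := by
    push_cast; ring
  rw [fS, fT, ec_coe, this, Complex.exp_ofReal_mul_I_re]

lemma gS_eq_gT (t l x : ℝ) : gS t l x = gT t l x := by
  rw [gS, gT, ec_coe, ec_neg_coe]

lemma conj_gT (t l : ℝ) (x : UnitAddCircle) :
    (starRingEnd ℂ) (gT t l x) = ((1 / (-(1 + t ^ 2)) : ℝ) : ℂ) *
      (-((t ^ 2 * l : ℝ) : ℂ) * ec (-x) + ((l : ℝ) : ℂ) * ec x + ((2 * t * sq1 l : ℝ) : ℂ)) := by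
  rw [gT]
  simp only [map_mul, map_add, map_neg, map_inv₀, Complex.conj_ofReal, conj_ec, ec_neg, inv_inv]

lemma Dz_eq_szego (t l1 l2 x : ℝ) (z : ℂ) : Dz t l1 l2 z x = szego t l1 l2 z x := by
  have h1 : pS t l2 x = -gT t l2 x := by
    rw [pS, gT, ec_coe, ec_neg_coe]
    rw [show (2 * Real.pi * Complex.I * x : ℂ) = 2 * Real.pi * x * Complex.I by ring,
      show -(2 * Real.pi * x * Complex.I : ℂ) = -(2 * Real.pi * x) * Complex.I by ring]
    push_cast
    ring
  have h2 : qS t l2 x = -(starRingEnd ℂ) (gT t l2 x) := by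
    rw [qS, conj_gT, ec_coe, ec_neg_coe]
    rw [show (2 * Real.pi * Complex.I * x : ℂ) = 2 * Real.pi * x * Complex.I by ring,
      show -(2 * Real.pi * x * Complex.I : ℂ) = -(2 * Real.pi * x) * Complex.I by ring]
    push_cast
    ring
  rw [Dz, szego, h1, h2]
  ext i j
  fin_cases i <;> fin_cases j <;> simp <;> ring

lemma sq1_sq {l : ℝ} (h : l ∈ Set.Ioo (0 : ℝ) 1) : sq1 l ^ 2 = 1 - l ^ 2 :=
  Real.sq_sqrt (by nlinarith [h.1, h.2])

lemma sq1_nonneg (l : ℝ) : 0 ≤ sq1 l := Real.sqrt_nonneg _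

lemma sq1_lt_one {l : ℝ} (h : l ∈ Set.Ioo (0 : ℝ) 1) : sq1 l < 1 := by
  have := sq1_sq h
  have h0 := sq1_nonneg l
  nlinarith [h.1, h.2, sq_nonneg (sq1 l)]

lemma fT_eq (t l : ℝ) (x : UnitAddCircle) :
    (fT t l x : ℂ) = ((1 / (-(1 + t ^ 2)) : ℝ) : ℂ) *
      (t * l * (ec x + ec (-x)) + (t ^ 2 - 1) * sq1 l) := by
  have h : (((ec x).re : ℝ) : ℂ) = (ec x + ec (-x)) / 2 := by
    rw [Complex.re_eq_add_conj, conj_ec, ec_neg]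
  rw [fT]
  push_cast
  rw [h]
  ring

lemma fT_sq_add {t l : ℝ} (hl : l ∈ Set.Ioo (0 : ℝ) 1) (x : UnitAddCircle) :
    (fT t l x : ℂ) ^ 2 + gT t l x * (starRingEnd ℂ) (gT t l x) = 1 := by
  have h1 : ec x * ec (-x) = 1 := by rw [← ec_add]; simp [ec_zero]
  have h2 : (sq1 l : ℂ) ^ 2 = 1 - (l : ℂ) ^ 2 := by exact_mod_cast sq1_sq hl
  have h3 : (1 + (t : ℂ) ^ 2) ≠ 0 := by
    exact_mod_cast (by positivity : (1 + t ^ 2) ≠ 0)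
  rw [conj_gT, gT, fT_eq]
  push_cast
  have h4 : (-1 + -(t : ℂ) ^ 2) ≠ 0 := by
    intro h; apply h3; linear_combination -h
  field_simp
  linear_combination (2 * t ^ 2 * l ^ 2 + l ^ 2 * t ^ 4 + l ^ 2 : ℂ) * h1 +
    ((t ^ 2 - 1) ^ 2 + 4 * t ^ 2 : ℂ) * h2

lemma norm_gT_le {t l : ℝ} (hl : l ∈ Set.Ioo (0 : ℝ) 1) (x : UnitAddCircle) :
    ‖gT t l x‖ ≤ 1 := by
  have h := fT_sq_add (t := t) hl x
  rw [Complex.mul_conj, Complex.normSq_eq_norm_sq] at h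
  have h2 : fT t l x ^ 2 + ‖gT t l x‖ ^ 2 = 1 := by exact_mod_cast h
  nlinarith [sq_nonneg (fT t l x), norm_nonneg (gT t l x)]

lemma det_szego {t l1 l2 : ℝ} (hl1 : l1 ∈ Set.Ioo (0 : ℝ) 1) (hl2 : l2 ∈ Set.Ioo (0 : ℝ) 1)
    (z : ℂ) (x : UnitAddCircle) :
    (szego t l1 l2 z x).det = (z * l1 * fT t l2 x) ^ 2 := by
  have h1 := fT_sq_add (t := t) hl2 x
  have h2 : (sq1 l1 : ℂ) ^ 2 = 1 - (l1 : ℂ) ^ 2 := by exact_mod_cast sq1_sq hl1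
  rw [szego, Matrix.det_fin_two_of]
  set G := gT t l2 x
  set G' := (starRingEnd ℂ) G
  linear_combination (l1 ^ 2 * z ^ 2 : ℂ) * (-1) * h1 - (z ^ 2 * (1 - G * G')) * h2

/-- The coefficient of `e^{-2πix}` in `D_z`. -/
def szegoNeg (t l1 l2 : ℝ) (z : ℂ) : Matrix (Fin 2) (Fin 2) ℂ :=
  (l2 * z / (-(1 + t ^ 2))) • !![(sq1 l1 : ℂ), (t : ℂ) ^ 2; -1, -(sq1 l1 * t ^ 2)]

/-- The coefficient of `e^{2πix}` in `D_z`. -/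
def szegoPos (t l1 l2 : ℝ) (z : ℂ) : Matrix (Fin 2) (Fin 2) ℂ :=
  (l2 * z / (-(1 + t ^ 2))) • !![-(sq1 l1 * t ^ 2 : ℂ), -1; (t : ℂ) ^ 2, (sq1 l1 : ℂ)]

/-- The constant coefficient of `D_z`. -/
def szegoZero (t l1 l2 : ℝ) (z : ℂ) : Matrix (Fin 2) (Fin 2) ℂ :=
  !![z ^ 2 + sq1 l1 * z * (2 * t * sq1 l2 / (-(1 + t ^ 2))),
     -(z * (2 * t * sq1 l2 / (-(1 + t ^ 2)))) - sq1 l1;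
     -(sq1 l1 * z ^ 2) - z * (2 * t * sq1 l2 / (-(1 + t ^ 2))),
     sq1 l1 * z * (2 * t * sq1 l2 / (-(1 + t ^ 2))) + 1]

lemma szego_eq (t l1 l2 : ℝ) (z : ℂ) (x : UnitAddCircle) :
    szego t l1 l2 z x =
      ec (-x) • szegoNeg t l1 l2 z + szegoZero t l1 l2 z + ec x • szegoPos t l1 l2 z := by
  rw [szego, szegoNeg, szegoZero, szegoPos, conj_gT, gT]
  ext i j
  fin_cases i <;> fin_cases j <;> simp <;> ring

lemma exists_factor {t l2 : ℝ} (ht : t ∈ Set.Ioo (-1 : ℝ) 1) (ht0 : t ≠ 0)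
    (hl2 : l2 ∈ Set.Ico ((1 - t ^ 2) / (1 + t ^ 2)) 1) :
    ∃ ζ₁ ζ₂ : ℂ, ‖ζ₁‖ = 1 ∧ ‖ζ₂‖ = 1 ∧ ∀ (l1 : ℝ) (x : UnitAddCircle), 0 ≤ l1 →
      wt (l1 * |t| * l2 / (1 + t ^ 2)) ζ₁ ζ₂ x = l1 * |fT t l2 x| := by
  have ht2 : 0 < 1 - t ^ 2 := by nlinarith [ht.1, ht.2]
  have hk : 0 < 1 + t ^ 2 := by positivity
  have hl0 : 0 < l2 := (div_pos ht2 hk).trans_le hl2.1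
  have hsq := sq1_sq ⟨hl0, hl2.2⟩
  have h1 : (1 - t ^ 2) ≤ l2 * (1 + t ^ 2) := by
    have := hl2.1; rwa [div_le_iff₀ hk] at this
  have h2 : ((1 - t ^ 2) * sq1 l2) ^ 2 ≤ (2 * t * l2) ^ 2 := by
    have h3 : (1 - t ^ 2) ^ 2 ≤ (l2 * (1 + t ^ 2)) ^ 2 := by gcongr
    rw [mul_pow, hsq]
    nlinarith
  set u : ℝ := (1 - t ^ 2) * sq1 l2 / (2 * t * l2) with hu
  have htl : 2 * t * l2 ≠ 0 := by positivity
  have hu1 : u ^ 2 ≤ 1 := by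
    rw [hu, div_pow]
    exact div_le_one_of_le₀ h2 (sq_nonneg _)
  set s := Real.sqrt (1 - u ^ 2) with hs
  have hs2 : s ^ 2 = 1 - u ^ 2 := Real.sq_sqrt (by linarith)
  have hnorm : ∀ e : ℝ, e ^ 2 = 1 - u ^ 2 → ‖(⟨u, e⟩ : ℂ)‖ = 1 := fun e he => by
    rw [← sq_eq_sq₀ (norm_nonneg _) (by norm_num), Complex.sq_norm, Complex.normSq_apply]
    simp only
    linarith
  refine ⟨⟨u, s⟩, ⟨u, -s⟩, hnorm _ hs2, hnorm _ (by rw [neg_sq]; exact hs2), fun l1 x hl1 => ?_⟩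
  have hprod : ec x * fT t l2 x = ((-(t * l2 / (1 + t ^ 2)) : ℝ) : ℂ) *
      ((ec x - ⟨u, s⟩) * (ec x - ⟨u, -s⟩)) := by
    have e1 : ec x * ec (-x) = 1 := by rw [← ec_add]; simp [ec_zero]
    have e2 : (ec x - ⟨u, s⟩) * (ec x - ⟨u, -s⟩) = ec x ^ 2 - (2 * u : ℝ) * ec x + 1 := by
      have e3 : (⟨u, s⟩ : ℂ) + ⟨u, -s⟩ = (2 * u : ℝ) := by
        apply Complex.ext <;> simp; ring
      have e4 : (⟨u, s⟩ : ℂ) * ⟨u, -s⟩ = 1 := by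
        apply Complex.ext
        · simp; linarith
        · simp; ring
      linear_combination (-ec x) * e3 + e4
    have e5 : t * l2 * (2 * u) = (1 - t ^ 2) * sq1 l2 := by rw [hu]; field_simp
    have e6 : (t : ℂ) * l2 * ((2 * u : ℝ) : ℂ) = (1 - t ^ 2) * sq1 l2 := by exact_mod_cast e5
    have hk' : (1 + (t : ℂ) ^ 2) ≠ 0 := by exact_mod_cast hk.ne'
    have h4 : (-1 + -(t : ℂ) ^ 2) ≠ 0 := by
      intro h; apply hk'; linear_combination -h
    rw [e2, fT_eq]
    push_cast at e6 ⊢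
    field_simp
    linear_combination (-t * l2 : ℂ) * e1 - ec x * e6
  have hn := congrArg norm hprod
  rw [norm_mul, norm_ec, one_mul, norm_mul, norm_mul, Complex.norm_real, Complex.norm_real,
    Real.norm_eq_abs, Real.norm_eq_abs, abs_neg, abs_div, abs_mul, abs_of_pos hl0,
    abs_of_pos hk] at hn
  rw [hn, wt]
  ring

lemma norm_szego_sub_le {t l1 l2 : ℝ} (hl1 : l1 ∈ Set.Ioo (0 : ℝ) 1)
    (hl2 : l2 ∈ Set.Ioo (0 : ℝ) 1) {z z' : ℂ} (hz : ‖z‖ = 1) (hz' : ‖z'‖ = 1)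
    (x : UnitAddCircle) : ‖szego t l1 l2 z' x - szego t l1 l2 z x‖ ≤ 9 * ‖z' - z‖ := by
  refine (frob_le_sum _).trans ?_
  have hg := norm_gT_le (t := t) hl2 x
  have ha : ‖(sq1 l1 : ℂ)‖ ≤ 1 := by
    rw [Complex.norm_real, Real.norm_of_nonneg (sq1_nonneg _)]; exact (sq1_lt_one hl1).le
  have hsq : ‖z' ^ 2 - z ^ 2‖ ≤ 2 * ‖z' - z‖ := by
    rw [show z' ^ 2 - z ^ 2 = (z' + z) * (z' - z) by ring, norm_mul]
    gcongr
    refine (norm_add_le _ _).trans ?_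
    rw [hz, hz']; norm_num
  have hgc : ‖(starRingEnd ℂ) (gT t l2 x)‖ ≤ 1 := by rwa [RCLike.norm_conj]
  have hag : ‖(sq1 l1 : ℂ) * gT t l2 x‖ ≤ 1 := by
    rw [norm_mul]; exact mul_le_one₀ ha (norm_nonneg _) hg
  have hagc : ‖(sq1 l1 : ℂ) * (starRingEnd ℂ) (gT t l2 x)‖ ≤ 1 := by
    rw [norm_mul]; exact mul_le_one₀ ha (norm_nonneg _) hgc
  have key : ∀ w : ℂ, ‖w‖ ≤ 1 → ‖w * (z' - z)‖ ≤ ‖z' - z‖ := fun w hw => by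
    rw [norm_mul]; exact mul_le_of_le_one_left (norm_nonneg _) hw
  have h1 := key _ hg
  have h2 := key _ hgc
  have h3 := key _ hag
  have h4 := key _ hagc
  have h5 : ‖(sq1 l1 : ℂ) * (z' ^ 2 - z ^ 2)‖ ≤ 2 * ‖z' - z‖ := by
    rw [norm_mul]
    exact (mul_le_of_le_one_left (norm_nonneg _) ha).trans hsq
  have e1 : ‖(szego t l1 l2 z' x - szego t l1 l2 z x) 0 0‖ ≤ 3 * ‖z' - z‖ := by
    have : (szego t l1 l2 z' x - szego t l1 l2 z x) 0 0 =
        (z' ^ 2 - z ^ 2) + (sq1 l1 : ℂ) * gT t l2 x * (z' - z) := by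
      simp [szego]; ring
    rw [this]
    linarith [norm_add_le (z' ^ 2 - z ^ 2) ((sq1 l1 : ℂ) * gT t l2 x * (z' - z))]
  have e2 : ‖(szego t l1 l2 z' x - szego t l1 l2 z x) 0 1‖ ≤ ‖z' - z‖ := by
    have : (szego t l1 l2 z' x - szego t l1 l2 z x) 0 1 =
        -((starRingEnd ℂ) (gT t l2 x) * (z' - z)) := by
      simp [szego]; ring
    rw [this, norm_neg]
    exact h2
  have e3 : ‖(szego t l1 l2 z' x - szego t l1 l2 z x) 1 0‖ ≤ 3 * ‖z' - z‖ := by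
    have : (szego t l1 l2 z' x - szego t l1 l2 z x) 1 0 =
        -((sq1 l1 : ℂ) * (z' ^ 2 - z ^ 2) + gT t l2 x * (z' - z)) := by
      simp [szego]; ring
    rw [this, norm_neg]
    linarith [norm_add_le ((sq1 l1 : ℂ) * (z' ^ 2 - z ^ 2)) (gT t l2 x * (z' - z))]
  have e4 : ‖(szego t l1 l2 z' x - szego t l1 l2 z x) 1 1‖ ≤ ‖z' - z‖ := by
    have : (szego t l1 l2 z' x - szego t l1 l2 z x) 1 1 =
        (sq1 l1 : ℂ) * (starRingEnd ℂ) (gT t l2 x) * (z' - z) := by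
      simp [szego]; ring
    rw [this]
    exact h4
  linarith [norm_nonneg (z' - z)]

lemma isTrigCocycle_szego {t l1 l2 : ℝ} (ht : t ∈ Set.Ioo (-1 : ℝ) 1) (ht0 : t ≠ 0)
    (hl1 : l1 ∈ Set.Ioo (0 : ℝ) 1) (hl2 : l2 ∈ Set.Ioo (0 : ℝ) 1) {ζ₁ ζ₂ z : ℂ}
    (h1 : ‖ζ₁‖ = 1) (h2 : ‖ζ₂‖ = 1)
    (hw : ∀ x, wt (l1 * |t| * l2 / (1 + t ^ 2)) ζ₁ ζ₂ x = l1 * |fT t l2 x|) (hz : ‖z‖ = 1) :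
    IsTrigCocycle (l1 * |t| * l2 / (1 + t ^ 2)) 36 ζ₁ ζ₂ (szego t l1 l2 z) where
  c_pos := by have := hl1.1; have := hl2.1; positivity
  one_le := by norm_num
  norm_one := h1
  norm_two := h2
  coeff := by
    have ha : ‖(sq1 l1 : ℂ)‖ ≤ 1 := by
      rw [Complex.norm_real, Real.norm_of_nonneg (sq1_nonneg _)]; exact (sq1_lt_one hl1).le
    have hk : (0 : ℝ) < 1 + t ^ 2 := by positivity
    have hk' : ‖(-(1 + (t : ℂ) ^ 2))‖ = 1 + t ^ 2 := by
      rw [norm_neg, show (1 + (t : ℂ) ^ 2) = ((1 + t ^ 2 : ℝ) : ℂ) by push_cast; ring,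
        Complex.norm_real, Real.norm_of_nonneg hk.le]
    have ht2 : ‖(t : ℂ) ^ 2‖ ≤ 1 := by
      rw [norm_pow, Complex.norm_real, Real.norm_eq_abs, sq_abs]; nlinarith [ht.1, ht.2]
    have hat : ‖(sq1 l1 : ℂ) * t ^ 2‖ ≤ 1 := by
      rw [norm_mul]; exact mul_le_one₀ ha (norm_nonneg _) ht2
    have hpre : ‖(l2 * z / (-(1 + (t : ℂ) ^ 2)))‖ ≤ 1 := by
      rw [norm_div, norm_mul, hz, hk', Complex.norm_real, Real.norm_of_nonneg hl2.1.le, mul_one]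
      exact div_le_one_of_le₀ (by nlinarith [hl2.2]) hk.le
    have hb : ‖(2 * t * sq1 l2 / (-(1 + (t : ℂ) ^ 2)))‖ ≤ 2 := by
      rw [norm_div, hk', div_le_iff₀ hk, norm_mul, norm_mul, Complex.norm_real, Complex.norm_real,
        Real.norm_of_nonneg (sq1_nonneg _), Complex.norm_ofNat, Real.norm_eq_abs]
      have e1 := (sq1_lt_one hl2).le
      have e2 : |t| ≤ 1 := abs_le.2 ⟨ht.1.le, ht.2.le⟩
      have e3 := mul_le_one₀ e2 (sq1_nonneg _) e1
      nlinarith [sq_nonneg t]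
    have hzb : ‖z * (2 * t * sq1 l2 / (-(1 + (t : ℂ) ^ 2)))‖ ≤ 2 := by
      rw [norm_mul, hz, one_mul]; exact hb
    have hazb : ‖sq1 l1 * z * (2 * t * sq1 l2 / (-(1 + (t : ℂ) ^ 2)))‖ ≤ 2 := by
      rw [mul_assoc, norm_mul]
      exact (mul_le_of_le_one_left (norm_nonneg _) ha).trans hzb
    have haz : ‖(sq1 l1 : ℂ) * z ^ 2‖ ≤ 1 := by
      rw [norm_mul, norm_pow, hz, one_pow, mul_one]; exact ha
    have hz2 : ‖z ^ 2‖ = 1 := by rw [norm_pow, hz, one_pow]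
    refine ⟨szegoNeg t l1 l2 z, szegoZero t l1 l2 z, szegoPos t l1 l2 z, ?_, ?_, ?_,
      szego_eq t l1 l2 z⟩
    · rw [szegoNeg, frob_smul]
      have h4 := frob_le_sum !![(sq1 l1 : ℂ), (t : ℂ) ^ 2; -1, -(sq1 l1 * t ^ 2)]
      simp only [Matrix.of_apply, Matrix.cons_val', Matrix.cons_val_zero, Matrix.cons_val_one,
        Matrix.cons_val_fin_one, norm_neg, norm_one] at h4
      refine (mul_le_of_le_one_left (norm_nonneg _) hpre).trans ?_
      linarith
    · rw [szegoZero]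
      refine (frob_le_sum _).trans ?_
      simp only [Matrix.of_apply, Matrix.cons_val', Matrix.cons_val_zero, Matrix.cons_val_one,
        Matrix.cons_val_fin_one]
      set b : ℂ := 2 * t * sq1 l2 / (-(1 + (t : ℂ) ^ 2))
      have h4 := norm_add_le (z ^ 2) (sq1 l1 * z * b)
      have h5 := norm_sub_le (-(z * b)) (sq1 l1 : ℂ)
      have h6 := norm_sub_le (-(sq1 l1 * z ^ 2)) (z * b)
      have h7 := norm_add_le (sq1 l1 * z * b) 1
      rw [norm_neg] at h5 h6
      rw [norm_one] at h7
      linarith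
    · rw [szegoPos, frob_smul]
      have h4 := frob_le_sum !![-(sq1 l1 * t ^ 2 : ℂ), -1; (t : ℂ) ^ 2, (sq1 l1 : ℂ)]
      simp only [Matrix.of_apply, Matrix.cons_val', Matrix.cons_val_zero, Matrix.cons_val_one,
        Matrix.cons_val_fin_one, norm_neg, norm_one] at h4
      refine (mul_le_of_le_one_left (norm_nonneg _) hpre).trans ?_
      linarith
  det := fun x => by
    rw [det_szego hl1 hl2, norm_pow, hw, norm_mul, norm_mul, hz, one_mul, Complex.norm_real,
      Complex.norm_real, Real.norm_of_nonneg hl1.1.le, Real.norm_eq_abs]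

lemma exists_entry_poly {A : UnitAddCircle → Matrix (Fin 2) (Fin 2) ℂ}
    {M₀ M₁ M₂ : Matrix (Fin 2) (Fin 2) ℂ}
    (hA : ∀ x, A x = ec (-x) • M₀ + M₁ + ec x • M₂) (α : ℝ) (n : ℕ) :
    ∃ P : Fin 2 → Fin 2 → Polynomial ℂ, (∀ i j, (P i j).natDegree ≤ 2 * n) ∧
      (∀ i j x, ec x ^ n * ct α A n x i j = (P i j).eval (ec x)) ∧
      ∃ u v : ℂ, ‖u‖ = 1 ∧ ‖v‖ = 1 ∧ (∀ i j, (P i j).coeff 0 = u * (M₀ ^ n) i j) ∧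
        ∀ i j, (P i j).coeff (2 * n) = v * (M₂ ^ n) i j := by
  induction n with
  | zero =>
    refine ⟨fun i j => Polynomial.C ((1 : Matrix (Fin 2) (Fin 2) ℂ) i j), by simp, by simp [ct],
      1, 1, by simp, by simp, by simp, by simp⟩
  | succ n ih =>
    obtain ⟨P, hd, hP, u, v, hu, hv, h0, h2⟩ := ih
    set e : ℂ := ec (n • (α : UnitAddCircle)) with he
    have he0 : e ≠ 0 := ec_ne_zero _
    let T : Fin 2 → Fin 2 → Polynomial ℂ := fun i k =>
      Polynomial.C (e⁻¹ * M₀ i k) + Polynomial.C (M₁ i k) * Polynomial.X +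
        Polynomial.C (e * M₂ i k) * Polynomial.X ^ 2
    have hTd : ∀ i k, (T i k).natDegree ≤ 2 := fun i k => by
      simp only [T]; compute_degree
    have hT0 : ∀ i k, (T i k).coeff 0 = e⁻¹ * M₀ i k := fun i k => by simp [T]
    have hT2 : ∀ i k, (T i k).coeff 2 = e * M₂ i k := fun i k => by
      simp [T, -map_mul]
    have hTe : ∀ i k x, (T i k).eval (ec x) = ec x * A (x + n • (α : UnitAddCircle)) i k := by
      intro i k x
      have hx := ec_ne_zero x
      rw [hA]
      simp only [T, Polynomial.eval_add, Polynomial.eval_mul, Polynomial.eval_C,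
        Polynomial.eval_X, Polynomial.eval_pow, Matrix.add_apply, Matrix.smul_apply, smul_eq_mul,
        ec_neg, ec_add, ← he]
      field_simp
    refine ⟨fun i j => ∑ k, T i k * P k j, fun i j => ?_, fun i j x => ?_, e⁻¹ * u, e * v, ?_, ?_,
      fun i j => ?_, fun i j => ?_⟩
    · refine Polynomial.natDegree_sum_le_of_forall_le _ _ fun k _ => ?_
      refine Polynomial.natDegree_mul_le.trans ?_
      have := hTd i k
      have := hd k j
      omega
    · simp only [ct, Matrix.mul_apply, Fin.sum_univ_two, Polynomial.eval_add, Polynomial.eval_mul,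
        hTe, ← hP]
      ring
    · rw [norm_mul, norm_inv, he, norm_ec, hu]; norm_num
    · rw [norm_mul, he, norm_ec, hv]; norm_num
    · simp only [Fin.sum_univ_two, Polynomial.coeff_add, Polynomial.mul_coeff_zero, hT0, h0,
        pow_succ', Matrix.mul_apply]
      ring
    · have h3 : ∀ k, (T i k * P k j).coeff (2 * (n + 1)) = e * M₂ i k * (v * (M₂ ^ n) k j) := by
        intro k
        rw [← hT2, ← h2, ← Polynomial.coeff_mul_add_eq_of_natDegree_le (hTd i k) (hd k j)]
        congr 1
        ring
      simp only [Fin.sum_univ_two, Polynomial.coeff_add, h3, pow_succ', Matrix.mul_apply]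
      ring

lemma exists_trace_poly {A : UnitAddCircle → Matrix (Fin 2) (Fin 2) ℂ}
    {M₀ M₁ M₂ : Matrix (Fin 2) (Fin 2) ℂ}
    (hA : ∀ x, A x = ec (-x) • M₀ + M₁ + ec x • M₂) (α : ℝ) (n : ℕ) :
    ∃ R : Polynomial ℂ, R.natDegree ≤ 2 * n ∧
      (∀ x, ec x ^ n * (ct α A n x).trace = R.eval (ec x)) ∧
      ‖R.coeff 0‖ = ‖(M₀ ^ n).trace‖ ∧ ‖R.coeff (2 * n)‖ = ‖(M₂ ^ n).trace‖ := by
  obtain ⟨P, hd, hP, u, v, hu, hv, h0, h2⟩ := exists_entry_poly hA α n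
  refine ⟨P 0 0 + P 1 1, Polynomial.natDegree_add_le_of_degree_le (hd _ _) (hd _ _), fun x => ?_,
    ?_, ?_⟩
  · rw [Polynomial.eval_add, ← hP, ← hP, Matrix.trace_fin_two]; ring
  · rw [Polynomial.coeff_add, h0, h0, Matrix.trace_fin_two, ← mul_add, norm_mul, hu, one_mul]
  · rw [Polynomial.coeff_add, h2, h2, Matrix.trace_fin_two, ← mul_add, norm_mul, hv, one_mul]

lemma trace_pow_eq (M : Matrix (Fin 2) (Fin 2) ℂ) {μ ν : ℂ} (h1 : M.trace = μ + ν)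
    (h2 : M.det = μ * ν) (n : ℕ) : (M ^ n).trace = μ ^ n + ν ^ n := by
  have hM : M ^ 2 = (μ + ν) • M - (μ * ν) • (1 : Matrix (Fin 2) (Fin 2) ℂ) := by
    rw [← h1, ← h2, Matrix.trace_fin_two, Matrix.det_fin_two, pow_two]
    ext i j
    fin_cases i <;> fin_cases j <;> simp [Matrix.mul_apply, Fin.sum_univ_two] <;> ring
  induction n using Nat.twoStepInduction with
  | zero => simp; norm_num
  | one => simp [h1]
  | more n ih1 ih2 =>
    have : M ^ (n + 2) = (μ + ν) • M ^ (n + 1) - (μ * ν) • M ^ n := by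
      rw [pow_add, hM, mul_sub, Matrix.mul_smul, Matrix.mul_smul, mul_one, ← pow_succ]
    rw [this, Matrix.trace_sub, Matrix.trace_smul, Matrix.trace_smul, ih1, ih2]
    simp only [smul_eq_mul]
    ring

lemma norm_trace_le (M : Matrix (Fin 2) (Fin 2) ℂ) : ‖M.trace‖ ≤ 2 * ‖M‖ := by
  rw [Matrix.trace_fin_two]
  have h1 := frob_entry_le M 0 0
  have h2 := frob_entry_le M 1 1
  linarith [norm_add_le (M 0 0) (M 1 1)]

lemma trace_ct_add {A : UnitAddCircle → Matrix (Fin 2) (Fin 2) ℂ} {α : ℝ} {q : ℕ} (hq : 0 < q)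
    (hα : q • (α : UnitAddCircle) = 0) (x : UnitAddCircle) :
    (ct α A q (x + (α : UnitAddCircle))).trace = (ct α A q x).trace := by
  obtain ⟨m, rfl⟩ : ∃ m, q = m + 1 := ⟨q - 1, by omega⟩
  rw [ct_add α A m 1 x, one_smul, Matrix.trace_mul_comm]
  have h1 : x + (α : UnitAddCircle) + m • (α : UnitAddCircle) = x := by
    rw [add_assoc, add_comm (α : UnitAddCircle), ← succ_nsmul, hα, add_zero]
  simp [ct, h1]

lemma infinite_range_ec : (Set.range ec).Infinite := by
  intro h
  have : ∀ᵐ x : UnitAddCircle, ∀ r ∈ h.toFinset, ec x ≠ r := by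
    rw [Filter.eventually_all_finset]
    exact fun r _ => ae_ec_ne r
  obtain ⟨x, hx⟩ := this.exists
  exact hx (ec x) (by simp) rfl

/-- Chambers' formula: over a rational rotation the trace depends on the phase only through
two extreme Fourier coefficients. -/
lemma norm_trace_sub_le {A : UnitAddCircle → Matrix (Fin 2) (Fin 2) ℂ}
    {M₀ M₁ M₂ : Matrix (Fin 2) (Fin 2) ℂ}
    (hA : ∀ x, A x = ec (-x) • M₀ + M₁ + ec x • M₂) {p : ℤ} {q : ℕ} (hq : 0 < q)
    (hpq : IsCoprime p q) (x y : UnitAddCircle) :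
    ‖(ct (p / q : ℝ) A q x).trace - (ct (p / q : ℝ) A q y).trace‖ ≤
      2 * (‖(M₀ ^ q).trace‖ + ‖(M₂ ^ q).trace‖) := by
  obtain ⟨R, hd, hR, h0, h2⟩ := exists_trace_poly hA (p / q : ℝ) q
  set ω : ℂ := ec ((p / q : ℝ) : UnitAddCircle) with hω
  have hprim : IsPrimitiveRoot ω q := by
    have := Complex.isPrimitiveRoot_exp_of_isCoprime p q hq.ne' hpq
    convert this using 1
    rw [hω, ec_coe]
    push_cast
    congr 1
    ring
  have hα : q • (((p / q : ℝ)) : UnitAddCircle) = 0 := by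
    rw [nsmul_coe_eq, mul_div_cancel₀ _ (by exact_mod_cast hq.ne')]
    have : ((p : ℤ) • (1 : ℝ) : ℝ) = p := by simp
    rw [← this, AddCircle.coe_zsmul, AddCircle.coe_period, smul_zero]
  have hinv : R.comp (Polynomial.C ω * Polynomial.X) = R := by
    refine Polynomial.eq_of_infinite_eval_eq _ _ (infinite_range_ec.mono ?_)
    rintro _ ⟨w, rfl⟩
    simp only [Set.mem_ofPred_eq, Polynomial.eval_comp, Polynomial.eval_mul, Polynomial.eval_C,
      Polynomial.eval_X]
    rw [← hR w, ← trace_ct_add hq hα w, mul_comm ω, hω, ← ec_add, ← hR, ec_add, mul_pow, ← hω,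
      hprim.pow_eq_one, mul_one]
  have hcoef : ∀ j, ¬ q ∣ j → R.coeff j = 0 := by
    intro j hj
    have h3 : (R.comp (Polynomial.C ω * Polynomial.X)).coeff j = R.coeff j := by rw [hinv]
    rw [Polynomial.comp_C_mul_X_coeff] at h3
    by_contra h4
    exact hj ((hprim.pow_eq_one_iff_dvd j).1 (mul_left_cancel₀ h4 (by rw [h3, mul_one])))
  have heval : ∀ w : ℂ, R.eval w =
      R.coeff 0 + R.coeff q * w ^ q + R.coeff (2 * q) * w ^ (2 * q) := by
    intro w
    rw [Polynomial.eval_eq_sum_range' (show R.natDegree < 2 * q + 1 by omega)]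
    have hsub : ({0, q, 2 * q} : Finset ℕ) ⊆ Finset.range (2 * q + 1) := by
      intro j hj
      simp only [Finset.mem_insert, Finset.mem_singleton] at hj
      rw [Finset.mem_range]
      omega
    rw [← Finset.sum_subset hsub]
    · rw [Finset.sum_insert, Finset.sum_insert, Finset.sum_singleton]
      · ring
      · simp; omega
      · simp; omega
    · intro j hj hj'
      rw [hcoef j, zero_mul]
      rintro ⟨m, rfl⟩
      rw [Finset.mem_range] at hj
      have hm : m < 3 := by
        by_contra! h
        have : q * 3 ≤ q * m := Nat.mul_le_mul_left _ h
        omega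
      apply hj'
      interval_cases m <;> simp [mul_comm]
  have htr : ∀ w : UnitAddCircle, (ct (p / q : ℝ) A q w).trace =
      R.coeff 0 * (ec w ^ q)⁻¹ + R.coeff q + R.coeff (2 * q) * ec w ^ q := by
    intro w
    have hw : ec w ^ q ≠ 0 := pow_ne_zero _ (ec_ne_zero w)
    apply mul_left_cancel₀ hw
    rw [hR, heval]
    field_simp
    ring
  have hn : ∀ w : UnitAddCircle, ‖ec w ^ q‖ = 1 := fun w => by rw [norm_pow, norm_ec, one_pow]
  have hfin : (ct (p / q : ℝ) A q x).trace - (ct (p / q : ℝ) A q y).trace =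
      R.coeff 0 * ((ec x ^ q)⁻¹ - (ec y ^ q)⁻¹) + R.coeff (2 * q) * (ec x ^ q - ec y ^ q) := by
    rw [htr, htr]; ring
  rw [hfin]
  refine (norm_add_le _ _).trans ?_
  rw [norm_mul, norm_mul, h0, h2]
  have e1 : ‖(ec x ^ q)⁻¹ - (ec y ^ q)⁻¹‖ ≤ 2 := by
    refine (norm_sub_le _ _).trans ?_
    rw [norm_inv, norm_inv, hn, hn]; norm_num
  have e2 : ‖ec x ^ q - ec y ^ q‖ ≤ 2 := by
    refine (norm_sub_le _ _).trans ?_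
    rw [hn, hn]; norm_num
  have e3 := mul_le_mul_of_nonneg_left e1 (norm_nonneg (M₀ ^ q).trace)
  have e4 := mul_le_mul_of_nonneg_left e2 (norm_nonneg (M₂ ^ q).trace)
  linarith

lemma integrable_log_poly (R : Polynomial ℂ) :
    Integrable fun x : UnitAddCircle => Real.log ‖R.eval (ec x)‖ := by
  refine integrable_ec (h := fun w => Real.log ‖R.eval w‖) ?_ ?_
  · exact Real.measurable_log.comp R.continuous.measurable.norm
  · exact Polynomial.intervalIntegrable_mahlerMeasure R

lemma log_norm_leadingCoeff_le (R : Polynomial ℂ) :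
    Real.log ‖R.leadingCoeff‖ ≤ ∫ x : UnitAddCircle, Real.log ‖R.eval (ec x)‖ := by
  rw [integral_ec fun w => Real.log ‖R.eval w‖, ← Polynomial.logMahlerMeasure_def,
    Polynomial.logMahlerMeasure_eq_log_leadingCoeff_add_sum_log_roots]
  have : 0 ≤ (R.roots.map fun a => Real.posLog ‖a‖).sum := by
    refine Multiset.sum_nonneg fun a ha => ?_
    obtain ⟨b, -, rfl⟩ := Multiset.mem_map.1 ha
    exact Real.posLog_nonneg
  linarith

lemma ae_eval_ec_ne_zero {R : Polynomial ℂ} (hR : R ≠ 0) :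
    ∀ᵐ x : UnitAddCircle, R.eval (ec x) ≠ 0 := by
  have : ∀ᵐ x : UnitAddCircle, ∀ r ∈ R.roots.toFinset, ec x ≠ r := by
    rw [Filter.eventually_all_finset]
    exact fun r _ => ae_ec_ne r
  filter_upwards [this] with x hx h
  exact hx (ec x) (by simp [hR, h]) rfl

lemma log_norm_trace_pow_le {c B : ℝ} {ζ₁ ζ₂ : ℂ}
    {A : UnitAddCircle → Matrix (Fin 2) (Fin 2) ℂ} (H : IsTrigCocycle c B ζ₁ ζ₂ A)
    {M₀ M₁ M₂ : Matrix (Fin 2) (Fin 2) ℂ}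
    (hA : ∀ x, A x = ec (-x) • M₀ + M₁ + ec x • M₂) (α : ℝ) (n : ℕ)
    (hne : (M₂ ^ n).trace ≠ 0) :
    Real.log ‖(M₂ ^ n).trace‖ ≤ Real.log 2 + lI α A n := by
  obtain ⟨R, hd, hR, -, h2⟩ := exists_trace_poly hA α n
  have hc : R.coeff (2 * n) ≠ 0 := by
    rw [← norm_ne_zero_iff, h2, norm_ne_zero_iff]; exact hne
  have hR0 : R ≠ 0 := fun h => hc (by rw [h, Polynomial.coeff_zero])
  have hdeg : R.natDegree = 2 * n :=
    le_antisymm hd (Polynomial.le_natDegree_of_ne_zero hc)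
  have h3 := log_norm_leadingCoeff_le R
  rw [Polynomial.leadingCoeff, hdeg, h2] at h3
  refine h3.trans ?_
  have h4 : Real.log 2 + lI α A n = ∫ x, (Real.log 2 + lphi α A n x) := by
    rw [integral_add (integrable_const _) (H.integrable_lphi α n)]; simp [lI]
  rw [h4]
  refine integral_mono_ae (integrable_log_poly R)
    ((integrable_const _).add (H.integrable_lphi α n)) ?_
  filter_upwards [ae_eval_ec_ne_zero hR0] with x hx
  have h5 : ‖R.eval (ec x)‖ ≤ 2 * ‖ct α A n x‖ := by
    rw [← hR, norm_mul, norm_pow, norm_ec, one_pow, one_mul]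
    exact norm_trace_le _
  have h6 : 0 < ‖R.eval (ec x)‖ := norm_pos_iff.2 hx
  have h7 : 0 < ‖ct α A n x‖ := by linarith
  simp only [lphi]
  rw [← Real.log_mul (by norm_num) h7.ne']
  exact Real.log_le_log h6 h5

lemma trace_szegoNeg (t l1 l2 : ℝ) (z : ℂ) : (szegoNeg t l1 l2 z).trace =
    (l2 * z / (-(1 + t ^ 2))) * (sq1 l1 * (1 - t ^ 2)) := by
  rw [szegoNeg, Matrix.trace_smul, Matrix.trace_fin_two_of, smul_eq_mul]; ring

lemma trace_szegoPos (t l1 l2 : ℝ) (z : ℂ) : (szegoPos t l1 l2 z).trace =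
    (l2 * z / (-(1 + t ^ 2))) * (sq1 l1 * (1 - t ^ 2)) := by
  rw [szegoPos, Matrix.trace_smul, Matrix.trace_fin_two_of, smul_eq_mul]; ring

lemma det_szegoNeg (t l2 : ℝ) {l1 : ℝ} (hl1 : l1 ∈ Set.Ioo (0 : ℝ) 1) (z : ℂ) :
    (szegoNeg t l1 l2 z).det = (l2 * z / (-(1 + t ^ 2))) ^ 2 * (t * l1) ^ 2 := by
  have h : (sq1 l1 : ℂ) ^ 2 = 1 - (l1 : ℂ) ^ 2 := by exact_mod_cast sq1_sq hl1
  rw [szegoNeg, Matrix.det_smul, Matrix.det_fin_two_of, Fintype.card_fin]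
  linear_combination (-(l2 * z / (-(1 + t ^ 2))) ^ 2 * t ^ 2 : ℂ) * h

lemma det_szegoPos (t l2 : ℝ) {l1 : ℝ} (hl1 : l1 ∈ Set.Ioo (0 : ℝ) 1) (z : ℂ) :
    (szegoPos t l1 l2 z).det = (l2 * z / (-(1 + t ^ 2))) ^ 2 * (t * l1) ^ 2 := by
  have h : (sq1 l1 : ℂ) ^ 2 = 1 - (l1 : ℂ) ^ 2 := by exact_mod_cast sq1_sq hl1
  rw [szegoPos, Matrix.det_smul, Matrix.det_fin_two_of, Fintype.card_fin]
  linear_combination (-(l2 * z / (-(1 + t ^ 2))) ^ 2 * t ^ 2 : ℂ) * h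

lemma le_of_log_sub_le {L r C : ℝ} {a : ℕ → ℝ}
    (ha : Filter.Tendsto (fun n : ℕ => a n / n) Filter.atTop (nhds L))
    (h : ∀ n : ℕ, n * r ≤ C + a n) : r ≤ L := by
  have h1 : Filter.Tendsto (fun n : ℕ => C / n + a n / n) Filter.atTop (nhds (0 + L)) :=
    (tendsto_const_div_atTop_nhds_zero_nat C).add ha
  rw [zero_add] at h1
  refine ge_of_tendsto h1 ?_
  filter_upwards [Filter.eventually_gt_atTop 0] with n hn
  have hn' : (0 : ℝ) < n := by exact_mod_cast hn
  rw [← add_div, le_div_iff₀ hn']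
  linarith [h n]

/-- The exponential growth rate `R` of the traces of the powers of the extreme Fourier
coefficients. -/
lemma exists_rate {t l1 l2 : ℝ} (ht : t ∈ Set.Ioo (-1 : ℝ) 1) (ht0 : t ≠ 0)
    (hl1 : l1 ∈ Set.Ioo (0 : ℝ) 1) (hl2 : l2 ∈ Set.Ioo (0 : ℝ) 1) {z : ℂ} {ζ₁ ζ₂ : ℂ}
    {c B : ℝ} (hc : c = l1 * |t| * l2 / (1 + t ^ 2)) (hz : ‖z‖ = 1)
    (H : IsTrigCocycle c B ζ₁ ζ₂ (szego t l1 l2 z)) :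
    ∃ R : ℝ, c ≤ R ∧ (∀ z' : ℂ, ‖z'‖ = 1 → ∀ n : ℕ, ‖(szegoNeg t l1 l2 z' ^ n).trace‖ ≤ 2 * R ^ n ∧
      ‖(szegoPos t l1 l2 z' ^ n).trace‖ ≤ 2 * R ^ n) ∧
      (∀ α L : ℝ, Filter.Tendsto (fun n : ℕ => lI α (szego t l1 l2 z) n / n) Filter.atTop
        (nhds L) → Real.log R ≤ L) ∧
      ((1 - t ^ 2) / (1 + t ^ 2) ≤ l1 → Real.log R - Real.log c = 0) ∧
      (l1 < (1 - t ^ 2) / (1 + t ^ 2) → Real.log R - Real.log c =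
        Real.log (((1 - t ^ 2) * sq1 l1 +
          Real.sqrt ((1 + t ^ 2) ^ 2 * (sq1 l1) ^ 2 - 4 * t ^ 2)) / (2 * |t| * l1))) := by
  have hk : 0 < 1 + t ^ 2 := by positivity
  have ht2 : 0 < 1 - t ^ 2 := by nlinarith [ht.1, ht.2]
  have hl10 := hl1.1
  have hl20 := hl2.1
  have hcpos := H.c_pos
  have hs : ∀ z' : ℂ, ‖z'‖ = 1 → ‖(l2 * z' / (-(1 + (t : ℂ) ^ 2)))‖ = l2 / (1 + t ^ 2) := by
    intro z' hz'
    have hk' : ‖(-(1 + (t : ℂ) ^ 2))‖ = 1 + t ^ 2 := by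
      rw [norm_neg, show (1 + (t : ℂ) ^ 2) = ((1 + t ^ 2 : ℝ) : ℂ) by push_cast; ring,
        Complex.norm_real, Real.norm_of_nonneg hk.le]
    rw [norm_div, norm_mul, hz', hk', Complex.norm_real, Real.norm_of_nonneg hl20.le, mul_one]
  have hasq := sq1_sq hl1
  have ha0 := sq1_nonneg l1
  set a := sq1 l1 with ha
  by_cases hcase : (1 - t ^ 2) / (1 + t ^ 2) ≤ l1
  · refine ⟨c, le_rfl, fun z' hz' n => ?_, fun α L hL => ?_, fun _ => sub_self _,
      fun h => absurd h (not_lt.2 hcase)⟩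
    · set m : ℝ := a * (1 - t ^ 2) / 2 with hm
      have hdisc : m ^ 2 ≤ (t * l1) ^ 2 := by
        rw [div_le_iff₀ hk] at hcase
        have e1 : (1 - t ^ 2) ^ 2 ≤ (l1 * (1 + t ^ 2)) ^ 2 := by gcongr
        rw [hm, div_pow, mul_pow, hasq]
        nlinarith
      set d : ℝ := Real.sqrt ((t * l1) ^ 2 - m ^ 2) with hd
      have hd2 : d ^ 2 = (t * l1) ^ 2 - m ^ 2 := Real.sq_sqrt (by linarith)
      have hnorm : ∀ e : ℝ, e ^ 2 = (t * l1) ^ 2 - m ^ 2 → ‖(⟨m, e⟩ : ℂ)‖ = |t| * l1 := by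
        intro e he
        rw [← sq_eq_sq₀ (norm_nonneg _) (by positivity), Complex.sq_norm, Complex.normSq_apply,
          mul_pow, sq_abs]
        simp only
        linarith
      have hsum : (⟨m, d⟩ : ℂ) + ⟨m, -d⟩ = a * (1 - t ^ 2) := by
        have : (a * (1 - t ^ 2) : ℂ) = ((2 * m : ℝ) : ℂ) := by rw [hm]; push_cast; ring
        rw [this]
        apply Complex.ext <;> simp; ring
      have hmul : (⟨m, d⟩ : ℂ) * ⟨m, -d⟩ = (t * l1) ^ 2 := by
        have : ((t * l1) ^ 2 : ℂ) = (((t * l1) ^ 2 : ℝ) : ℂ) := by push_cast; ring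
        rw [this]
        apply Complex.ext
        · simp only [Complex.mul_re, Complex.ofReal_re]; linarith
        · simp only [Complex.mul_im, Complex.ofReal_im]; ring
      set s : ℂ := l2 * z' / (-(1 + (t : ℂ) ^ 2)) with hsdef
      have hbound : ∀ e : ℝ, e ^ 2 = (t * l1) ^ 2 - m ^ 2 → ‖s * ⟨m, e⟩‖ = c := by
        intro e he
        rw [norm_mul, hs z' hz', hnorm e he, hc]; ring
      have hd2' : (-d) ^ 2 = (t * l1) ^ 2 - m ^ 2 := by rw [neg_sq, hd2]
      have hfin : ‖(s * ⟨m, d⟩) ^ n + (s * ⟨m, -d⟩) ^ n‖ ≤ 2 * c ^ n := by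
        refine (norm_add_le _ _).trans ?_
        rw [norm_pow, norm_pow, hbound d hd2, hbound _ hd2']
        linarith
      constructor
      · rw [trace_pow_eq _ (μ := s * ⟨m, d⟩) (ν := s * ⟨m, -d⟩)]
        · exact hfin
        · rw [trace_szegoNeg, ← mul_add, hsum]
        · rw [det_szegoNeg t l2 hl1]; linear_combination (-s ^ 2) * hmul
      · rw [trace_pow_eq _ (μ := s * ⟨m, d⟩) (ν := s * ⟨m, -d⟩)]
        · exact hfin
        · rw [trace_szegoPos, ← mul_add, hsum]
        · rw [det_szegoPos t l2 hl1]; linear_combination (-s ^ 2) * hmul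
    · obtain ⟨L', h1, -, h3⟩ := H.exists_lyap α
      rwa [tendsto_nhds_unique hL h1]
  · push Not at hcase
    set m : ℝ := a * (1 - t ^ 2) / 2 with hm
    have hm0 : 0 ≤ m := by positivity
    have hdisc : (t * l1) ^ 2 ≤ m ^ 2 := by
      have h1 := hcase
      rw [lt_div_iff₀ hk] at h1
      have e1 : (l1 * (1 + t ^ 2)) ^ 2 ≤ (1 - t ^ 2) ^ 2 := by gcongr
      rw [hm, div_pow, mul_pow a, hasq]
      nlinarith
    set d : ℝ := Real.sqrt (m ^ 2 - (t * l1) ^ 2) with hd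
    have hd0 : 0 ≤ d := Real.sqrt_nonneg _
    have hd2 : d ^ 2 = m ^ 2 - (t * l1) ^ 2 := Real.sq_sqrt (by linarith)
    have hdm : d ≤ m := by
      refine abs_le_of_sq_le_sq' ?_ hm0 |>.2
      rw [hd2]; linarith [sq_nonneg (t * l1)]
    have hρ : |t| * l1 ≤ m + d := by
      have : |t| * l1 ≤ m := by
        refine abs_le_of_sq_le_sq' ?_ hm0 |>.2
        rw [mul_pow, sq_abs, ← mul_pow]; exact hdisc
      linarith
    have htpos : 0 < |t| := abs_pos.2 ht0
    have hρ0 : 0 < m + d := lt_of_lt_of_le (by positivity) hρ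
    set R : ℝ := l2 / (1 + t ^ 2) * (m + d) with hR
    have hR0 : 0 < R := by positivity
    have hcR : c = l2 / (1 + t ^ 2) * (|t| * l1) := by rw [hc]; ring
    have hsum : ((m + d : ℝ) : ℂ) + ((m - d : ℝ) : ℂ) = a * (1 - t ^ 2) := by
      rw [hm]; push_cast; ring
    have hmul : ((m + d : ℝ) : ℂ) * ((m - d : ℝ) : ℂ) = (t * l1) ^ 2 := by
      have : (m + d) * (m - d) = (t * l1) ^ 2 := by ring_nf; rw [hd2]; ring
      exact_mod_cast this
    have htr : ∀ (z' : ℂ) (n : ℕ),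
        (szegoNeg t l1 l2 z' ^ n).trace =
          (l2 * z' / (-(1 + (t : ℂ) ^ 2))) ^ n * (((m + d) ^ n + (m - d) ^ n : ℝ) : ℂ) ∧
        (szegoPos t l1 l2 z' ^ n).trace =
          (l2 * z' / (-(1 + (t : ℂ) ^ 2))) ^ n * (((m + d) ^ n + (m - d) ^ n : ℝ) : ℂ) := by
      intro z' n
      set s : ℂ := l2 * z' / (-(1 + (t : ℂ) ^ 2)) with hsdef
      constructor
      · rw [trace_pow_eq _ (μ := s * (m + d : ℝ)) (ν := s * (m - d : ℝ))]
        · rw [mul_pow, mul_pow]; push_cast; ring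
        · rw [trace_szegoNeg, ← mul_add, hsum]
        · rw [det_szegoNeg t l2 hl1]; linear_combination (-s ^ 2) * hmul
      · rw [trace_pow_eq _ (μ := s * (m + d : ℝ)) (ν := s * (m - d : ℝ))]
        · rw [mul_pow, mul_pow]; push_cast; ring
        · rw [trace_szegoPos, ← mul_add, hsum]
        · rw [det_szegoPos t l2 hl1]; linear_combination (-s ^ 2) * hmul
    have hnn : ∀ n : ℕ, 0 ≤ (m - d) ^ n := fun n => pow_nonneg (by linarith) n
    have hpnorm : ∀ (z' : ℂ), ‖z'‖ = 1 → ∀ n : ℕ,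
        ‖(l2 * z' / (-(1 + (t : ℂ) ^ 2))) ^ n * (((m + d) ^ n + (m - d) ^ n : ℝ) : ℂ)‖ =
          R ^ n + (l2 / (1 + t ^ 2)) ^ n * (m - d) ^ n := by
      intro z' hz' n
      have : 0 ≤ (m + d) ^ n := by positivity
      rw [norm_mul, norm_pow, hs z' hz', Complex.norm_real,
        Real.norm_of_nonneg (add_nonneg this (hnn n)), hR, mul_pow]
      ring
    refine ⟨R, ?_, fun z' hz' n => ?_, fun α L hL => ?_, fun h => absurd h (not_le.2 hcase),
      fun _ => ?_⟩
    · rw [hcR, hR]; gcongr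
    · have : R ^ n + (l2 / (1 + t ^ 2)) ^ n * (m - d) ^ n ≤ 2 * R ^ n := by
        have h1 : (m - d) ^ n ≤ (m + d) ^ n := pow_le_pow_left₀ (by linarith) (by linarith) n
        have h2 : (l2 / (1 + t ^ 2)) ^ n * (m - d) ^ n ≤
            (l2 / (1 + t ^ 2)) ^ n * (m + d) ^ n := by gcongr
        rw [hR, mul_pow]
        linarith
      rw [(htr z' n).1, (htr z' n).2, hpnorm z' hz']
      exact ⟨this, this⟩
    · refine le_of_log_sub_le hL (C := Real.log 2) fun n => ?_
      have h1 : R ^ n ≤ ‖(szegoPos t l1 l2 z ^ n).trace‖ := by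
        rw [(htr z n).2, hpnorm z hz]
        have := mul_nonneg (by positivity : 0 ≤ (l2 / (1 + t ^ 2)) ^ n) (hnn n)
        linarith
      have h2 : 0 < R ^ n := by positivity
      have h3 := log_norm_trace_pow_le H (szego_eq t l1 l2 z) α n
        (norm_pos_iff.1 (h2.trans_le h1))
      rw [← Real.log_pow]
      exact (Real.log_le_log h2 h1).trans h3
    · rw [← Real.log_div hR0.ne' hcpos.ne']
      congr 1
      have hsqrt : Real.sqrt ((1 + t ^ 2) ^ 2 * a ^ 2 - 4 * t ^ 2) = 2 * d := by
        rw [hd, show (1 + t ^ 2) ^ 2 * a ^ 2 - 4 * t ^ 2 = 2 ^ 2 * (m ^ 2 - (t * l1) ^ 2) by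
          rw [hm]; linear_combination (4 * t ^ 2) * hasq]
        rw [Real.sqrt_mul (by norm_num), Real.sqrt_sq (by norm_num)]
      rw [hsqrt, hR, hcR, hm]
      field_simp

section Hilbert
variable {E : Type*} [NormedAddCommGroup E] [InnerProductSpace ℂ E] [CompleteSpace E]

lemma mem_unitary_of_isometry {U : E →L[ℂ] E} (hU : ∀ x, ‖U x‖ = ‖x‖)
    (hs : Function.Surjective U) : U ∈ unitary (E →L[ℂ] E) := by
  have h1 : ContinuousLinearMap.adjoint U * U = 1 := by
    exact (ContinuousLinearMap.norm_map_iff_adjoint_comp_self U).1 hU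
  refine Unitary.mem_iff.2 ⟨h1, ?_⟩
  ext x
  obtain ⟨y, rfl⟩ := hs x
  have := congrArg (fun T : E →L[ℂ] E => T y) h1
  simp only [mul_apply_eq_comp, one_apply_eq_self] at this ⊢
  change U (ContinuousLinearMap.adjoint U (U y)) = U y
  rw [this]

lemma isStarNormal_sub_of_unitary {U : E →L[ℂ] E} (hU : U ∈ unitary (E →L[ℂ] E)) (z : ℂ) :
    IsStarNormal (U - algebraMap ℂ (E →L[ℂ] E) z) := by
  obtain ⟨h1, h2⟩ := Unitary.mem_iff.1 hU
  constructor
  rw [commute_iff_eq, star_sub, sub_mul, sub_mul, mul_sub, mul_sub, mul_sub, mul_sub, h1, h2,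
    Algebra.algebraMap_eq_smul_one]
  simp only [star_smul, star_one, smul_mul_assoc, mul_smul_comm, one_mul, mul_one]
  rw [smul_comm z]
  abel

lemma exists_approx_eigenvector {U : E →L[ℂ] E} (hU : U ∈ unitary (E →L[ℂ] E)) {z : ℂ}
    (hz : z ∈ spectrum ℂ U) {δ : ℝ} (hδ : 0 < δ) : ∃ ψ : E, ψ ≠ 0 ∧ ‖U ψ - z • ψ‖ ≤ δ * ‖ψ‖ := by
  by_contra! hcon
  set T : E →L[ℂ] E := U - algebraMap ℂ (E →L[ℂ] E) z with hT
  have hTa : ∀ x, T x = U x - z • x := fun x => by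
    simp [hT, Algebra.algebraMap_eq_smul_one]
  have hnT : IsStarNormal T := isStarNormal_sub_of_unitary hU z
  have hb : ∀ x, δ * ‖x‖ ≤ ‖T x‖ := by
    intro x
    by_cases hx : x = 0
    · simp [hx]
    · rw [hTa]
      exact (hcon x hx).le
  have hanti : AntilipschitzWith (Real.toNNReal δ⁻¹) T := by
    refine ContinuousLinearMap.antilipschitz_of_bound T fun x => ?_
    rw [Real.coe_toNNReal _ (by positivity), inv_mul_eq_div, le_div_iff₀ hδ, mul_comm]
    exact hb x
  have hker : T.ker = ⊥ := LinearMap.ker_eq_bot.2 hanti.injective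
  have hdense : T.range.topologicalClosure = ⊤ := by
    rw [Submodule.topologicalClosure_eq_top_iff,
        ContinuousLinearMap.IsStarNormal.orthogonal_range hnT, hker]
  have hbij : Function.Bijective T :=
    (ContinuousLinearMap.bijective_iff_dense_range_and_antilipschitz T).2 ⟨hdense, _, hanti⟩
  have hunit : IsUnit T := ContinuousLinearMap.isUnit_iff_bijective.2 hbij
  refine spectrum.mem_iff.1 hz ?_
  rw [← IsUnit.neg_iff, neg_sub]
  exact hunit

lemma exists_eigenvector_near [FiniteDimensional ℂ E] {U : E →L[ℂ] E} (hU : ∀ x, ‖U x‖ = ‖x‖)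
    {z : ℂ} {ε : ℝ} {φ : E} (hφ : φ ≠ 0) (h : ‖U φ - z • φ‖ ≤ ε * ‖φ‖) :
    ∃ z' : ℂ, ‖z'‖ = 1 ∧ ‖z' - z‖ ≤ ε ∧ ∃ ψ : E, ψ ≠ 0 ∧ U ψ = z' • ψ := by
  have hinj : Function.Injective U := by
    refine (injective_iff_map_eq_zero U).2 fun x hx => ?_
    rw [← norm_eq_zero, ← hU, hx, norm_zero]
  have hUu := mem_unitary_of_isometry hU
      (LinearMap.surjective_of_injective (f := (U : E →ₗ[ℂ] E)) hinj)
  have hn := norm_pos_iff.2 hφ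
  have hε : 0 ≤ ε := by
    have := (norm_nonneg _).trans h
    exact nonneg_of_mul_nonneg_left this hn
  have key : ∃ z' ∈ spectrum ℂ U, ‖z' - z‖ ≤ ε := by
    by_cases hz : z ∈ spectrum ℂ U
    · exact ⟨z, hz, by simpa using hε⟩
    have hnt : Nontrivial E := ⟨φ, 0, hφ⟩
    set T : E →L[ℂ] E := U - algebraMap ℂ (E →L[ℂ] E) z with hT
    have hTa : ∀ x, T x = U x - z • x := fun x => by
      simp [hT, Algebra.algebraMap_eq_smul_one]
    have hnT : IsStarNormal T := isStarNormal_sub_of_unitary hUu z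
    have hunit : IsUnit T := by
      rw [spectrum.notMem_iff, ← IsUnit.neg_iff, neg_sub] at hz
      exact hz
    obtain ⟨V, hV⟩ := hunit
    have hnV : IsStarNormal (↑V⁻¹ : E →L[ℂ] E) := by
      have : IsStarNormal (V : E →L[ℂ] E) := hV ▸ hnT
      infer_instance
    obtain ⟨μ, hμ, hμn⟩ := spectrum.exists_nnnorm_eq_spectralRadius (↑V⁻¹ : E →L[ℂ] E)
    rw [hnV.spectralRadius_eq_nnnorm] at hμn
    have hμn : ‖μ‖ = ‖(↑V⁻¹ : E →L[ℂ] E)‖ := by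
      have : ‖μ‖₊ = ‖(↑V⁻¹ : E →L[ℂ] E)‖₊ := by exact_mod_cast hμn
      exact congrArg NNReal.toReal this
    have h1 : ‖φ‖ ≤ ‖μ‖ * (ε * ‖φ‖) := by
      have : φ = (↑V⁻¹ : E →L[ℂ] E) (T φ) := by
        rw [← hV, ← mul_apply_eq_comp, Units.inv_mul]; rfl
      calc ‖φ‖ = ‖(↑V⁻¹ : E →L[ℂ] E) (T φ)‖ := by rw [← this]
        _ ≤ ‖(↑V⁻¹ : E →L[ℂ] E)‖ * ‖T φ‖ := ContinuousLinearMap.le_opNorm _ _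
        _ ≤ _ := by rw [hTa, hμn]; gcongr
    have h2 : 1 ≤ ‖μ‖ * ε := by
      rw [← mul_assoc] at h1
      exact le_of_mul_le_mul_right (by linarith) hn
    have hμ0 : μ ≠ 0 := by
      rintro rfl
      norm_num at h2
    have h3 : μ⁻¹ ∈ spectrum ℂ T := by
      have := (spectrum.inv_mem_iff (r := Units.mk0 μ hμ0) (a := V⁻¹)).1 hμ
      rw [← hV]
      simpa using this
    refine ⟨z + μ⁻¹, ?_, ?_⟩
    · rw [hT, spectrum.mem_iff] at h3
      rw [spectrum.mem_iff, map_add]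
      convert h3 using 2
      abel
    · rw [add_sub_cancel_left, norm_inv]
      exact (inv_le_iff_one_le_mul₀ (norm_pos_iff.2 hμ0)).2 (by rwa [mul_comm])
  obtain ⟨z', hz', hd⟩ := key
  have : Module.End.HasEigenvalue (U : E →ₗ[ℂ] E) z' := by
    rw [Module.End.hasEigenvalue_iff_mem_spectrum]
    exact ContinuousLinearMap.spectrum_eq (f := U) ▸ hz'
  obtain ⟨ψ, hψ⟩ := this.exists_hasEigenvector
  have h1 : U ψ = z' • ψ := hψ.apply_eq_smul
  refine ⟨z', ?_, hd, ψ, hψ.2, h1⟩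
  have h2 := hU ψ
  rw [h1, norm_smul] at h2
  exact mul_right_cancel₀ (norm_ne_zero_iff.2 hψ.2) (by rw [h2, one_mul])

end Hilbert

section Walk
variable {G : Type*}

/-- The upper component of the coin applied to `(u, v)`. -/
def coinP (f : G → ℝ) (g u v : G → ℂ) (n : G) : ℂ := f n * u n - g n * v n

/-- The lower component of the coin applied to `(u, v)`. -/
def coinM (f : G → ℝ) (g u v : G → ℂ) (n : G) : ℂ := (starRingEnd ℂ) (g n) * u n + f n * v n

variable {l a : ℝ} {f : G → ℝ} {g u v : G → ℂ}

lemma norm_coin_sq (hfg : ∀ n, (f n : ℂ) ^ 2 + g n * (starRingEnd ℂ) (g n) = 1) (n : G) :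
    ‖coinP f g u v n‖ ^ 2 + ‖coinM f g u v n‖ ^ 2 = ‖u n‖ ^ 2 + ‖v n‖ ^ 2 := by
  have : ((‖coinP f g u v n‖ ^ 2 + ‖coinM f g u v n‖ ^ 2 : ℝ) : ℂ)
      = ((‖u n‖ ^ 2 + ‖v n‖ ^ 2 : ℝ) : ℂ) := by
    push_cast
    rw [← Complex.mul_conj', ← Complex.mul_conj', ← Complex.mul_conj', ← Complex.mul_conj',
      coinP, coinM]
    simp only [map_sub, map_add, map_mul, Complex.conj_conj, Complex.conj_ofReal]
    linear_combination (u n * (starRingEnd ℂ) (u n) + v n * (starRingEnd ℂ) (v n)) * hfg n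
  exact_mod_cast this

variable [CommRing G]

/-- The upper component of the walk applied to `(u, v)`. -/
def walkP (l a : ℝ) (f : G → ℝ) (g u v : G → ℂ) (n : G) : ℂ :=
  l * coinP f g u v (n - 1) - a * coinM f g u v n

/-- The lower component of the walk applied to `(u, v)`. -/
def walkM (l a : ℝ) (f : G → ℝ) (g u v : G → ℂ) (n : G) : ℂ :=
  l * coinM f g u v (n + 1) + a * coinP f g u v n

lemma norm_walk_sq (hla : l ^ 2 + a ^ 2 = 1) (n : G) :
    ‖walkP l a f g u v (n + 1)‖ ^ 2 + ‖walkM l a f g u v n‖ ^ 2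
      = ‖coinP f g u v n‖ ^ 2 + ‖coinM f g u v (n + 1)‖ ^ 2 := by
  have hla' : (l : ℂ) ^ 2 + (a : ℂ) ^ 2 = 1 := by exact_mod_cast hla
  have : ((‖walkP l a f g u v (n + 1)‖ ^ 2 + ‖walkM l a f g u v n‖ ^ 2 : ℝ) : ℂ)
      = ((‖coinP f g u v n‖ ^ 2 + ‖coinM f g u v (n + 1)‖ ^ 2 : ℝ) : ℂ) := by
    push_cast
    rw [← Complex.mul_conj', ← Complex.mul_conj', ← Complex.mul_conj', ← Complex.mul_conj',
      walkP, walkM, add_sub_cancel_right]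
    simp only [map_sub, map_add, map_mul, Complex.conj_ofReal]
    linear_combination (coinP f g u v n * (starRingEnd ℂ) (coinP f g u v n) +
      coinM f g u v (n + 1) * (starRingEnd ℂ) (coinM f g u v (n + 1))) * hla'
  exact_mod_cast this

lemma hasSum_of_shift {P M P' M' : G → ℝ} (hP0 : ∀ n, 0 ≤ P n) (hM0 : ∀ n, 0 ≤ M n)
    (hP0' : ∀ n, 0 ≤ P' n) (hM0' : ∀ n, 0 ≤ M' n) (h : ∀ n, P' (n + 1) + M' n = P n + M (n + 1))
    {S : ℝ} (hS : HasSum (fun n => P n + M n) S) : HasSum (fun n => P' n + M' n) S := by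
  have hP : Summable P := hS.summable.of_nonneg_of_le hP0 fun n => le_add_of_nonneg_right (hM0 n)
  have hM : Summable M := hS.summable.of_nonneg_of_le hM0 fun n => le_add_of_nonneg_left (hP0 n)
  have hM' : HasSum (fun n => M (n + 1)) (∑' n, M n) :=
    (Equiv.addRight (1 : G)).hasSum_iff.2 hM.hasSum
  have h2 : HasSum (fun n => P' (n + 1) + M' n) S := by
    rw [hS.unique (hP.hasSum.add hM.hasSum)]
    simpa only [h] using hP.hasSum.add hM'
  have hP2 : Summable (fun n => P' (n + 1)) :=
    h2.summable.of_nonneg_of_le (fun n => hP0' _) fun n => le_add_of_nonneg_right (hM0' n)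
  have hM2 : Summable M' :=
    h2.summable.of_nonneg_of_le hM0' fun n => le_add_of_nonneg_left (hP0' _)
  have hP3 : HasSum P' (∑' n, P' (n + 1)) := (Equiv.addRight (1 : G)).hasSum_iff.1 hP2.hasSum
  rw [h2.unique (hP2.hasSum.add hM2.hasSum)]
  exact hP3.add hM2.hasSum

lemma hasSum_walk (hla : l ^ 2 + a ^ 2 = 1)
    (hfg : ∀ n, (f n : ℂ) ^ 2 + g n * (starRingEnd ℂ) (g n) = 1) {S : ℝ}
    (h : HasSum (fun n => ‖u n‖ ^ 2 + ‖v n‖ ^ 2) S) :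
    HasSum (fun n => ‖walkP l a f g u v n‖ ^ 2 + ‖walkM l a f g u v n‖ ^ 2) S :=
  hasSum_of_shift (P := fun n => ‖coinP f g u v n‖ ^ 2) (M := fun n => ‖coinM f g u v n‖ ^ 2)
    (fun _ => sq_nonneg _) (fun _ => sq_nonneg _) (fun _ => sq_nonneg _) (fun _ => sq_nonneg _)
    (fun n => norm_walk_sq hla n) (by simpa only [norm_coin_sq hfg] using h)

end Walk

section Ring
variable {t l1 l2 : ℝ} {z : ℂ} {q : ℕ} {y : ZMod q → UnitAddCircle} {u v : ZMod q → ℂ}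

lemma szego_mulVec (hl1 : l1 ∈ Set.Ioo (0 : ℝ) 1) (hl2 : l2 ∈ Set.Ioo (0 : ℝ) 1)
    (hP : ∀ n, walkP l1 (sq1 l1) (fun r => fT t l2 (y r)) (fun r => gT t l2 (y r)) u v n = z * u n)
    (hM : ∀ n, walkM l1 (sq1 l1) (fun r => fT t l2 (y r)) (fun r => gT t l2 (y r)) u v n = z * v n)
    (n : ZMod q) :
    (szego t l1 l2 z (y n)).mulVec
        ![coinM (fun r => fT t l2 (y r)) (fun r => gT t l2 (y r)) u v n, z * u n]
      = (l1 * z * fT t l2 (y n) : ℂ) •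
        ![coinM (fun r => fT t l2 (y r)) (fun r => gT t l2 (y r)) u v (n + 1), z * u (n + 1)] ∧
    (szego t l1 l2 z (y n)).adjugate.mulVec
        ![coinM (fun r => fT t l2 (y r)) (fun r => gT t l2 (y r)) u v (n + 1), z * u (n + 1)]
      = (l1 * z * fT t l2 (y n) : ℂ) •
        ![coinM (fun r => fT t l2 (y r)) (fun r => gT t l2 (y r)) u v n, z * u n] := by
  have h1 := hM n
  have h2 := hP (n + 1)
  have hfg := fT_sq_add (t := t) hl2 (y n)
  have hla : (l1 : ℂ) ^ 2 + (sq1 l1 : ℂ) ^ 2 = 1 := by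
    have := sq1_sq hl1
    have h : l1 ^ 2 + sq1 l1 ^ 2 = 1 := by linarith
    exact_mod_cast h
  rw [walkM] at h1
  rw [walkP, add_sub_cancel_right] at h2
  generalize coinM (fun r => fT t l2 (y r)) (fun r => gT t l2 (y r)) u v (n + 1) = m' at *
  have hp : coinP (fun r => fT t l2 (y r)) (fun r => gT t l2 (y r)) u v n
    = fT t l2 (y n) * u n - gT t l2 (y n) * v n := rfl
  have hm : coinM (fun r => fT t l2 (y r)) (fun r => gT t l2 (y r)) u v n
    = (starRingEnd ℂ) (gT t l2 (y n)) * u n + fT t l2 (y n) * v n := rfl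
  rw [hp] at h1 h2
  rw [hm, szego, Matrix.adjugate_fin_two_of, ← h2]
  generalize (starRingEnd ℂ) (gT t l2 (y n)) = gb at *
  generalize gT t l2 (y n) = gg at *
  generalize (fT t l2 (y n) : ℂ) = ff at *
  generalize (sq1 l1 : ℂ) = a at *
  generalize (l1 : ℂ) = l at *
  generalize u n = U at *
  generalize v n = V at *
  have h3 : z * V - l * m' - a * (ff * U - gg * V) = 0 := by rw [← h1]; ring
  constructor <;> ext i <;> fin_cases i <;>
    simp only [Matrix.mulVec, dotProduct, Fin.sum_univ_two, Matrix.of_apply, Matrix.cons_val',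
      Matrix.cons_val_zero, Matrix.cons_val_one, Matrix.cons_val_fin_one, Pi.smul_apply,
      smul_eq_mul, Fin.zero_eta, Fin.mk_one, Fin.isValue]
  · linear_combination (z * ff) * h3 + (a * z * U) * hfg
  · linear_combination (-a * z * ff) * h3 + (-z * U) * hfg + z * (gg * ff * V - U * ff ^ 2) * hla
  · linear_combination (-l) * h3 + (-z * l * V) * hfg + (-m') * hla
  · linear_combination (-z * gg * l) * h3 + (-z * gg * m') * hla

end Ring

lemma ct_mulVec {β : ℝ} {A : UnitAddCircle → Matrix (Fin 2) (Fin 2) ℂ} {q : ℕ}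
    {y : ZMod q → UnitAddCircle} (hy : ∀ r, y (r + 1) = y r + (β : UnitAddCircle))
    {w : ZMod q → Fin 2 → ℂ} {s : UnitAddCircle → ℂ}
    (h : ∀ n, (A (y n)).mulVec (w n) = s (y n) • w (n + 1) ∧
      (A (y n)).adjugate.mulVec (w (n + 1)) = s (y n) • w n) (r : ZMod q) (n : ℕ) :
    y (r + n) = y r + n • (β : UnitAddCircle) ∧
    (ct β A n (y r)).mulVec (w r)
      = (∏ j ∈ Finset.range n, s (y r + j • (β : UnitAddCircle))) • w (r + n) ∧
    (ct β A n (y r)).adjugate.mulVec (w (r + n))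
      = (∏ j ∈ Finset.range n, s (y r + j • (β : UnitAddCircle))) • w r := by
  induction n with
  | zero => simp [ct]
  | succ n ih =>
    obtain ⟨ih1, ih2, ih3⟩ := ih
    obtain ⟨h1, h2⟩ := h (r + n)
    rw [ih1] at h1 h2
    have hn : r + ((n + 1 : ℕ) : ZMod q) = r + n + 1 := by push_cast; ring
    refine ⟨?_, ?_, ?_⟩
    · rw [hn, hy, ih1, succ_nsmul]; abel
    · rw [hn, ct, ← Matrix.mulVec_mulVec, ih2, Matrix.mulVec_smul, h1, smul_smul,
        Finset.prod_range_succ]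
    · rw [hn, ct, Matrix.adjugate_mul_distrib, ← Matrix.mulVec_mulVec, h2, Matrix.mulVec_smul, ih3,
        smul_smul, Finset.prod_range_succ, mul_comm]

lemma trace_eq_two_mul {X : Matrix (Fin 2) (Fin 2) ℂ} {P : ℂ} {w : Fin 2 → ℂ} (hw : w ≠ 0)
    (h1 : X.mulVec w = P • w) (h2 : X.adjugate.mulVec w = P • w) : X.trace = 2 * P := by
  have h3 : X + X.adjugate = X.trace • (1 : Matrix (Fin 2) (Fin 2) ℂ) := by
    ext i j
    fin_cases i <;> fin_cases j <;>
      simp [Matrix.adjugate_fin_two, Matrix.trace, Fin.sum_univ_two, add_comm]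
  have h4 : X.trace • w = (2 * P) • w := by
    have := congrArg (fun Y => Matrix.mulVec Y w) h3
    simp only [Matrix.add_mulVec, Matrix.smul_mulVec, Matrix.one_mulVec] at this
    rw [← this, h1, h2, two_mul, add_smul]
  exact smul_left_injective ℂ hw h4

lemma exists_norm_trace_eq {t l1 l2 : ℝ} {z : ℂ} {q : ℕ} {y : ZMod q → UnitAddCircle}
    {u v : ZMod q → ℂ} {β : ℝ}
    (hl1 : l1 ∈ Set.Ioo (0 : ℝ) 1) (hl2 : l2 ∈ Set.Ioo (0 : ℝ) 1) (hz : ‖z‖ = 1)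
    (hy : ∀ r, y (r + 1) = y r + (β : UnitAddCircle)) (huv : ¬(u = 0 ∧ v = 0))
    (hP : ∀ n, walkP l1 (sq1 l1) (fun r => fT t l2 (y r)) (fun r => gT t l2 (y r)) u v n = z * u n)
    (hM : ∀ n,
      walkM l1 (sq1 l1) (fun r => fT t l2 (y r)) (fun r => gT t l2 (y r)) u v n = z * v n) :
    ∃ x, ‖(ct β (szego t l1 l2 z) q x).trace‖
      = 2 * ∏ j ∈ Finset.range q, (l1 * |fT t l2 (x + j • (β : UnitAddCircle))|) := by
  have hz0 : z ≠ 0 := by rintro rfl; simp at hz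
  have hl0 : (l1 : ℂ) ≠ 0 := by exact_mod_cast hl1.1.ne'
  set w : ZMod q → Fin 2 → ℂ := fun n =>
    ![coinM (fun r => fT t l2 (y r)) (fun r => gT t l2 (y r)) u v n, z * u n] with hw
  have hex : ∃ r, w r ≠ 0 := by
    by_contra! hcon
    have hc : ∀ n, coinM (fun r => fT t l2 (y r)) (fun r => gT t l2 (y r)) u v n = 0 := fun n => by
      simpa [hw] using congrFun (hcon n) 0
    have hu : ∀ n, u n = 0 := fun n => by
      simpa [hw, hz0] using congrFun (hcon n) 1
    have hcp : ∀ n, coinP (fun r => fT t l2 (y r)) (fun r => gT t l2 (y r)) u v n = 0 := fun n => by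
      have := hP (n + 1)
      rw [walkP, add_sub_cancel_right, hc, hu, mul_zero, mul_zero, sub_zero] at this
      exact (mul_eq_zero.1 this).resolve_left hl0
    refine huv ⟨funext hu, funext fun n => ?_⟩
    have := hM n
    rw [walkM, hc, hcp, mul_zero, mul_zero, add_zero] at this
    exact (mul_eq_zero.1 this.symm).resolve_left hz0
  obtain ⟨r, hr⟩ := hex
  obtain ⟨-, h1, h2⟩ := ct_mulVec (s := fun x => (l1 * z * fT t l2 x : ℂ)) hy
    (fun n => szego_mulVec hl1 hl2 hP hM n) r q
  rw [ZMod.natCast_self, add_zero] at h1 h2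
  refine ⟨y r, ?_⟩
  rw [trace_eq_two_mul hr h1 h2, norm_mul, norm_prod]
  simp only [norm_mul, hz, mul_one, Complex.norm_real, Real.norm_eq_abs, abs_of_pos hl1.1]
  norm_num

/-- The walk on a ring of `q` sites as a linear operator. -/
def ringWalk {q : ℕ} [NeZero q] (l a : ℝ) (f : ZMod q → ℝ) (g : ZMod q → ℂ) :
    EuclideanSpace ℂ (ZMod q ⊕ ZMod q) →L[ℂ] EuclideanSpace ℂ (ZMod q ⊕ ZMod q) :=
  LinearMap.toContinuousLinearMap
    { toFun := fun ψ => WithLp.toLp 2 (Sum.elim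
        (walkP l a f g (fun r => ψ (.inl r)) (fun r => ψ (.inr r)))
        (walkM l a f g (fun r => ψ (.inl r)) (fun r => ψ (.inr r))))
      map_add' := fun ψ φ => by
        ext (r | r) <;> simp [walkP, walkM, coinP, coinM] <;> ring
      map_smul' := fun c ψ => by
        ext (r | r) <;> simp [walkP, walkM, coinP, coinM] <;> ring }

lemma ringWalk_inl {q : ℕ} [NeZero q] (l a : ℝ) (f : ZMod q → ℝ) (g : ZMod q → ℂ)
    (ψ : EuclideanSpace ℂ (ZMod q ⊕ ZMod q)) (r : ZMod q) : ringWalk l a f g ψ (.inl r)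
      = walkP l a f g (fun r => ψ (.inl r)) (fun r => ψ (.inr r)) r := rfl

lemma ringWalk_inr {q : ℕ} [NeZero q] (l a : ℝ) (f : ZMod q → ℝ) (g : ZMod q → ℂ)
    (ψ : EuclideanSpace ℂ (ZMod q ⊕ ZMod q)) (r : ZMod q) : ringWalk l a f g ψ (.inr r)
      = walkM l a f g (fun r => ψ (.inl r)) (fun r => ψ (.inr r)) r := rfl

lemma norm_sq_sum_type {q : ℕ} [NeZero q] (ψ : EuclideanSpace ℂ (ZMod q ⊕ ZMod q)) :
    ‖ψ‖ ^ 2 = ∑ r, (‖ψ (.inl r)‖ ^ 2 + ‖ψ (.inr r)‖ ^ 2) := by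
  rw [EuclideanSpace.norm_sq_eq, Fintype.sum_sum_type, Finset.sum_add_distrib]

lemma norm_ringWalk {q : ℕ} [NeZero q] {l a : ℝ} {f : ZMod q → ℝ} {g : ZMod q → ℂ}
    (hla : l ^ 2 + a ^ 2 = 1)
    (hfg : ∀ n, (f n : ℂ) ^ 2 + g n * (starRingEnd ℂ) (g n) = 1)
    (ψ : EuclideanSpace ℂ (ZMod q ⊕ ZMod q)) : ‖ringWalk l a f g ψ‖ = ‖ψ‖ := by
  have h := hasSum_walk hla hfg
    (hasSum_fintype fun r => ‖ψ (.inl r)‖ ^ 2 + ‖ψ (.inr r)‖ ^ 2)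
  have h2 := h.unique (hasSum_fintype _)
  refine (sq_eq_sq₀ (norm_nonneg _) (norm_nonneg _)).1 ?_
  rw [norm_sq_sum_type, norm_sq_sum_type, h2]
  simp only [ringWalk_inl, ringWalk_inr]

lemma exists_near_norm_trace_eq {t l1 l2 : ℝ} {z : ℂ} {q : ℕ} [NeZero q]
    {y : ZMod q → UnitAddCircle} {u v : ZMod q → ℂ} {β ε : ℝ}
    (hl1 : l1 ∈ Set.Ioo (0 : ℝ) 1) (hl2 : l2 ∈ Set.Ioo (0 : ℝ) 1)
    (hy : ∀ r, y (r + 1) = y r + (β : UnitAddCircle)) (hε : 0 ≤ ε)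
    (h0 : 0 < ∑ r, (‖u r‖ ^ 2 + ‖v r‖ ^ 2))
    (h : ∑ r, (‖walkP l1 (sq1 l1) (fun r => fT t l2 (y r)) (fun r => gT t l2 (y r)) u v r
          - z * u r‖ ^ 2
        + ‖walkM l1 (sq1 l1) (fun r => fT t l2 (y r)) (fun r => gT t l2 (y r)) u v r
          - z * v r‖ ^ 2) ≤ ε ^ 2 * ∑ r, (‖u r‖ ^ 2 + ‖v r‖ ^ 2)) :
    ∃ z' : ℂ, ‖z'‖ = 1 ∧ ‖z' - z‖ ≤ ε ∧ ∃ x, ‖(ct β (szego t l1 l2 z') q x).trace‖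
      = 2 * ∏ j ∈ Finset.range q, (l1 * |fT t l2 (x + j • (β : UnitAddCircle))|) := by
  have hla : l1 ^ 2 + sq1 l1 ^ 2 = 1 := by rw [sq1_sq hl1]; ring
  set U := ringWalk l1 (sq1 l1) (fun r => fT t l2 (y r)) (fun r => gT t l2 (y r)) with hU
  set φ : EuclideanSpace ℂ (ZMod q ⊕ ZMod q) := WithLp.toLp 2 (Sum.elim u v) with hφ
  have hn : ‖φ‖ ^ 2 = ∑ r, (‖u r‖ ^ 2 + ‖v r‖ ^ 2) := by rw [norm_sq_sum_type]; rfl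
  have hφ0 : φ ≠ 0 := by
    intro h
    rw [← hn, h] at h0
    simp at h0
  have hUφ : ‖U φ - z • φ‖ ≤ ε * ‖φ‖ := by
    refine (sq_le_sq₀ (norm_nonneg _) (by positivity)).1 ?_
    rw [mul_pow, hn, norm_sq_sum_type]
    exact h
  obtain ⟨z', hz', hd, ψ, hψ, hψe⟩ := exists_eigenvector_near
    (norm_ringWalk hla fun n => fT_sq_add hl2 (y n)) hφ0 hUφ
  refine ⟨z', hz', hd, exists_norm_trace_eq (u := fun r => ψ (.inl r)) (v := fun r => ψ (.inr r))
    hl1 hl2 hz' hy ?_ ?_ ?_⟩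
  · rintro ⟨h1, h2⟩
    refine hψ ?_
    ext (r | r)
    · exact congrFun h1 r
    · exact congrFun h2 r
  · intro n
    rw [← ringWalk_inl, hψe]; rfl
  · intro n
    rw [← ringWalk_inr, hψe]; rfl

lemma h2_hasSum (ψ : H2) : HasSum (fun n => ‖ψ n 0‖ ^ 2 + ‖ψ n 1‖ ^ 2) (‖ψ‖ ^ 2) := by
  have h := lp.hasSum_norm (p := 2) (by norm_num) ψ
  simp only [ENNReal.toReal_ofNat, Real.rpow_two] at h
  simpa only [EuclideanSpace.norm_sq_eq, Fin.sum_univ_two] using h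

lemma exists_h2 {u v : ℤ → ℂ} (h : Summable fun n => ‖u n‖ ^ 2 + ‖v n‖ ^ 2) :
    ∃ ψ : H2, ∀ n, ψ n 0 = u n ∧ ψ n 1 = v n := by
  have hm : Memℓp (fun n : ℤ => (!₂[u n, v n] : EuclideanSpace ℂ (Fin 2))) 2 := by
    refine memℓp_gen ?_
    simp only [ENNReal.toReal_ofNat, Real.rpow_two, EuclideanSpace.norm_sq_eq, Fin.sum_univ_two]
    simpa using h
  exact ⟨⟨_, hm⟩, fun n => ⟨rfl, rfl⟩⟩

/-- The phases visited by the walk. -/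
def phase (Φ θ : ℝ) (n : ℤ) : UnitAddCircle := ((θ + n * Φ : ℝ) : UnitAddCircle)

lemma wPlus_eq (t l1 l2 Φ θ : ℝ) (ψ : ℤ → EuclideanSpace ℂ (Fin 2)) (n : ℤ) :
    wPlus t l1 l2 Φ θ ψ n = walkP l1 (sq1 l1) (fun r => fT t l2 (phase Φ θ r))
      (fun r => gT t l2 (phase Φ θ r)) (fun r => ψ r 0) (fun r => ψ r 1) n := by
  simp only [wPlus, walkP, coinP, coinM, fS_eq_fT, gS_eq_gT, phase]
  push_cast
  rfl

lemma wMinus_eq (t l1 l2 Φ θ : ℝ) (ψ : ℤ → EuclideanSpace ℂ (Fin 2)) (n : ℤ) :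
    wMinus t l1 l2 Φ θ ψ n = walkM l1 (sq1 l1) (fun r => fT t l2 (phase Φ θ r))
      (fun r => gT t l2 (phase Φ θ r)) (fun r => ψ r 0) (fun r => ψ r 1) n := by
  simp only [wMinus, walkM, coinP, coinM, fS_eq_fT, gS_eq_gT, phase]
  push_cast
  rfl

lemma norm_smul_add_smul_sq_le {l a : ℝ} (hla : l ^ 2 + a ^ 2 = 1) (x y : ℂ) :
    ‖(l : ℂ) * x + a * y‖ ^ 2 ≤ ‖x‖ ^ 2 + ‖y‖ ^ 2 := by
  have h : ‖(l : ℂ) * x + a * y‖ ≤ |l| * ‖x‖ + |a| * ‖y‖ := by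
    refine (norm_add_le _ _).trans ?_
    simp
  have h2 := pow_le_pow_left₀ (norm_nonneg _) h 2
  have h3 : |l| ^ 2 + |a| ^ 2 = 1 := by simpa only [sq_abs] using hla
  nlinarith [sq_nonneg (|a| * ‖x‖ - |l| * ‖y‖)]

lemma summable_add_int {P : ℤ → ℝ} (h : Summable P) (k : ℤ) : Summable fun n => P (n + k) :=
  (Equiv.addRight k).summable_iff.2 h

lemma walk_surjective {l a : ℝ} {f : ℤ → ℝ} {g : ℤ → ℂ} (hla : l ^ 2 + a ^ 2 = 1)
    (hfg : ∀ n, (f n : ℂ) ^ 2 + g n * (starRingEnd ℂ) (g n) = 1) {x y : ℤ → ℂ}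
    (h : Summable fun n => ‖x n‖ ^ 2 + ‖y n‖ ^ 2) :
    ∃ u v : ℤ → ℂ, (Summable fun n => ‖u n‖ ^ 2 + ‖v n‖ ^ 2) ∧
      (∀ n, walkP l a f g u v n = x n) ∧ ∀ n, walkM l a f g u v n = y n := by
  have hla' : (l : ℂ) ^ 2 + (a : ℂ) ^ 2 = 1 := by exact_mod_cast hla
  set c : ℤ → ℂ := fun n => l * x (n + 1) + a * y n with hc
  set d : ℤ → ℂ := fun n => l * y (n - 1) + (-a : ℝ) * x n with hd
  set u : ℤ → ℂ := fun n => f n * c n + g n * d n with hu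
  set v : ℤ → ℂ := fun n => -(starRingEnd ℂ) (g n) * c n + f n * d n with hv
  have h1 : ∀ n, coinP f g u v n = c n := fun n => by
    simp only [coinP, hu, hv]
    linear_combination c n * hfg n
  have h2 : ∀ n, coinM f g u v n = d n := fun n => by
    simp only [coinM, hu, hv]
    linear_combination d n * hfg n
  refine ⟨u, v, ?_, fun n => ?_, fun n => ?_⟩
  · have hx : Summable fun n => ‖x n‖ ^ 2 :=
      h.of_nonneg_of_le (fun n => sq_nonneg _) fun n => le_add_of_nonneg_right (sq_nonneg _)
    have hy : Summable fun n => ‖y n‖ ^ 2 :=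
      h.of_nonneg_of_le (fun n => sq_nonneg _) fun n => le_add_of_nonneg_left (sq_nonneg _)
    have hx' : Summable fun n => ‖x (n + 1)‖ ^ 2 := summable_add_int hx 1
    have hy' : Summable fun n => ‖y (n - 1)‖ ^ 2 := summable_add_int hy (-1)
    refine ((hx'.add hy).add (hy'.add hx)).of_nonneg_of_le (fun n => by positivity) fun n => ?_
    rw [← norm_coin_sq hfg, h1, h2]
    exact add_le_add (norm_smul_add_smul_sq_le hla _ _)
      (norm_smul_add_smul_sq_le (by rw [neg_sq]; exact hla) _ _)
  · rw [walkP, h1, h2]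
    simp only [hc, hd, sub_add_cancel]
    push_cast
    linear_combination x n * hla'
  · rw [walkM, h1, h2]
    simp only [hc, hd, add_sub_cancel_right]
    push_cast
    linear_combination y n * hla'

lemma exists_walk_approx {t l1 l2 Φ θ : ℝ} {z : ℂ}
    (hl1 : l1 ∈ Set.Ioo (0 : ℝ) 1) (hl2 : l2 ∈ Set.Ioo (0 : ℝ) 1) {W : H2 →L[ℂ] H2}
    (hW : ∀ (ψ : H2) (n : ℤ),
      W ψ n 0 = wPlus t l1 l2 Φ θ (fun m => ψ m) n ∧
      W ψ n 1 = wMinus t l1 l2 Φ θ (fun m => ψ m) n)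
    (hz : z ∈ spectrum ℂ W) : ‖z‖ = 1 ∧ ∀ δ > 0, ∃ u v : ℤ → ℂ, ∃ S > 0,
      HasSum (fun n => ‖u n‖ ^ 2 + ‖v n‖ ^ 2) S ∧ ∃ S', S' ≤ δ ^ 2 * S ∧
      HasSum (fun n =>
        ‖walkP l1 (sq1 l1) (fun r => fT t l2 (phase Φ θ r)) (fun r => gT t l2 (phase Φ θ r)) u v n
          - z * u n‖ ^ 2
        + ‖walkM l1 (sq1 l1) (fun r => fT t l2 (phase Φ θ r)) (fun r => gT t l2 (phase Φ θ r)) u v n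
          - z * v n‖ ^ 2) S' := by
  have hla : l1 ^ 2 + sq1 l1 ^ 2 = 1 := by rw [sq1_sq hl1]; ring
  have hfg : ∀ n : ℤ, (fT t l2 (phase Φ θ n) : ℂ) ^ 2 + gT t l2 (phase Φ θ n) *
    (starRingEnd ℂ) (gT t l2 (phase Φ θ n)) = 1 := fun n => fT_sq_add hl2 _
  simp only [wPlus_eq, wMinus_eq] at hW
  have hiso : ∀ ψ, ‖W ψ‖ = ‖ψ‖ := by
    intro ψ
    have h1 := hasSum_walk hla hfg (h2_hasSum ψ)
    have h2 := h2_hasSum (W ψ)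
    simp only [(hW _ _).1, (hW _ _).2] at h2
    exact (sq_eq_sq₀ (norm_nonneg _) (norm_nonneg _)).1 (h2.unique h1)
  have hsurj : Function.Surjective W := by
    intro φ
    obtain ⟨u, v, hs, h1, h2⟩ := walk_surjective hla hfg (h2_hasSum φ).summable
    obtain ⟨ψ, hψ⟩ := exists_h2 hs
    refine ⟨ψ, ?_⟩
    ext n i
    fin_cases i
    · refine ((hW ψ n).1.trans ?_).trans (h1 n)
      simp only [hψ]
    · refine ((hW ψ n).2.trans ?_).trans (h2 n)
      simp only [hψ]
  have hu := mem_unitary_of_isometry hiso hsurj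
  refine ⟨?_, fun δ hδ => ?_⟩
  · simpa using spectrum.subset_circle_of_unitary hu hz
  · obtain ⟨ψ, h0, hψ⟩ := exists_approx_eigenvector hu hz hδ
    refine ⟨fun n => ψ n 0, fun n => ψ n 1, ‖ψ‖ ^ 2, by positivity, h2_hasSum ψ,
      ‖W ψ - z • ψ‖ ^ 2, ?_, ?_⟩
    · rw [← mul_pow]
      exact pow_le_pow_left₀ (norm_nonneg _) hψ 2
    · have h2 := h2_hasSum (W ψ - z • ψ)
      have hs : ∀ n i, (W ψ - z • ψ : H2) n i = W ψ n i - z * ψ n i := fun _ _ => rfl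
      simpa only [hs, (hW _ _).1, (hW _ _).2] using h2

lemma abs_fT_sub_le {t l2 : ℝ} (hl2 : l2 ∈ Set.Ioo (0 : ℝ) 1) (x y : UnitAddCircle) :
    |fT t l2 x - fT t l2 y| ≤ ‖ec x - ec y‖ := by
  have h0 : 0 < 1 + t ^ 2 := by positivity
  have h : fT t l2 x - fT t l2 y = -(2 * t / (1 + t ^ 2)) * l2 * (ec x - ec y).re := by
    rw [fT, fT, Complex.sub_re]
    field_simp
    ring
  rw [h, abs_mul, abs_mul, abs_neg, abs_of_pos hl2.1]
  have h1 : |2 * t / (1 + t ^ 2)| ≤ 1 := by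
    rw [abs_div, abs_of_pos h0, div_le_one h0, abs_le]
    constructor <;> nlinarith [sq_nonneg (t - 1), sq_nonneg (t + 1)]
  have h2 : |2 * t / (1 + t ^ 2)| * l2 ≤ 1 := mul_le_one₀ h1 hl2.1.le hl2.2.le
  calc _ ≤ 1 * |(ec x - ec y).re| := by gcongr
    _ ≤ _ := by rw [one_mul]; exact Complex.abs_re_le_norm _

lemma norm_gT_sub_le {t l2 : ℝ} (hl2 : l2 ∈ Set.Ioo (0 : ℝ) 1) (x y : UnitAddCircle) :
    ‖gT t l2 x - gT t l2 y‖ ≤ ‖ec x - ec y‖ := by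
  have h0 : 0 < 1 + t ^ 2 := by positivity
  have hc : ‖ec (-x) - ec (-y)‖ = ‖ec x - ec y‖ := by
    rw [ec_neg, ec_neg, ← conj_ec, ← conj_ec, ← map_sub, RCLike.norm_conj]
  have h : gT t l2 x - gT t l2 y = ((1 / (-(1 + t ^ 2)) : ℝ) : ℂ) * (l2 : ℂ) *
      (-((t ^ 2 : ℝ) : ℂ) * (ec x - ec y) + (ec (-x) - ec (-y))) := by
    rw [gT, gT]
    push_cast
    ring
  have h1 : ‖-((t ^ 2 : ℝ) : ℂ) * (ec x - ec y) + (ec (-x) - ec (-y))‖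
      ≤ (1 + t ^ 2) * ‖ec x - ec y‖ := by
    refine (norm_add_le _ _).trans ?_
    rw [norm_mul, norm_neg, Complex.norm_real, Real.norm_of_nonneg (sq_nonneg t), hc]
    linarith
  rw [h, norm_mul, norm_mul, Complex.norm_real, Complex.norm_real, Real.norm_of_nonneg hl2.1.le,
    Real.norm_eq_abs, abs_div, abs_neg, abs_of_pos h0, abs_one]
  calc 1 / (1 + t ^ 2) * l2 * ‖-((t ^ 2 : ℝ) : ℂ) * (ec x - ec y) + (ec (-x) - ec (-y))‖
      ≤ 1 / (1 + t ^ 2) * 1 * ((1 + t ^ 2) * ‖ec x - ec y‖) := by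
        gcongr
        exact hl2.2.le
    _ = _ := by field_simp

lemma norm_add_sq_le_two (x y : ℂ) : ‖x + y‖ ^ 2 ≤ 2 * ‖x‖ ^ 2 + 2 * ‖y‖ ^ 2 := by
  have h := pow_le_pow_left₀ (norm_nonneg _) (norm_add_le x y) 2
  nlinarith [sq_nonneg (‖x‖ - ‖y‖)]

lemma norm_mul_sub_mul_sq_le {x y p r : ℂ} {ρ : ℝ} (hx : ‖x‖ ≤ ρ) (hy : ‖y‖ ≤ ρ) :
    ‖x * p + y * r‖ ^ 2 ≤ 2 * ρ ^ 2 * (‖p‖ ^ 2 + ‖r‖ ^ 2) := by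
  have h := norm_add_sq_le_two (x * p) (y * r)
  rw [norm_mul, norm_mul, mul_pow, mul_pow] at h
  have h1 := mul_le_mul_of_nonneg_right (pow_le_pow_left₀ (norm_nonneg _) hx 2) (sq_nonneg ‖p‖)
  have h2 := mul_le_mul_of_nonneg_right (pow_le_pow_left₀ (norm_nonneg _) hy 2) (sq_nonneg ‖r‖)
  linarith

lemma coin_perturb_sq_le {l a ρ : ℝ} (hla : l ^ 2 + a ^ 2 = 1) {f₀ f₁ F₀ F₁ : ℝ}
    {g₀ g₁ G₀ G₁ u₀ u₁ v₀ v₁ z : ℂ} (hf₀ : |f₀ - F₀| ≤ ρ) (hf₁ : |f₁ - F₁| ≤ ρ)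
    (hg₀ : ‖g₀ - G₀‖ ≤ ρ) (hg₁ : ‖g₁ - G₁‖ ≤ ρ) :
    ‖l * (f₀ * u₀ - g₀ * v₀) - a * ((starRingEnd ℂ) g₁ * u₁ + f₁ * v₁) - z * u₁‖ ^ 2
      + ‖l * ((starRingEnd ℂ) g₁ * u₁ + f₁ * v₁) + a * (f₀ * u₀ - g₀ * v₀) - z * v₀‖ ^ 2
    ≤ 2 * ‖l * (F₀ * u₀ - G₀ * v₀) - a * ((starRingEnd ℂ) G₁ * u₁ + F₁ * v₁) - z * u₁‖ ^ 2
      + 2 * ‖l * ((starRingEnd ℂ) G₁ * u₁ + F₁ * v₁) + a * (F₀ * u₀ - G₀ * v₀) - z * v₀‖ ^ 2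
      + 8 * ρ ^ 2 * ((‖u₀‖ ^ 2 + ‖v₀‖ ^ 2) + (‖u₁‖ ^ 2 + ‖v₁‖ ^ 2)) := by
  have h0 : ‖((f₀ - F₀ : ℝ) : ℂ) * u₀ + -(g₀ - G₀) * v₀‖ ^ 2
      ≤ 2 * ρ ^ 2 * (‖u₀‖ ^ 2 + ‖v₀‖ ^ 2) :=
    norm_mul_sub_mul_sq_le (by rwa [Complex.norm_real, Real.norm_eq_abs]) (by rwa [norm_neg])
  have h1 : ‖(starRingEnd ℂ) (g₁ - G₁) * u₁ + ((f₁ - F₁ : ℝ) : ℂ) * v₁‖ ^ 2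
      ≤ 2 * ρ ^ 2 * (‖u₁‖ ^ 2 + ‖v₁‖ ^ 2) :=
    norm_mul_sub_mul_sq_le (by rwa [RCLike.norm_conj])
        (by rwa [Complex.norm_real, Real.norm_eq_abs])
  have e1 : l * (f₀ * u₀ - g₀ * v₀) - a * ((starRingEnd ℂ) g₁ * u₁ + f₁ * v₁) - z * u₁
      = (l * (F₀ * u₀ - G₀ * v₀) - a * ((starRingEnd ℂ) G₁ * u₁ + F₁ * v₁) - z * u₁)
        + (l * (((f₀ - F₀ : ℝ) : ℂ) * u₀ + -(g₀ - G₀) * v₀)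
          + (-a : ℝ) * ((starRingEnd ℂ) (g₁ - G₁) * u₁ + ((f₁ - F₁ : ℝ) : ℂ) * v₁)) := by
    rw [map_sub]; push_cast; ring
  have e2 : l * ((starRingEnd ℂ) g₁ * u₁ + f₁ * v₁) + a * (f₀ * u₀ - g₀ * v₀) - z * v₀
      = (l * ((starRingEnd ℂ) G₁ * u₁ + F₁ * v₁) + a * (F₀ * u₀ - G₀ * v₀) - z * v₀)
        + (l * ((starRingEnd ℂ) (g₁ - G₁) * u₁ + ((f₁ - F₁ : ℝ) : ℂ) * v₁)
          + a * (((f₀ - F₀ : ℝ) : ℂ) * u₀ + -(g₀ - G₀) * v₀)) := by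
    rw [map_sub]; push_cast; ring
  rw [e1, e2]
  have k1 := norm_add_sq_le_two
    (l * (F₀ * u₀ - G₀ * v₀) - a * ((starRingEnd ℂ) G₁ * u₁ + F₁ * v₁) - z * u₁)
    (l * (((f₀ - F₀ : ℝ) : ℂ) * u₀ + -(g₀ - G₀) * v₀)
          + (-a : ℝ) * ((starRingEnd ℂ) (g₁ - G₁) * u₁ + ((f₁ - F₁ : ℝ) : ℂ) * v₁))
  have k2 := norm_add_sq_le_two
    (l * ((starRingEnd ℂ) G₁ * u₁ + F₁ * v₁) + a * (F₀ * u₀ - G₀ * v₀) - z * v₀)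
    (l * ((starRingEnd ℂ) (g₁ - G₁) * u₁ + ((f₁ - F₁ : ℝ) : ℂ) * v₁)
          + a * (((f₀ - F₀ : ℝ) : ℂ) * u₀ + -(g₀ - G₀) * v₀))
  have m1 := norm_smul_add_smul_sq_le (l := l) (a := -a) (by rw [neg_sq]; exact hla)
    (((f₀ - F₀ : ℝ) : ℂ) * u₀ + -(g₀ - G₀) * v₀)
    ((starRingEnd ℂ) (g₁ - G₁) * u₁ + ((f₁ - F₁ : ℝ) : ℂ) * v₁)
  have m2 := norm_smul_add_smul_sq_le hla
    ((starRingEnd ℂ) (g₁ - G₁) * u₁ + ((f₁ - F₁ : ℝ) : ℂ) * v₁)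
    (((f₀ - F₀ : ℝ) : ℂ) * u₀ + -(g₀ - G₀) * v₀)
  linarith

/-- Estimate of the error terms at the two ends of a truncated approximate eigenvector. -/
lemma norm_edge_sq_le {l a b : ℝ} (hla : l ^ 2 + a ^ 2 = 1) {z c w : ℂ} (hz : ‖z‖ = 1)
    (hc : ‖c‖ ^ 2 ≤ b) (hw : ‖w‖ ^ 2 ≤ b) :
    ‖(l : ℂ) * c‖ ^ 2 + ‖(a : ℂ) * c - z * w‖ ^ 2 ≤ 5 * b := by
  have h1 := norm_smul_add_smul_sq_le hla c 0
  have h2 := norm_smul_add_smul_sq_le (l := a) (a := l) (by rw [add_comm]; exact hla) c 0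
  have h3 := norm_add_sq_le_two (a * c) (-(z * w))
  rw [mul_zero, add_zero, norm_zero] at h1 h2
  rw [norm_neg, norm_mul z, hz, one_mul, ← sub_eq_add_neg] at h3
  linarith

/-- Restriction of a sequence to `[1, M]`. -/
def cutoff (M : ℕ) (u : ℕ → ℂ) (k : ℕ) : ℂ := if 1 ≤ k ∧ k ≤ M then u k else 0

lemma sum_ring_le {q m : ℕ} [NeZero q] (hq : m + 3 ≤ q) {l a ρ : ℝ} (hla : l ^ 2 + a ^ 2 = 1)
    {f : ZMod q → ℝ} {g : ZMod q → ℂ}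
    (hfg : ∀ n, (f n : ℂ) ^ 2 + g n * (starRingEnd ℂ) (g n) = 1) {F : ℕ → ℝ} {G u v : ℕ → ℂ}
    (hf : ∀ k : ℕ, k ≤ m + 1 → |f k - F k| ≤ ρ) (hg : ∀ k : ℕ, k ≤ m + 1 → ‖g k - G k‖ ≤ ρ) {z : ℂ}
    (hz : ‖z‖ = 1) :
    ∑ r, (‖walkP l a f g (fun r => cutoff (m + 1) u r.val) (fun r => cutoff (m + 1) v r.val) r
          - z * cutoff (m + 1) u r.val‖ ^ 2
        + ‖walkM l a f g (fun r => cutoff (m + 1) u r.val) (fun r => cutoff (m + 1) v r.val) r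
          - z * cutoff (m + 1) v r.val‖ ^ 2)
    ≤ ∑ i ∈ Finset.range m,
        (2 * ‖l * (F (i + 1) * u (i + 1) - G (i + 1) * v (i + 1))
            - a * ((starRingEnd ℂ) (G (i + 2)) * u (i + 2) + F (i + 2) * v (i + 2))
            - z * u (i + 2)‖ ^ 2
          + 2 * ‖l * ((starRingEnd ℂ) (G (i + 2)) * u (i + 2) + F (i + 2) * v (i + 2))
            + a * (F (i + 1) * u (i + 1) - G (i + 1) * v (i + 1)) - z * v (i + 1)‖ ^ 2
          + 8 * ρ ^ 2 * ((‖u (i + 1)‖ ^ 2 + ‖v (i + 1)‖ ^ 2)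
            + (‖u (i + 2)‖ ^ 2 + ‖v (i + 2)‖ ^ 2)))
      + 5 * (‖u 1‖ ^ 2 + ‖v 1‖ ^ 2) + 5 * (‖u (m + 1)‖ ^ 2 + ‖v (m + 1)‖ ^ 2) := by
  set U : ZMod q → ℂ := fun r => cutoff (m + 1) u r.val with hU
  set V : ZMod q → ℂ := fun r => cutoff (m + 1) v r.val with hV
  set T : ZMod q → ℝ := fun r => ‖walkP l a f g U V (r + 1) - z * U (r + 1)‖ ^ 2
    + ‖walkM l a f g U V r - z * V r‖ ^ 2 with hT
  have hsum : ∑ r, (‖walkP l a f g U V r - z * U r‖ ^ 2 + ‖walkM l a f g U V r - z * V r‖ ^ 2)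
      = ∑ r, T r := by
    rw [Finset.sum_add_distrib, Finset.sum_add_distrib]
    congr 1
    exact (Equiv.sum_comp (Equiv.addRight (1 : ZMod q))
      (fun r => ‖walkP l a f g U V r - z * U r‖ ^ 2)).symm
  have hval : ∀ k : ℕ, k < q → (k : ZMod q).val = k := fun k hk => ZMod.val_natCast_of_lt hk
  have hUin : ∀ k : ℕ, 1 ≤ k → k ≤ m + 1 → U k = u k := fun k h1 h2 => by
    simp only [hU]; rw [hval k (by lia), cutoff, if_pos ⟨h1, h2⟩]
  have hVin : ∀ k : ℕ, 1 ≤ k → k ≤ m + 1 → V k = v k := fun k h1 h2 => by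
    simp only [hV]; rw [hval k (by lia), cutoff, if_pos ⟨h1, h2⟩]
  have hUout : ∀ k : ℕ, k ≤ q → (k = 0 ∨ m + 2 ≤ k) → U k = 0 := fun k hk h => by
    simp only [hU]
    rcases hk.lt_or_eq with hk | rfl
    · rw [hval k hk, cutoff, if_neg (by lia)]
    · rw [ZMod.natCast_self, ZMod.val_zero, cutoff, if_neg (by lia)]
  have hVout : ∀ k : ℕ, k ≤ q → (k = 0 ∨ m + 2 ≤ k) → V k = 0 := fun k hk h => by
    simp only [hV]
    rcases hk.lt_or_eq with hk | rfl
    · rw [hval k hk, cutoff, if_neg (by lia)]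
    · rw [ZMod.natCast_self, ZMod.val_zero, cutoff, if_neg (by lia)]
  have hTk : ∀ k : ℕ, T k = ‖l * (f k * U k - g k * V k)
        - a * ((starRingEnd ℂ) (g (k + 1 : ℕ)) * U (k + 1 : ℕ) + f (k + 1 : ℕ) * V (k + 1 : ℕ))
        - z * U (k + 1 : ℕ)‖ ^ 2
      + ‖l * ((starRingEnd ℂ) (g (k + 1 : ℕ)) * U (k + 1 : ℕ) + f (k + 1 : ℕ) * V (k + 1 : ℕ))
        + a * (f k * U k - g k * V k) - z * V k‖ ^ 2 := fun k => by
    simp only [hT, walkP, walkM, coinP, coinM, add_sub_cancel_right, Nat.cast_add, Nat.cast_one]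
  rw [hsum, ← sum_range_eq_sum_zmod T]
  have hsub : ∑ k ∈ Finset.range (m + 2), T k = ∑ k ∈ Finset.range q, T k := by
    refine Finset.sum_subset (Finset.range_subset_range.2 (by lia)) fun k hk hk' => ?_
    rw [Finset.mem_range] at hk hk'
    rw [hTk, hUout k (by lia) (by lia), hVout k (by lia) (by lia), hUout (k + 1) (by lia) (by lia),
      hVout (k + 1) (by lia) (by lia)]
    simp
  rw [← hsub, Finset.sum_range_succ, Finset.sum_range_succ']
  refine add_le_add (add_le_add (Finset.sum_le_sum fun i hi => ?_) ?_) ?_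
  · rw [Finset.mem_range] at hi
    rw [hTk, hUin (i + 1) (by lia) (by lia), hVin (i + 1) (by lia) (by lia),
      hUin (i + 1 + 1) (by lia) (by lia), hVin (i + 1 + 1) (by lia) (by lia)]
    exact coin_perturb_sq_le hla (hf _ (by lia)) (hf _ (by lia)) (hg _ (by lia)) (hg _ (by lia))
  · rw [hTk, hUout 0 (by lia) (by lia), hVout 0 (by lia) (by lia), hUin (0 + 1) (by lia) (by lia),
      hVin (0 + 1) (by lia) (by lia)]
    have hn := norm_coin_sq (u := fun _ => u 1) (v := fun _ => v 1) hfg (0 + 1 : ℕ)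
    rw [coinM] at hn
    have hc : ‖(starRingEnd ℂ) (g (0 + 1 : ℕ)) * u 1 + f (0 + 1 : ℕ) * v 1‖ ^ 2
        ≤ ‖u 1‖ ^ 2 + ‖v 1‖ ^ 2 := by
      rw [← hn]; exact le_add_of_nonneg_left (sq_nonneg _)
    have := norm_edge_sq_le (l := l) (a := -a) (by rw [neg_sq]; exact hla) hz hc
      (le_add_of_nonneg_right (sq_nonneg ‖v 1‖))
    rw [add_comm] at this
    refine le_trans (le_of_eq ?_) this
    simp
  · rw [hTk, hUin (m + 1) (by lia) (by lia), hVin (m + 1) (by lia) (by lia),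
      hUout (m + 1 + 1) (by lia) (by lia), hVout (m + 1 + 1) (by lia) (by lia)]
    have hn := norm_coin_sq (u := fun _ => u (m + 1)) (v := fun _ => v (m + 1)) hfg (m + 1 : ℕ)
    rw [coinP] at hn
    have hc : ‖f (m + 1 : ℕ) * u (m + 1) - g (m + 1 : ℕ) * v (m + 1)‖ ^ 2
        ≤ ‖u (m + 1)‖ ^ 2 + ‖v (m + 1)‖ ^ 2 := by
      rw [← hn]; exact le_add_of_nonneg_right (sq_nonneg _)
    refine le_trans (le_of_eq ?_) (norm_edge_sq_le hla hz hc
      (le_add_of_nonneg_left (sq_nonneg ‖u (m + 1)‖)))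
    simp

lemma phase_add (Φ θ : ℝ) (j : ℤ) (k : ℕ) :
    phase Φ θ (j + k) = phase Φ θ j + k • (Φ : UnitAddCircle) := by
  rw [nsmul_coe_eq, phase, phase, ← AddCircle.coe_add]
  congr 1
  push_cast
  ring

lemma hasSum_window {e : ℤ → ℝ} {S : ℝ} (h : HasSum e S) (M : ℕ) :
    HasSum (fun j : ℤ => ∑ i ∈ Finset.range M, e (j + (i + 1 : ℕ))) (M * S) := by
  have := hasSum_sum (f := fun (i : ℕ) (j : ℤ) => e (j + (i + 1 : ℕ))) (a := fun _ => S)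
    (s := Finset.range M)
    (fun i _ => (Equiv.addRight ((i + 1 : ℕ) : ℤ)).hasSum_iff.2 h)
  simpa only [Finset.sum_const, Finset.card_range, nsmul_eq_mul] using this

/-- A window on which an `ℓ²` sequence with small total error has small relative error. -/
lemma exists_window {e b : ℤ → ℝ} {S S' : ℝ} (hS : 0 < S) (he : HasSum e S') (hb : HasSum b S)
    {m : ℕ} (hS' : 2 * (m + 1 : ℕ) * S' ≤ S) : ∃ j : ℤ,
    2 * ∑ i ∈ Finset.range (m + 1), e (j + (i + 1 : ℕ)) + 5 * b (j + (1 : ℕ))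
        + 5 * b (j + (m + 1 : ℕ))
      < 12 / (m + 1 : ℕ) * ∑ i ∈ Finset.range (m + 1), b (j + (i + 1 : ℕ)) := by
  by_contra! hcon
  have h1 := ((hasSum_window hb (m + 1)).mul_left (12 / (m + 1 : ℕ) : ℝ))
  have hsh : ∀ k : ℕ, HasSum (fun j : ℤ => b (j + k)) S := fun k =>
    (Equiv.addRight (k : ℤ)).hasSum_iff.2 hb
  have h2 := (((hasSum_window he (m + 1)).mul_left 2).add ((hsh 1).mul_left 5)).add
    ((hsh (m + 1)).mul_left 5)
  have h3 := hasSum_le hcon h1 h2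
  have hm : (0 : ℝ) < (m + 1 : ℕ) := by positivity
  rw [← mul_assoc, div_mul_cancel₀ _ hm.ne'] at h3
  linarith

lemma sum_cutoff {q m : ℕ} [NeZero q] (hq : m + 3 ≤ q) (u v : ℕ → ℂ) :
    ∑ r : ZMod q, (‖cutoff (m + 1) u r.val‖ ^ 2 + ‖cutoff (m + 1) v r.val‖ ^ 2)
      = ∑ i ∈ Finset.range (m + 1), (‖u (i + 1)‖ ^ 2 + ‖v (i + 1)‖ ^ 2) := by
  rw [← sum_range_eq_sum_zmod
    (fun r : ZMod q => ‖cutoff (m + 1) u r.val‖ ^ 2 + ‖cutoff (m + 1) v r.val‖ ^ 2)]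
  have h1 : ∀ k ∈ Finset.range q, ‖cutoff (m + 1) u (k : ZMod q).val‖ ^ 2
      + ‖cutoff (m + 1) v (k : ZMod q).val‖ ^ 2
      = ‖cutoff (m + 1) u k‖ ^ 2 + ‖cutoff (m + 1) v k‖ ^ 2 := fun k hk => by
    rw [ZMod.val_natCast_of_lt (Finset.mem_range.1 hk)]
  rw [Finset.sum_congr rfl h1, ← Finset.sum_subset (Finset.range_subset_range.2
    (show m + 2 ≤ q by lia)), Finset.sum_range_succ']
  · have h0 : ∀ w : ℕ → ℂ, cutoff (m + 1) w 0 = 0 := fun w => by simp [cutoff]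
    rw [h0, h0]
    simp only [norm_zero, ne_eq, OfNat.ofNat_ne_zero, not_false_eq_true, zero_pow, add_zero]
    refine Finset.sum_congr rfl fun k hk => ?_
    rw [Finset.mem_range] at hk
    rw [cutoff, cutoff, if_pos (by lia), if_pos (by lia)]
  · intro k _ hk
    rw [Finset.mem_range] at hk
    rw [cutoff, cutoff, if_neg (by lia), if_neg (by lia)]
    simp

lemma exists_norm_trace_of_spectrum {t l1 l2 Φ θ : ℝ} {z : ℂ}
    (hl1 : l1 ∈ Set.Ioo (0 : ℝ) 1) (hl2 : l2 ∈ Set.Ioo (0 : ℝ) 1) {W : H2 →L[ℂ] H2}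
    (hW : ∀ (ψ : H2) (n : ℤ),
      W ψ n 0 = wPlus t l1 l2 Φ θ (fun m => ψ m) n ∧
      W ψ n 1 = wMinus t l1 l2 Φ θ (fun m => ψ m) n)
    (hz : z ∈ spectrum ℂ W) : ‖z‖ = 1 ∧ ∀ m q : ℕ, m + 3 ≤ q → ∀ β : ℝ,
      q • (β : UnitAddCircle) = 0 → ∀ ε ≥ 0,
      12 / (m + 1 : ℕ) + 16 * (7 * (m + 1 : ℕ) * |β - Φ|) ^ 2 ≤ ε ^ 2 →
      ∃ z' : ℂ, ‖z'‖ = 1 ∧ ‖z' - z‖ ≤ ε ∧ ∃ x, ‖(ct β (szego t l1 l2 z') q x).trace‖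
        = 2 * ∏ j ∈ Finset.range q, (l1 * |fT t l2 (x + j • (β : UnitAddCircle))|) := by
  obtain ⟨hz1, happ⟩ := exists_walk_approx hl1 hl2 hW hz
  refine ⟨hz1, fun m q hq β hβ ε hε hεb => ?_⟩
  have : NeZero q := ⟨by lia⟩
  have hla : l1 ^ 2 + sq1 l1 ^ 2 = 1 := by rw [sq1_sq hl1]; ring
  have hm : (0 : ℝ) < (m + 1 : ℕ) := by positivity
  obtain ⟨u, v, S, hS, hb, S', hS', he⟩ := happ (Real.sqrt (1 / (2 * (m + 1 : ℕ)))) (by positivity)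
  rw [Real.sq_sqrt (by positivity), one_div, inv_mul_eq_div, le_div_iff₀ (by positivity),
    mul_comm] at hS'
  obtain ⟨j, hj⟩ := exists_window hS he hb hS'
  set ρ : ℝ := 7 * (m + 1 : ℕ) * |β - Φ| with hρ
  set y : ZMod q → UnitAddCircle := fun r => phase Φ θ j + r.val • (β : UnitAddCircle) with hy
  have hmod : ∀ n : ℕ, (n % q) • (β : UnitAddCircle) = n • (β : UnitAddCircle) := fun n => by
    conv_rhs => rw [← Nat.mod_add_div n q, add_smul, mul_comm, mul_smul, hβ, smul_zero, add_zero]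
  have hystep : ∀ r, y (r + 1) = y r + (β : UnitAddCircle) := fun r => by
    simp only [hy]
    rw [ZMod.val_add, hmod, add_smul, ← add_assoc]
    congr 1
    rw [ZMod.val_one_eq_one_mod, hmod, one_smul]
  have hdist : ∀ k : ℕ, k ≤ m + 1 → ‖ec (y k) - ec (phase Φ θ (j + k))‖ ≤ ρ := fun k hk => by
    refine (norm_ec_sub_le _ _).trans ?_
    simp only [hy]
    rw [ZMod.val_natCast_of_lt (by lia), phase_add, add_sub_add_left_eq_sub, nsmul_coe_eq,
      nsmul_coe_eq, ← AddCircle.coe_sub, ← mul_sub]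
    refine (mul_le_mul_of_nonneg_left (norm_coe_le_abs _) (by positivity)).trans ?_
    rw [abs_mul, Nat.abs_cast, hρ]
    have hk' : (k : ℝ) ≤ (m + 1 : ℕ) := by exact_mod_cast hk
    have hpi : 2 * Real.pi ≤ 7 := by linarith [Real.pi_lt_d2]
    calc 2 * Real.pi * (k * |β - Φ|) ≤ 7 * ((m + 1 : ℕ) * |β - Φ|) := by gcongr
      _ = _ := by ring
  set b : ℤ → ℝ := fun n => ‖u n‖ ^ 2 + ‖v n‖ ^ 2 with hbdef
  have hring := sum_ring_le hq hla (fun n => fT_sq_add (t := t) hl2 (y n))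
    (F := fun k => fT t l2 (phase Φ θ (j + k))) (G := fun k => gT t l2 (phase Φ θ (j + k)))
    (u := fun k => u (j + k)) (v := fun k => v (j + k))
    (fun k hk => (abs_fT_sub_le hl2 _ _).trans (hdist k hk))
    (fun k hk => (norm_gT_sub_le hl2 _ _).trans (hdist k hk)) hz1
  have hcut := sum_cutoff hq (fun k => u (j + k)) (fun k => v (j + k))
  set B : ℝ := ∑ i ∈ Finset.range (m + 1), b (j + (i + 1 : ℕ)) with hB
  have hb0 : ∀ n, 0 ≤ b n := fun n => add_nonneg (sq_nonneg _) (sq_nonneg _)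
  set eP : ℤ → ℝ := fun n => ‖walkP l1 (sq1 l1) (fun n => fT t l2 (phase Φ θ n))
    (fun n => gT t l2 (phase Φ θ n)) u v n - z * u n‖ ^ 2 with heP
  set eM : ℤ → ℝ := fun n => ‖walkM l1 (sq1 l1) (fun n => fT t l2 (phase Φ θ n))
    (fun n => gT t l2 (phase Φ θ n)) u v n - z * v n‖ ^ 2 with heM
  have hP0 : ∀ n, 0 ≤ eP n := fun n => sq_nonneg _
  have hM0 : ∀ n, 0 ≤ eM n := fun n => sq_nonneg _
  refine exists_near_norm_trace_eq (y := y)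
      (u := fun r => cutoff (m + 1) (fun k => u (j + k)) r.val)
    (v := fun r => cutoff (m + 1) (fun k => v (j + k)) r.val) hl1 hl2 hystep hε ?_ ?_
  · rw [hcut]
    have h0 : 0 ≤ 2 * ∑ i ∈ Finset.range (m + 1), (eP (j + (i + 1 : ℕ)) + eM (j + (i + 1 : ℕ)))
        + 5 * b (j + (1 : ℕ)) + 5 * b (j + (m + 1 : ℕ)) := by
      have := Finset.sum_nonneg (s := Finset.range (m + 1))
        fun i _ => add_nonneg (hP0 (j + (i + 1 : ℕ))) (hM0 (j + (i + 1 : ℕ)))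
      have h1 := hb0 (j + (1 : ℕ))
      have h2 := hb0 (j + (m + 1 : ℕ))
      positivity
    exact pos_of_mul_pos_right (h0.trans_lt hj) (by positivity)
  · rw [hcut]
    refine hring.trans ?_
    have hterm : ∀ i : ℕ,
        (2 * ‖l1 * (fT t l2 (phase Φ θ (j + (i + 1 : ℕ))) * u (j + (i + 1 : ℕ))
              - gT t l2 (phase Φ θ (j + (i + 1 : ℕ))) * v (j + (i + 1 : ℕ)))
            - sq1 l1 * ((starRingEnd ℂ) (gT t l2 (phase Φ θ (j + (i + 2 : ℕ))))
              * u (j + (i + 2 : ℕ)) + fT t l2 (phase Φ θ (j + (i + 2 : ℕ))) * v (j + (i + 2 : ℕ)))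
            - z * u (j + (i + 2 : ℕ))‖ ^ 2
          + 2 * ‖l1 * ((starRingEnd ℂ) (gT t l2 (phase Φ θ (j + (i + 2 : ℕ))))
              * u (j + (i + 2 : ℕ)) + fT t l2 (phase Φ θ (j + (i + 2 : ℕ))) * v (j + (i + 2 : ℕ)))
            + sq1 l1 * (fT t l2 (phase Φ θ (j + (i + 1 : ℕ))) * u (j + (i + 1 : ℕ))
              - gT t l2 (phase Φ θ (j + (i + 1 : ℕ))) * v (j + (i + 1 : ℕ)))
            - z * v (j + (i + 1 : ℕ))‖ ^ 2)
        = 2 * eP (j + (i + 1 + 1 : ℕ)) + 2 * eM (j + (i + 1 : ℕ)) := fun i => by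
      have e1 : j + ((i + 2 : ℕ) : ℤ) - 1 = j + (i + 1 : ℕ) := by push_cast; ring
      have e2 : j + ((i + 1 : ℕ) : ℤ) + 1 = j + (i + 2 : ℕ) := by push_cast; ring
      simp only [heP, heM, walkP, walkM, coinP, coinM, e2, e1]
    have hPs : ∑ i ∈ Finset.range m, eP (j + (i + 1 + 1 : ℕ))
        ≤ ∑ i ∈ Finset.range (m + 1), eP (j + (i + 1 : ℕ)) := by
      rw [Finset.sum_range_succ' (fun i : ℕ => eP (j + (i + 1 : ℕ)))]
      exact le_add_of_nonneg_right (hP0 _)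
    have hMs : ∑ i ∈ Finset.range m, eM (j + (i + 1 : ℕ))
        ≤ ∑ i ∈ Finset.range (m + 1), eM (j + (i + 1 : ℕ)) := by
      rw [Finset.sum_range_succ (fun i : ℕ => eM (j + (i + 1 : ℕ)))]
      exact le_add_of_nonneg_right (hM0 _)
    have hbs : ∑ i ∈ Finset.range m, b (j + (i + 1 : ℕ)) ≤ B := by
      rw [hB, Finset.sum_range_succ (fun i : ℕ => b (j + (i + 1 : ℕ)))]
      exact le_add_of_nonneg_right (hb0 _)
    have hbs' : ∑ i ∈ Finset.range m, b (j + (i + 1 + 1 : ℕ)) ≤ B := by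
      rw [hB, Finset.sum_range_succ' (fun i : ℕ => b (j + (i + 1 : ℕ)))]
      exact le_add_of_nonneg_right (hb0 _)
    have hB0 : 0 ≤ B := Finset.sum_nonneg fun i _ => hb0 _
    have hfin := mul_le_mul_of_nonneg_right hεb hB0
    have hρ2 : 0 ≤ ρ ^ 2 := sq_nonneg ρ
    have hj' : 2 * (∑ i ∈ Finset.range (m + 1), eP (j + (i + 1 : ℕ))
        + ∑ i ∈ Finset.range (m + 1), eM (j + (i + 1 : ℕ))) + 5 * b (j + (1 : ℕ))
        + 5 * b (j + (m + 1 : ℕ)) < 12 / (m + 1 : ℕ) * B := by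
      rw [← Finset.sum_add_distrib]
      exact hj
    have hX := mul_le_mul_of_nonneg_left (add_le_add hbs hbs')
        (mul_nonneg (by norm_num : (0:ℝ) ≤ 8) hρ2)
    refine le_trans ?_ hfin
    simp only [hterm]
    rw [Finset.sum_add_distrib, Finset.sum_add_distrib, ← Finset.mul_sum, ← Finset.mul_sum,
      ← Finset.mul_sum, Finset.sum_add_distrib]
    change _ + 8 * ρ ^ 2 * (∑ i ∈ Finset.range m, b (j + (i + 1 : ℕ))
      + ∑ i ∈ Finset.range m, b (j + (i + 1 + 1 : ℕ))) + 5 * b (j + (1 : ℕ))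
        + 5 * b (j + (m + 1 : ℕ)) ≤ _
    linarith

lemma exists_coprime_approx (Φ : ℝ) {M : ℕ} (hM : 1 ≤ M) (k : ℕ) :
    ∃ p : ℤ, IsCoprime p ((M * 2 ^ k : ℕ) : ℤ) ∧
      |(p : ℝ) / (M * 2 ^ k : ℕ) - Φ| ≤ 2 / 2 ^ k := by
  have hM0 : (0 : ℝ) < M := by exact_mod_cast hM
  set s : ℤ := ⌊((M * 2 ^ k : ℕ) * Φ - 1) / (2 * M)⌋ with hs
  refine ⟨1 + 2 * M * s, ?_, ?_⟩
  · rw [Nat.cast_mul, Nat.cast_pow]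
    have h : ∀ a b : ℤ, IsCoprime (1 + a * b) a := fun a b => ⟨1, -b, by ring⟩
    refine IsCoprime.mul_right ?_ (IsCoprime.pow_right ?_)
    · rw [show (2 * M * s : ℤ) = M * (2 * s) by ring]; exact h _ _
    · rw [show (2 * M * s : ℤ) = 2 * (M * s) by ring]; exact h _ _
  · have h1 := Int.floor_le (((M * 2 ^ k : ℕ) * Φ - 1) / (2 * M))
    have h2 := Int.lt_floor_add_one (((M * 2 ^ k : ℕ) * Φ - 1) / (2 * M))
    rw [← hs] at h1 h2
    rw [le_div_iff₀ (by positivity)] at h1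
    rw [div_lt_iff₀ (by positivity)] at h2
    push_cast at h1 h2 ⊢
    have hq : (0 : ℝ) < M * 2 ^ k := by positivity
    have he : (1 + 2 * (M : ℝ) * s) / (M * 2 ^ k) - Φ
        = (1 + 2 * M * s - M * 2 ^ k * Φ) / (M * 2 ^ k) := by
      field_simp
    have he' : (2 : ℝ) / 2 ^ k = 2 * M / (M * 2 ^ k) := by
      field_simp
    rw [he, he', abs_div, abs_of_pos hq]
    gcongr
    rw [abs_le]
    constructor <;> nlinarith

lemma mul_self_eq_trace_smul_sub (X : Matrix (Fin 2) (Fin 2) ℂ) :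
    X * X = X.trace • X - X.det • (1 : Matrix (Fin 2) (Fin 2) ℂ) := by
  ext i j
  fin_cases i <;> fin_cases j <;>
    simp [Matrix.mul_apply, Fin.sum_univ_two, Matrix.trace_fin_two, Matrix.det_fin_two] <;> ring

lemma IsTrigCocycle.lI_two_mul_le {c B : ℝ} {ζ₁ ζ₂ : ℂ}
    {A : UnitAddCircle → Matrix (Fin 2) (Fin 2) ℂ} (H : IsTrigCocycle c B ζ₁ ζ₂ A) {α : ℝ} {q : ℕ}
    (hq : q • (α : UnitAddCircle) = 0) {T N P E : ℝ} (hT : ∀ x, ‖(ct α A q x).trace‖ ≤ T)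
    (hN : ∀ x, ‖ct α A q x‖ ≤ N)
    (hP : ∀ x, ∏ j ∈ Finset.range q, wt c ζ₁ ζ₂ (x + j • (α : UnitAddCircle)) ≤ P)
    (hE : T * N + 2 * P ^ 2 ≤ E) : lI α A (2 * q) ≤ Real.log E := by
  have hle : ∀ᵐ x, lphi α A (2 * q) x ≤ Real.log E := by
    filter_upwards [H.ae_reg α] with x hx
    refine Real.log_le_log (H.norm_ct_pos hx _) (le_trans ?_ hE)
    rw [two_mul, ct_add, hq, add_zero, mul_self_eq_trace_smul_sub]
    refine (norm_sub_le _ _).trans ?_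
    rw [frob_smul, frob_smul, H.norm_det_ct]
    have hp0 : 0 ≤ ∏ j ∈ Finset.range q, wt c ζ₁ ζ₂ (x + j • (α : UnitAddCircle)) :=
      Finset.prod_nonneg fun j _ => H.wt_nonneg _
    have hP' := pow_le_pow_left₀ hp0 (hP x) 2
    have h1 := frob_one_le
    have hT0 : 0 ≤ T := (norm_nonneg _).trans (hT x)
    have h2 := mul_le_mul (hT x) (hN x) (norm_nonneg _) hT0
    have h3 := mul_le_mul hP' h1 (norm_nonneg _) (sq_nonneg P)
    linarith
  have := integral_mono_ae (H.integrable_lphi α (2 * q)) (integrable_const (Real.log E)) hle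
  simpa [lI] using this

lemma exists_scales {b : ℝ} {a Q : ℕ} (hab : b ≤ a) (hQ : 1 ≤ Q) :
    ∃ r k m : ℕ, k + 1 ≤ (41 + 8 * a) * Q ∧ 9 * ((1 : ℝ) / 2 ^ r) ≤ Real.exp (-(b * Q)) ∧
      (2 : ℝ) / 2 ^ k ≤ 9 * (1 / 2 ^ r) ∧ m + 3 ≤ 2 ^ k ∧ ∀ s : ℝ, 0 ≤ s → s ≤ 2 / 2 ^ k →
        12 / (m + 1 : ℕ) + 16 * (7 * (m + 1 : ℕ) * s) ^ 2 ≤ ((1 : ℝ) / 2 ^ r) ^ 2 := by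
  obtain ⟨r, hr⟩ : ∃ r, r = 4 + 2 * (a * Q) := ⟨_, rfl⟩
  obtain ⟨n, hn⟩ : ∃ n, n = 12 + 2 * r := ⟨_, rfl⟩
  obtain ⟨m, hm1⟩ : ∃ m, m + 1 = 2 ^ n := ⟨2 ^ n - 1, Nat.sub_add_cancel Nat.one_le_two_pow⟩
  refine ⟨r, 2 * n, m, ?_, ?_, ?_, ?_, fun s hs hsk => ?_⟩
  · have h41 : (41 + 8 * a) * Q = 41 * Q + 8 * (a * Q) := by ring
    lia
  · have h1 : Real.exp (b * Q) ≤ 4 ^ (a * Q) := by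
      refine (Real.exp_le_exp.2 (show b * Q ≤ ((a * Q : ℕ) : ℝ) * 1 by
        push_cast; rw [mul_one]; gcongr)).trans ?_
      rw [Real.exp_nat_mul]
      gcongr
      linarith [Real.exp_one_lt_d9]
    have h2 : (0 : ℝ) ≤ 4 ^ (a * Q) := by positivity
    have h3 : (2 : ℝ) ^ r = 16 * 4 ^ (a * Q) := by rw [hr, pow_add, pow_mul]; norm_num
    rw [Real.exp_neg, mul_one_div, inv_eq_one_div, div_le_div_iff₀ (by positivity) (by positivity),
      one_mul, h3]
    linarith
  · have h1 : (2 : ℝ) ^ r ≤ 2 ^ (2 * n) := pow_le_pow_right₀ (by norm_num) (by lia)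
    rw [mul_one_div]
    gcongr
    norm_num
  · have h4 : 2 ^ 2 ≤ 2 ^ n := Nat.pow_le_pow_right (by norm_num) (by lia)
    rw [two_mul, pow_add, ← hm1] at *
    nlinarith
  · rw [hm1]
    obtain ⟨y, hy⟩ : ∃ y : ℝ, y = 2 ^ n := ⟨_, rfl⟩
    have hyk : (2 : ℝ) ^ (2 * n) = y ^ 2 := by rw [hy, ← pow_mul, mul_comm]
    have hyr : y = 4096 * (2 ^ r) ^ 2 := by rw [hy, hn, pow_add, ← pow_mul, mul_comm r]; norm_num
    have hy0 : 0 < y := by rw [hy]; positivity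
    have hy1 : 1 ≤ y := by rw [hy]; exact one_le_pow₀ (by norm_num)
    have h1 : 7 * y * s ≤ 14 / y := by
      refine (mul_le_mul_of_nonneg_left hsk (by positivity)).trans (le_of_eq ?_)
      rw [hyk]; field_simp; norm_num
    have h2 : (7 * y * s) ^ 2 ≤ (14 / y) ^ 2 := by gcongr
    have h3 : (14 / y) ^ 2 ≤ 196 / y := by
      rw [div_pow, div_le_div_iff₀ (by positivity) hy0]
      nlinarith
    have h4 : ((1 : ℝ) / 2 ^ r) ^ 2 = 4096 / y := by
      rw [hyr]; field_simp
    rw [h4, Nat.cast_pow, Nat.cast_ofNat, ← hy]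
    have h5 : 12 / y + 16 * (196 / y) ≤ 4096 / y := by
      rw [← mul_div_assoc, ← add_div]
      gcongr
      norm_num
    linarith

lemma lyap_le_log_rate {t l1 l2 Φ θ : ℝ} {z : ℂ}
    (ht : t ∈ Set.Ioo (-1 : ℝ) 1) (ht0 : t ≠ 0)
    (hl1 : l1 ∈ Set.Ioo (0 : ℝ) 1) (hl2 : l2 ∈ Set.Ioo (0 : ℝ) 1) (hΦ : Irrational Φ)
    {W : H2 →L[ℂ] H2}
    (hW : ∀ (ψ : H2) (n : ℤ),
      W ψ n 0 = wPlus t l1 l2 Φ θ (fun m => ψ m) n ∧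
      W ψ n 1 = wMinus t l1 l2 Φ θ (fun m => ψ m) n)
    (hz : z ∈ spectrum ℂ W) {ζ₁ ζ₂ : ℂ} (hζ₁ : ‖ζ₁‖ = 1) (hζ₂ : ‖ζ₂‖ = 1) {c : ℝ}
    (hc : c = l1 * |t| * l2 / (1 + t ^ 2)) (hw : ∀ x, wt c ζ₁ ζ₂ x = l1 * |fT t l2 x|) {R : ℝ}
    (hcR : c ≤ R)
    (hR : ∀ z' : ℂ, ‖z'‖ = 1 → ∀ n : ℕ, ‖(szegoNeg t l1 l2 z' ^ n).trace‖ ≤ 2 * R ^ n ∧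
      ‖(szegoPos t l1 l2 z' ^ n).trace‖ ≤ 2 * R ^ n) {L : ℝ}
    (hL : Filter.Tendsto (fun n : ℕ => lI Φ (szego t l1 l2 z) n / n) Filter.atTop (nhds L))
    (hLn : ∀ n : ℕ, n * L ≤ lI Φ (szego t l1 l2 z) n) :
    L ≤ Real.log R := by
  obtain ⟨hz1, hnear⟩ := exists_norm_trace_of_spectrum hl1 hl2 hW hz
  have hcyc : ∀ z' : ℂ, ‖z'‖ = 1 → IsTrigCocycle c 36 ζ₁ ζ₂ (szego t l1 l2 z') := fun z' hz' => by
    subst hc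
    exact isTrigCocycle_szego ht ht0 hl1 hl2 hζ₁ hζ₂ hw hz'
  have H := hcyc z hz1
  have hc0 := H.c_pos
  have hR0 : 0 < R := hc0.trans_le hcR
  have hlog := Real.log_le_log hc0 hcR
  by_contra! hlt
  obtain ⟨κ, hκ, hκ1, hκu⟩ : ∃ κ : ℝ, 0 < κ ∧ κ ≤ 1 ∧ 100 * κ ≤ L - Real.log R :=
    ⟨min 1 ((L - Real.log R) / 100), lt_min one_pos (by linarith), min_le_left _ _, by
      have := min_le_right 1 ((L - Real.log R) / 100); linarith⟩
  obtain ⟨c₃, hc₃, k₀, hk₀, hunif⟩ := H.exists_uniform_lower hΦ hL hLn hκ hκ1 (by linarith)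
  obtain ⟨a, hca⟩ := exists_nat_ge c₃
  obtain ⟨Q, hQN, hQ1, hQ⟩ := hunif (41 + 8 * a) (⌈1 / κ⌉₊)
  have hQκ : 1 ≤ κ * Q := by
    have h1 : 1 / κ ≤ Q := (Nat.le_ceil _).trans (by exact_mod_cast hQN)
    rwa [div_le_iff₀' hκ] at h1
  obtain ⟨r, k, m, hkD, h2r, hkr, hmk, hεb⟩ := exists_scales hca hQ1
  obtain ⟨q, hqdef⟩ : ∃ q, q = k₀ * Q * 2 ^ k := ⟨_, rfl⟩
  have hM1 : 1 ≤ k₀ * Q := Nat.mul_pos hk₀ hQ1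
  obtain ⟨p, hpq, hpΦ⟩ := exists_coprime_approx Φ hM1 k
  rw [← hqdef] at hpq hpΦ
  have hqk : 2 ^ k ≤ q := hqdef ▸ Nat.le_mul_of_pos_left _ hM1
  have hq0 : 0 < q := (by positivity : 0 < 2 ^ k).trans_le hqk
  obtain ⟨β, hβ⟩ : ∃ β : ℝ, β = p / q := ⟨_, rfl⟩
  rw [← hβ] at hpΦ
  have hβ0 : q • (β : UnitAddCircle) = 0 := by
    rw [nsmul_coe_eq, hβ, mul_div_cancel₀ _ (by positivity)]
    exact (AddCircle.coe_eq_zero_iff (1 : ℝ)).2 ⟨p, by simp⟩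
  obtain ⟨z', hz', hzz, x₀, hx₀⟩ := hnear m q (hmk.trans hqk) β hβ0 (1 / 2 ^ r) (by positivity)
    (hεb _ (abs_nonneg _) hpΦ)
  have H' := hcyc z' hz'
  obtain ⟨hlow, hup, hprod⟩ := hQ β (szego t l1 l2 z') H' (hpΦ.trans (hkr.trans h2r))
    fun x => (norm_szego_sub_le hl1 hl2 hz1 hz' x).trans
      ((mul_le_mul_of_nonneg_left hzz (by norm_num)).trans h2r)
  have hqQ : k₀ * 2 ^ k * Q = q := by rw [hqdef]; ring
  have hup := hup (k₀ * 2 ^ k) (Nat.mul_pos hk₀ (by positivity))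
  have hprod := hprod (k₀ * 2 ^ k)
  rw [hqQ] at hup hprod
  have hlow := hlow (k + 1) hkD
  rw [show k₀ * Q * 2 ^ (k + 1) = 2 * q by rw [hqdef]; ring] at hlow
  have htr : ∀ x, ‖(ct β (szego t l1 l2 z') q x).trace‖
      ≤ 10 * Real.exp (q * (Real.log R + κ)) := fun x => by
    have h1 := norm_trace_sub_le (szego_eq t l1 l2 z') hq0 hpq x x₀
    rw [← hβ] at h1
    obtain ⟨h2, h3⟩ := hR z' hz' q
    have h4 : ‖(ct β (szego t l1 l2 z') q x₀).trace‖ ≤ 2 * Real.exp (q * (Real.log c + κ)) := by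
      rw [hx₀]
      simpa only [hw] using mul_le_mul_of_nonneg_left (hprod x₀) (by norm_num : (0 : ℝ) ≤ 2)
    have h5 : Real.exp (q * (Real.log c + κ)) ≤ Real.exp (q * (Real.log R + κ)) := by gcongr
    have h6 : R ^ q ≤ Real.exp (q * (Real.log R + κ)) := by
      rw [Real.exp_nat_mul, Real.exp_add, Real.exp_log hR0]
      gcongr
      exact le_mul_of_one_le_right hR0.le (Real.one_le_exp hκ.le)
    have h7 := norm_le_norm_sub_add (ct β (szego t l1 l2 z') q x).trace
      (ct β (szego t l1 l2 z') q x₀).trace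
    linarith
  have hfin := H'.lI_two_mul_le hβ0 htr hup hprod
    (E := 12 * Real.exp (q * (Real.log R + L + 2 * κ))) (by
      rw [mul_assoc, ← Real.exp_add, ← Real.exp_nat_mul]
      have e1 : q * (Real.log R + κ) + q * (L + κ) = q * (Real.log R + L + 2 * κ) := by ring
      have e2 : Real.exp ((2 : ℕ) * (q * (Real.log c + κ)))
          ≤ Real.exp (q * (Real.log R + L + 2 * κ)) := by
        rw [show ((2 : ℕ) : ℝ) * (q * (Real.log c + κ)) = q * (2 * Real.log c + 2 * κ) by
          push_cast; ring]
        gcongr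
        linarith
      rw [e1]
      linarith)
  rw [Real.log_mul (by norm_num) (Real.exp_pos _).ne', Real.log_exp] at hfin
  have h12 : Real.log 12 ≤ 11 := by
    have := Real.log_le_sub_one_of_pos (show (0 : ℝ) < 12 by norm_num); linarith
  have hqQ' : κ * Q ≤ κ * q := by
    have : Q ≤ q := by rw [← hqQ]; exact Nat.le_mul_of_pos_left _ (Nat.mul_pos hk₀ (by positivity))
    gcongr
  have hmul := mul_le_mul_of_nonneg_left hκu (Nat.cast_nonneg (α := ℝ) q)
  push_cast at hlow
  nlinarith

lemma norm_coc_SzP {t l1 l2 : ℝ} {z : ℂ} (hl1 : l1 ∈ Set.Ioo (0 : ℝ) 1) (hz : ‖z‖ = 1) {c : ℝ}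
    {ζ₁ ζ₂ : ℂ} (hw : ∀ x, wt c ζ₁ ζ₂ x = l1 * |fT t l2 x|) (Φ : ℝ) (n : ℕ) (x : ℝ) :
    ‖coc Φ (SzP t l1 l2 z) n x‖ =
      (∏ j ∈ Finset.range n, wt c ζ₁ ζ₂ ((x : UnitAddCircle) + j • (Φ : UnitAddCircle)))⁻¹
        * ‖ct Φ (szego t l1 l2 z) n x‖ := by
  have hscal : ∀ n : ℕ, ∃ s : ℂ, coc Φ (SzP t l1 l2 z) n x = s • ct Φ (szego t l1 l2 z) n x ∧
      ‖s‖ = (∏ j ∈ Finset.range n,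
        wt c ζ₁ ζ₂ ((x : UnitAddCircle) + j • (Φ : UnitAddCircle)))⁻¹ := fun n => by
    induction n with
    | zero => exact ⟨1, by simp [coc, ct], by simp⟩
    | succ n ih =>
      obtain ⟨s, h1, h2⟩ := ih
      have hx : ((x + n * Φ : ℝ) : UnitAddCircle) = x + n • (Φ : UnitAddCircle) := by
        rw [nsmul_coe_eq, AddCircle.coe_add]
      refine ⟨z⁻¹ / ((l1 : ℂ) * ((|fS t l2 (x + n * Φ)| : ℝ) : ℂ)) * s, ?_, ?_⟩
      · rw [coc, ct, h1, SzP, Dz_eq_szego, hx, Matrix.smul_mul, Matrix.mul_smul, smul_smul]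
      · rw [norm_mul, h2, Finset.prod_range_succ, hw ((x : UnitAddCircle) + n • _), ← hx,
          ← fS_eq_fT, norm_div, norm_inv, hz, norm_mul, Complex.norm_real, Complex.norm_real,
          Real.norm_of_nonneg hl1.1.le, Real.norm_of_nonneg (abs_nonneg _), mul_inv_rev, inv_one,
          one_div, mul_inv_rev]
  obtain ⟨s, h1, h2⟩ := hscal n
  rw [h1, frob_smul, h2]

lemma hasLyap_SzP {t l1 l2 : ℝ} {z : ℂ} (hl1 : l1 ∈ Set.Ioo (0 : ℝ) 1) (hz : ‖z‖ = 1) {c B : ℝ}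
    {ζ₁ ζ₂ : ℂ} (hw : ∀ x, wt c ζ₁ ζ₂ x = l1 * |fT t l2 x|)
    (H : IsTrigCocycle c B ζ₁ ζ₂ (szego t l1 l2 z)) {Φ L : ℝ}
    (hL : Filter.Tendsto (fun n : ℕ => lI Φ (szego t l1 l2 z) n / n) Filter.atTop (nhds L)) :
    HasLyap Φ (SzP t l1 l2 z) (L - Real.log c) := by
  refine (hL.sub_const (Real.log c)).congr' ?_
  filter_upwards [Filter.eventually_ne_atTop 0] with n hn
  set F : UnitAddCircle → ℝ := fun x => Real.log
    ((∏ j ∈ Finset.range n, wt c ζ₁ ζ₂ (x + j • (Φ : UnitAddCircle)))⁻¹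
        * ‖ct Φ (szego t l1 l2 z) n x‖) with hF
  have h1 : ∫ x in (0 : ℝ)..1, Real.log ‖coc Φ (SzP t l1 l2 z) n x‖ = ∫ x, F x := by
    simp only [norm_coc_SzP hl1 hz hw]
    have := UnitAddCircle.intervalIntegral_preimage 0 F
    rwa [zero_add] at this
  have h2 : ∀ᵐ x, F x = lphi Φ (szego t l1 l2 z) n x
      - ∑ j ∈ Finset.range n, Real.log (wt c ζ₁ ζ₂ (x + j • (Φ : UnitAddCircle))) := by
    filter_upwards [H.ae_reg Φ] with x hx
    have hp := Finset.prod_pos (s := Finset.range n) fun j _ => hx j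
    rw [hF]
    simp only
    rw [Real.log_mul (inv_pos.2 hp).ne' (H.norm_ct_pos hx n).ne', Real.log_inv,
      Real.log_prod fun j _ => (hx j).ne', lphi]
    ring
  have h3 : ∫ x, ∑ j ∈ Finset.range n, Real.log (wt c ζ₁ ζ₂ (x + j • (Φ : UnitAddCircle)))
      = n * Real.log c := by
    rw [integral_finsetSum _ fun j _ => H.integrable_log_wt.comp_add_right _]
    have : ∀ j : ℕ, ∫ x, Real.log (wt c ζ₁ ζ₂ (x + j • (Φ : UnitAddCircle))) = Real.log c :=
      fun j => (integral_add_right_eq_self (fun x => Real.log (wt c ζ₁ ζ₂ x)) _).trans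
        H.integral_log_wt
    simp [this]
  rw [h1, integral_congr_ae h2, integral_sub (H.integrable_lphi Φ n) (H.integrable_sum_log_wt Φ n),
    h3, ← lI]
  have hn' : (n : ℝ) ≠ 0 := by exact_mod_cast hn
  field_simp

/-- Lyapunov exponent of the Szegő cocycle in the singular case
`λ₂ ∈ [(1−t²)/(1+t²), 1)`, for `z` in the spectrum of the walk operator. -/
theorem lyapunov_singular
    (t l1 l2 Φ θ : ℝ) (z : ℂ)
    (ht : t ∈ Set.Ioo (-1 : ℝ) 1) (ht0 : t ≠ 0)
    (hl1 : l1 ∈ Set.Ioo (0 : ℝ) 1)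
    (hl2 : l2 ∈ Set.Ico ((1 - t ^ 2) / (1 + t ^ 2)) 1)
    (hΦ : Irrational Φ)
    (W : H2 →L[ℂ] H2)
    (hW : ∀ (ψ : H2) (n : ℤ),
      W ψ n 0 = wPlus t l1 l2 Φ θ (fun m => ψ m) n ∧
      W ψ n 1 = wMinus t l1 l2 Φ θ (fun m => ψ m) n)
    (hz : z ∈ spectrum ℂ W) :
    ((1 - t ^ 2) / (1 + t ^ 2) ≤ l1 →
      HasLyap Φ (SzP t l1 l2 z) 0) ∧
    (l1 < (1 - t ^ 2) / (1 + t ^ 2) →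
      HasLyap Φ (SzP t l1 l2 z)
        (Real.log (((1 - t ^ 2) * sq1 l1 +
          Real.sqrt ((1 + t ^ 2) ^ 2 * (sq1 l1) ^ 2 - 4 * t ^ 2)) / (2 * |t| * l1)))) := by
  have hl20 : 0 < l2 := lt_of_lt_of_le (div_pos (by nlinarith [ht.1, ht.2]) (by positivity)) hl2.1
  have hl2' : l2 ∈ Set.Ioo (0 : ℝ) 1 := ⟨hl20, hl2.2⟩
  have hz1 := (exists_norm_trace_of_spectrum hl1 hl2' hW hz).1
  obtain ⟨ζ₁, ζ₂, h1, h2, hw⟩ := exists_factor ht ht0 hl2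
  have hw' := fun x => hw l1 x hl1.1.le
  have H := isTrigCocycle_szego ht ht0 hl1 hl2' h1 h2 hw' hz1
  obtain ⟨R, hcR, hR, hRL, hval0, hval⟩ := exists_rate ht ht0 hl1 hl2' rfl hz1 H
  obtain ⟨L, hL, hLn, -⟩ := H.exists_lyap Φ
  have hLR := le_antisymm (lyap_le_log_rate ht ht0 hl1 hl2' hΦ hW hz h1 h2 rfl hw' hcR hR hL hLn)
    (hRL Φ L hL)
  have hmain := hasLyap_SzP hl1 hz1 hw' H hL
  rw [hLR] at hmain
  exact ⟨fun h => hval0 h ▸ hmain, fun h => hval h ▸ hmain⟩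

end
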